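/- If G is a 6-critical graph, then |E(G)| ≥ (5·|V(G)| + 3)/2, i.e., 2·|E(G)| ≥ 5·|V(G)| + 3. -/

import Mathlib

open SimpleGraph

variable {V : Type*}

/-- `c` is a proper edge coloring of `G` using colors `0, …, n-1`:
every edge gets a color `< n`, and distinct edges sharing an endpoint
receive distinct colors. -/
def IsProperEdgeColoring (G : SimpleGraph V) (n : ℕ) (c : Sym2 V → ℕ) : Prop :=
  (∀ e ∈ G.edgeSet, c e < n) ∧
    ∀ e₁ ∈ G.edgeSet, ∀ e₂ ∈ G.edgeSet, e₁ ≠ e₂ → (∃ v, v ∈ e₁ ∧ v ∈ e₂) →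
      c e₁ ≠ c e₂

/-- The edge chromatic number `χ'(G)`: the least number of colors in a proper
edge coloring of `G`. -/
noncomputable def edgeChromaticNumber (G : SimpleGraph V) : ℕ :=
  sInf {n | ∃ c, IsProperEdgeColoring G n c}

/-- The degree `d_G(v)` of a vertex. -/
noncomputable def deg (G : SimpleGraph V) (v : V) : ℕ := (G.neighborSet v).ncard

/-- The maximum vertex degree `Δ(G)`. -/
noncomputable def maxDeg (G : SimpleGraph V) : ℕ := sSup {d | ∃ v, deg G v = d}

/-- `G` is critical: it is class 2 (i.e. `χ'(G) ≠ Δ(G)`) and every proper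
subgraph `H` of `G` satisfies `χ'(H) < χ'(G)`. -/
def IsCritical (G : SimpleGraph V) : Prop :=
  edgeChromaticNumber G ≠ maxDeg G ∧
    ∀ H : G.Subgraph, H ≠ ⊤ → edgeChromaticNumber H.coe < edgeChromaticNumber G

/-- `G` is `k`-critical: critical with maximum degree `k`. -/
def IsKCritical (G : SimpleGraph V) (k : ℕ) : Prop :=
  IsCritical G ∧ maxDeg G = k

namespace Kempe

/-- `c` is a proper edge coloring of `H` with colors in `κ`; pairs that are not edges are mapped
to `none`. -/
structure IsColoring {κ : Type*} (H : SimpleGraph V) (c : V → V → Option κ) : Prop where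
  symm : ∀ u v, c u v = c v u
  inj : ∀ {u v w k}, c u v = some k → c u w = some k → v = w
  dom : ∀ u v, (∃ k, c u v = some k) ↔ H.Adj u v

/-- The color `k` does not occur at the vertex `v`. -/
def Missing {κ : Type*} (c : V → V → Option κ) (v : V) (k : κ) : Prop := ∀ u, c v u ≠ some k

variable {κ : Type*} {G H : SimpleGraph V} {c : V → V → Option κ}

section Recolor
open Classical

/-- Replace the color of the pair `x`, `y` by `o`. -/
noncomputable def recolor (c : V → V → Option κ) (x y : V) (o : Option κ) : V → V → Option κ :=
  fun u v => if s(u, v) = s(x, y) then o else c u v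

theorem recolor_of_ne {x y u v : V} {o : Option κ} (h : s(u, v) ≠ s(x, y)) :
    recolor c x y o u v = c u v := if_neg h

theorem recolor_self {x y : V} {o : Option κ} : recolor c x y o x y = o := if_pos rfl

theorem IsColoring.insert (hc : IsColoring H c) {x y : V} {k : κ}
    (hx : Missing c x k) (hy : Missing c y k)
    (hG : ∀ u v, G.Adj u v ↔ H.Adj u v ∨ s(u, v) = s(x, y)) :
    IsColoring G (recolor c x y (some k)) := by
  have hxy : x ≠ y := ((hG x y).2 (Or.inr rfl)).ne
  refine ⟨fun u v => ?_, fun {u v w l} => ?_, fun u v => ?_⟩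
  · simp only [recolor, Sym2.eq_swap (a := u), hc.symm u v]
  · simp only [recolor]
    intro h1 h2
    split_ifs at h1 h2 with a b b
    · simp only [Sym2.eq_iff] at a b
      grind
    · obtain rfl := Option.some.inj h1
      simp only [Sym2.eq_iff] at a
      rcases a with ⟨rfl, rfl⟩ | ⟨rfl, rfl⟩
      · exact absurd h2 (hx _)
      · exact absurd h2 (hy _)
    · obtain rfl := Option.some.inj h2
      simp only [Sym2.eq_iff] at b
      rcases b with ⟨rfl, rfl⟩ | ⟨rfl, rfl⟩
      · exact absurd h1 (hx _)
      · exact absurd h1 (hy _)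
    · exact hc.inj h1 h2
  · rw [hG, ← hc.dom]
    simp only [recolor]
    split_ifs with h <;> simp [h]

theorem IsColoring.erase (hc : IsColoring H c) (x y : V) :
    IsColoring (H.deleteEdges {s(x, y)}) (recolor c x y none) := by
  refine ⟨fun u v => ?_, fun {u v w l} => ?_, fun u v => ?_⟩
  · simp only [recolor, Sym2.eq_swap (a := u), hc.symm u v]
  · simp only [recolor]
    intro h1 h2
    split_ifs at h1 h2
    exact hc.inj h1 h2
  · rw [deleteEdges_adj, ← hc.dom]
    simp only [recolor]
    split_ifs with h <;> simp [h]

end Recolor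

theorem adj_iff_delete {x y : V} (h : G.Adj x y) (u v : V) :
    G.Adj u v ↔ (G.deleteEdges {s(x, y)}).Adj u v ∨ s(u, v) = s(x, y) := by
  simp only [deleteEdges_adj, Set.mem_singleton_iff]
  by_cases e : s(u, v) = s(x, y)
  · simp only [e, not_true, and_false, false_or, iff_true]
    simp only [Sym2.eq_iff] at e
    rcases e with ⟨rfl, rfl⟩ | ⟨rfl, rfl⟩
    exacts [h, h.symm]
  · simp [e]

/-- `G` has no proper edge coloring with colors in `κ`. -/
def Uncolorable (κ : Type*) (G : SimpleGraph V) : Prop :=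
  ∀ c : V → V → Option κ, ¬ IsColoring G c

theorem not_both_missing (hG : Uncolorable κ G) {x y : V} (h : G.Adj x y)
    (hc : IsColoring (G.deleteEdges {s(x, y)}) c) {k : κ} (hx : Missing c x k) :
    ¬ Missing c y k :=
  fun hy => hG _ (hc.insert hx hy (adj_iff_delete h))

/-- Uncolor the edge `xz` and give its color to the uncolored edge `xy`. -/
theorem IsColoring.shift {x y z : V} (hxy : G.Adj x y)
    (hc : IsColoring (G.deleteEdges {s(x, y)}) c) {k : κ} (hy : Missing c y k)
    (hz : c x z = some k) :
    IsColoring (G.deleteEdges {s(x, z)}) (recolor (recolor c x z none) x y (some k)) := by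
  have hxz : (G.deleteEdges {s(x, y)}).Adj x z := (hc.dom _ _).1 ⟨k, hz⟩
  have hyz : s(x, z) ≠ s(x, y) := by simpa using (deleteEdges_adj.1 hxz).2
  refine (hc.erase x z).insert (fun u => ?_) (fun u => ?_) fun u v => ?_
  · by_cases e : s(x, u) = s(x, z)
    · simp [recolor, e]
    · rw [recolor_of_ne e]
      intro h
      exact e (by rw [hc.inj h hz])
  · by_cases e : s(y, u) = s(x, z)
    · simp [recolor, e]
    · rw [recolor_of_ne e]
      exact hy u
  · have := adj_iff_delete hxy u v
    simp only [deleteEdges_adj, Set.mem_singleton_iff] at this ⊢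
    grind

section Swap
open Classical

/-- `S` is a union of components of the graph formed by the edges colored `i` or `j`. -/
def Closed (c : V → V → Option κ) (i j : κ) (S : Set V) : Prop :=
  ∀ u v, c u v = some i ∨ c u v = some j → (u ∈ S ↔ v ∈ S)

/-- Exchange the colors `i` and `j` on `S`. -/
noncomputable def swapOn (c : V → V → Option κ) (i j : κ) (S : Set V) : V → V → Option κ :=
  fun u v => if u ∈ S then (c u v).map (Equiv.swap i j) else c u v

theorem swapOn_of_notMem {i j : κ} {S : Set V} {u v : V} (h : u ∉ S) :
    swapOn c i j S u v = c u v := if_neg h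

theorem swapOn_of_mem {i j : κ} {S : Set V} {u v : V} (h : u ∈ S) (k : κ) :
    swapOn c i j S u v = some k ↔ c u v = some (Equiv.swap i j k) := by
  simp only [swapOn, h, if_true, Option.map_eq_some_iff]
  constructor
  · rintro ⟨a, ha, rfl⟩
    simpa using ha
  · intro h
    exact ⟨_, h, by simp⟩

theorem IsColoring.swapOn (hc : IsColoring H c) {i j : κ} {S : Set V} (hS : Closed c i j S) :
    IsColoring H (swapOn c i j S) := by
  refine ⟨fun u v => ?_, fun {u v w l} => ?_, fun u v => ?_⟩
  · by_cases h : u ∈ S ↔ v ∈ S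
    · simp only [Kempe.swapOn, h, hc.symm u v]
    · have h1 : ∀ k, c u v = some k → k ≠ i ∧ k ≠ j := fun k hk =>
        ⟨fun e => h (hS u v (Or.inl (e ▸ hk))), fun e => h (hS u v (Or.inr (e ▸ hk)))⟩
      have h2 : (c u v).map (Equiv.swap i j) = c u v := by
        cases e : c u v with
        | none => rfl
        | some k => simp [Equiv.swap_apply_of_ne_of_ne (h1 k e).1 (h1 k e).2]
      simp only [Kempe.swapOn, ← hc.symm u v, h2, ite_self]
  · by_cases h : u ∈ S
    · rw [swapOn_of_mem h, swapOn_of_mem h]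
      exact hc.inj
    · rw [swapOn_of_notMem h, swapOn_of_notMem h]
      exact hc.inj
  · rw [← hc.dom]
    by_cases h : u ∈ S
    · simp only [swapOn_of_mem h]
      exact ⟨fun ⟨k, hk⟩ => ⟨_, hk⟩, fun ⟨k, hk⟩ => ⟨Equiv.swap i j k, by simpa using hk⟩⟩
    · simp only [swapOn_of_notMem h]

theorem missing_swapOn_of_mem {i j : κ} {S : Set V} {v : V} (h : v ∈ S) (k : κ) :
    Missing (swapOn c i j S) v k ↔ Missing c v (Equiv.swap i j k) := by
  simp only [Missing, ne_eq, swapOn_of_mem h]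

theorem missing_swapOn_of_notMem {i j : κ} {S : Set V} {v : V} (h : v ∉ S) (k : κ) :
    Missing (swapOn c i j S) v k ↔ Missing c v k := by
  simp only [Missing, ne_eq, swapOn_of_notMem h]

theorem missing_swapOn_of_ne {i j : κ} {S : Set V} {v : V} {k : κ} (hi : k ≠ i) (hj : k ≠ j) :
    Missing (swapOn c i j S) v k ↔ Missing c v k := by
  by_cases h : v ∈ S
  · rw [missing_swapOn_of_mem h, Equiv.swap_apply_of_ne_of_ne hi hj]
  · rw [missing_swapOn_of_notMem h]

end Swap

/-- The vertices joined to `v` by a path with colors `i` and `j`. -/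
def comp (c : V → V → Option κ) (i j : κ) (v : V) : Set V :=
  {w | Relation.ReflTransGen (fun a b => c a b = some i ∨ c a b = some j) v w}

theorem mem_comp_self {i j : κ} {v : V} : v ∈ comp c i j v := Relation.ReflTransGen.refl

theorem comp_closed (hc : IsColoring H c) (i j : κ) (v : V) : Closed c i j (comp c i j v) :=
  fun a b h => ⟨fun ha => Relation.ReflTransGen.tail ha h,
    fun hb => Relation.ReflTransGen.tail hb (by rwa [hc.symm b a])⟩

theorem mem_comp_of_mem {i j : κ} {u v w : V} (hc : IsColoring H c) (hu : u ∈ comp c i j w)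
    (hv : u ∈ comp c i j v) : v ∈ comp c i j w := by
  have : Std.Symm (fun a b => c a b = some i ∨ c a b = some j) :=
    ⟨fun a b h => by rwa [hc.symm b a]⟩
  exact Relation.ReflTransGen.trans hu (symm hv)

/-- A two-colored path has at most two ends. -/
theorem card_ends_le_two [Fintype V] [DecidableEq κ] (hc : IsColoring H c) (i j : κ) (v : V)
    (T : Finset V) (hT : ∀ w ∈ T, w ∈ comp c i j v ∧ (Missing c w i ∨ Missing c w j)) :
    T.card ≤ 2 := by
  classical
  let S : Finset V := Finset.univ.filter (· ∈ comp c i j v)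
  let K : SimpleGraph S :=
    { Adj := fun a b => c a b = some i ∨ c a b = some j
      symm := ⟨fun a b h => by rwa [hc.symm b a]⟩
      loopless := ⟨fun a h => by
        rcases h with h | h <;> exact H.loopless.irrefl _ ((hc.dom _ _).1 ⟨_, h⟩)⟩ }
  have hv : v ∈ S := by simp [S, mem_comp_self]
  have hreach : ∀ w (hw : w ∈ comp c i j v),
      K.Reachable ⟨v, hv⟩ ⟨w, by simpa [S] using hw⟩ := by
    intro w hw
    induction hw with
    | refl => exact SimpleGraph.Reachable.refl _
    | tail h1 h2 ih =>
      exact ih.trans (SimpleGraph.Adj.reachable (G := K) h2)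
  have hconn : K.Connected := by
    have : Nonempty S := ⟨⟨v, hv⟩⟩
    refine ⟨fun a b => ?_⟩
    have ha := hreach a ((Finset.mem_filter.1 a.2).2)
    have hb := hreach b ((Finset.mem_filter.1 b.2).2)
    exact ha.symm.trans hb
  have h1 := hconn.card_vert_le_card_edgeSet_add_one
  have h2 := K.sum_degrees_eq_twice_card_edges
  have hdeg : ∀ a : S, K.degree a + (if (a : V) ∈ T then 1 else 0) ≤ 2 := by
    intro a
    have hsub : ∀ (l : Finset κ), (∀ b, K.Adj a b → ∃ k ∈ l, c a b = some k) →
        K.degree a ≤ l.card := by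
      intro l hl
      rw [← K.card_neighborFinset_eq_degree, ← Finset.card_map (s := l) Function.Embedding.some]
      refine Finset.card_le_card_of_injOn (fun b => c a b) (fun b hb => ?_) ?_
      · obtain ⟨k, hk, e⟩ := hl b (by simpa using hb)
        simp [e, hk]
      · intro b hb d hd e
        obtain ⟨k, hk, e1⟩ := hl b (by simpa using hb)
        exact Subtype.ext (hc.inj e1 (e.symm.trans e1))
    split_ifs with haT
    · rcases (hT _ haT).2 with hm | hm
      · have := hsub {j} (fun b hb => ⟨j, by simp, hb.resolve_left (hm b)⟩)
        simp at this; omega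
      · have := hsub {i} (fun b hb => ⟨i, by simp, hb.resolve_right (hm b)⟩)
        simp at this; omega
    · have := hsub {i, j} (fun b hb => by rcases hb with h | h <;> simp [h])
      have h3 : ({i, j} : Finset κ).card ≤ 2 := Finset.card_le_two
      omega
  have h3 : ∑ a : S, (K.degree a + (if (a : V) ∈ T then 1 else 0)) ≤ ∑ _a : S, 2 :=
    Finset.sum_le_sum fun a _ => hdeg a
  have h4 : ∑ a : S, (if (a : V) ∈ T then 1 else 0) = T.card := by
    rw [Finset.sum_coe_sort S (fun a => if a ∈ T then 1 else 0), Finset.sum_ite_mem,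
      Finset.inter_eq_right.2 (fun w hw => by simpa [S] using (hT w hw).1)]
    simp
  rw [Finset.sum_add_distrib, h2, h4] at h3
  simp only [Finset.sum_const, Finset.card_univ, smul_eq_mul] at h3
  rw [Nat.card_eq_fintype_card, Nat.card_eq_fintype_card, ← SimpleGraph.edgeFinset_card] at h1
  omega

/-- The numbers of missing and of present colors at a vertex add up to the number of colors. -/
theorem card_missing_add [Finite V] [Fintype κ] (hc : IsColoring H c) (v : V) :
    {k | Missing c v k}.ncard + deg H v = Fintype.card κ := by
  classical
  have : deg H v = {k | ¬ Missing c v k}.ncard := by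
    have key : ∀ k, ¬ Missing c v k ↔ ∃ u, c v u = some k := by simp [Missing]
    simp only [key]
    have hf : ∀ u ∈ H.neighborSet v, ∃ k, c v u = some k := fun u hu => (hc.dom v u).2 hu
    choose f hf using hf
    refine Set.ncard_congr f (fun u hu => ⟨u, hf u hu⟩) ?_ ?_
    · intro a b ha hb e
      have h := hf b hb
      rw [← e] at h
      exact hc.inj (hf a ha) h
    · rintro k ⟨u, hu⟩
      have : u ∈ H.neighborSet v := (hc.dom v u).1 ⟨k, hu⟩
      exact ⟨u, this, Option.some.inj ((hf u this).symm.trans hu)⟩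
  rw [this, ← Nat.card_eq_fintype_card]
  exact Set.ncard_add_ncard_compl {k | Missing c v k}

theorem deg_delete [Finite V] {x y : V} (h : G.Adj x y) :
    deg (G.deleteEdges {s(x, y)}) x + 1 = deg G x := by
  have : G.neighborSet x = insert y ((G.deleteEdges {s(x, y)}).neighborSet x) := by
    ext u
    simp only [mem_neighborSet, Set.mem_insert_iff, deleteEdges_adj, Set.mem_singleton_iff,
      Sym2.eq_iff, not_or]
    constructor
    · intro hu
      by_cases e : u = y <;> simp [e, hu]
      intro _ e2; exact absurd (e2 ▸ hu) (G.loopless.irrefl _)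
    · rintro (rfl | h) <;> tauto
  rw [deg, deg, this, Set.ncard_insert_of_notMem (by simp)]

theorem deg_delete_of_ne {x y v : V} (hx : v ≠ x) (hy : v ≠ y) :
    deg (G.deleteEdges {s(x, y)}) v = deg G v := by
  have : (G.deleteEdges {s(x, y)}).neighborSet v = G.neighborSet v := by
    ext u
    simp only [mem_neighborSet, deleteEdges_adj, Set.mem_singleton_iff, Sym2.eq_iff]
    grind
  rw [deg, deg, this]

end Kempe

namespace Kempe

variable {κ : Type*} {G H : SimpleGraph V} {c c' : V → V → Option κ} {x y : V}

/-- `Fan c x y l` says that the reverse of `l` is a list of distinct vertices starting with `x`, in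
which the color of the edge from `y` to each later vertex is missing at its predecessor. -/
inductive Fan (c : V → V → Option κ) (x y : V) : List V → Prop
  | base : Fan c x y [x]
  | step {v w : V} {l : List V} {k : κ} (h : Fan c x y (w :: l)) (hw : Missing c w k)
      (hv : c y v = some k) (hn : v ∉ w :: l) : Fan c x y (v :: w :: l)

theorem Fan.congr {l : List V} (h : Fan c x y l) (h1 : ∀ w ∈ l, c' y w = c y w)
    (h2 : ∀ w ∈ l.tail, ∀ k, Missing c w k → Missing c' w k) : Fan c' x y l := by
  induction h with
  | base => exact .base
  | step h hw hv hn ih =>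
    exact .step (ih (fun w hw => h1 w (by simp [hw])) fun w hw => h2 w (by
      simpa using Or.inr hw)) (h2 _ (by simp) _ hw) ((h1 _ (by simp)).trans hv) hn

theorem Fan.exists_of_mem {l : List V} (h : Fan c x y l) {w : V} (hw : w ∈ l) :
    ∃ l', Fan c x y (w :: l') ∧ (w :: l').length ≤ l.length := by
  induction h with
  | base => exact ⟨[], by simpa using (List.mem_singleton.1 hw) ▸ Fan.base, by simp⟩
  | @step v u l k h hu hv hn ih =>
    rcases List.mem_cons.1 hw with rfl | hw
    · exact ⟨_, .step h hu hv hn, le_rfl⟩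
    · obtain ⟨l', h1, h2⟩ := ih hw
      exact ⟨l', h1, h2.trans (by simp)⟩

theorem Fan.ne {l : List V} (h : Fan c x y l) (hc : IsColoring H c) (hxy : x ≠ y) {w : V}
    (hw : w ∈ l) : w ≠ y := by
  induction h with
  | base => exact (List.mem_singleton.1 hw) ▸ hxy
  | step h hu hv hn ih =>
    rcases List.mem_cons.1 hw with rfl | hw
    · exact ((hc.dom _ _).1 ⟨_, hv⟩).ne'
    · exact ih hw

theorem Fan.not_both_missing (hG : Uncolorable κ G) (hxy : G.Adj x y) {l : List V} :
    ∀ {c : V → V → Option κ} {v : V} {k : κ}, IsColoring (G.deleteEdges {s(x, y)}) c →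
      Fan c x y (v :: l) → Missing c v k → ¬ Missing c y k := by
  induction l with
  | nil =>
    intro c v k hc h hv
    cases h
    exact Kempe.not_both_missing hG hxy hc hv
  | cons w l ih =>
    intro c v k hc h hv hy
    cases h with
    | @step _ _ _ j h hw hj hn =>
    have hvy := (hc.dom _ _).1 ⟨_, hj⟩
    have hwy := h.ne hc hxy.ne (w := w) (by simp)
    have hr : ∀ {a b o}, a ≠ y → a ≠ v → recolor c y v o a b = c a b := by
      intro a b o h1 h2
      exact recolor_of_ne (by simp [h1, h2])
    have hr' : ∀ {a o}, a ≠ v → recolor c y v o y a = c y a := by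
      intro a o h1
      exact recolor_of_ne (by simp only [ne_eq, Sym2.eq_iff]; grind)
    have hwv : w ≠ v := fun e => hn (by simp [e])
    have hm : ∀ {a i}, Missing c a i → Missing (recolor c y v none) a i := by
      intro a i h b
      simp only [recolor]
      split_ifs
      · simp
      · exact h b
    have hm' : ∀ {a i o}, a ≠ y → a ≠ v → Missing c a i → Missing (recolor c y v o) a i := by
      intro a i o h1 h2 h b
      rw [hr h1 h2]
      exact h b
    have hc' := (hc.erase y v).insert (hm hy) (hm hv) (adj_iff_delete hvy)
    have hcc : recolor (recolor c y v none) y v (some k) = recolor c y v (some k) := by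
      funext a b
      simp only [recolor]
      split_ifs <;> rfl
    rw [hcc] at hc'
    refine ih hc' (h.congr (fun a ha => hr' fun e => hn (e ▸ ha)) fun a ha i hi => ?_)
      (hm' hwy hwv hw) (fun a ha => ?_)
    · exact hm' (h.ne hc hxy.ne (List.mem_of_mem_tail ha))
        (fun e => hn (e ▸ List.mem_of_mem_tail ha)) hi
    · by_cases e : a = v
      · subst e
        rw [recolor_self] at ha
        obtain rfl := Option.some.inj ha
        exact hy _ hj
      · rw [hr' e] at ha
        exact e (hc.inj ha hj)

theorem Fan.mem_comp (hG : Uncolorable κ G) (hxy : G.Adj x y)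
    (hc : IsColoring (G.deleteEdges {s(x, y)}) c) {i j : κ} (hy : Missing c y j) {n : ℕ} :
    ∀ {l : List V} {u : V}, l.length = n → Fan c x y (u :: l) → Missing c u i →
      u ∈ comp c i j y := by
  induction n using Nat.strong_induction_on with
  | _ n ih =>
  intro l u hl h hu
  by_contra hn
  have hyS : y ∉ comp c i j u := fun hy' => hn (mem_comp_of_mem hc mem_comp_self hy')
  have hc' := hc.swapOn (comp_closed hc i j u)
  refine Fan.not_both_missing hG hxy (k := j) hc' (h.congr ?_ ?_) ?_ ?_
  · intro w _
    rw [swapOn_of_notMem hyS]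
  · intro w hw k hk
    obtain ⟨l', h1, h2⟩ := (h.exists_of_mem (List.mem_of_mem_tail hw))
    obtain ⟨l'', h3, h4⟩ : ∃ l'', Fan c x y (w :: l'') ∧ l''.length < n := by
      cases h with
      | base => simp at hw
      | step h5 _ _ _ =>
        obtain ⟨l'', h3, h4⟩ := h5.exists_of_mem hw
        exact ⟨l'', h3, by simp at h4 hl; omega⟩
    have hkj : k ≠ j := fun e => Fan.not_both_missing hG hxy hc h3 hk (e ▸ hy)
    by_cases hki : k = i
    · subst hki
      have := ih _ h4 rfl h3 hk
      rw [missing_swapOn_of_notMem]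
      · exact hk
      · intro hw'
        exact hn (mem_comp_of_mem hc this hw')
    · rwa [missing_swapOn_of_ne hki hkj]
  · rw [missing_swapOn_of_mem mem_comp_self]
    simpa using hu
  · rwa [missing_swapOn_of_notMem hyS]

theorem Fan.unique [Fintype V] (hG : Uncolorable κ G) (hxy : G.Adj x y)
    (hc : IsColoring (G.deleteEdges {s(x, y)}) c) {j : κ} (hy : Missing c y j) {i : κ}
    {l l' : List V} {u v : V} (h : Fan c x y (u :: l)) (h' : Fan c x y (v :: l'))
    (hu : Missing c u i) (hv : Missing c v i) : u = v := by
  classical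
  by_contra e
  have := card_ends_le_two hc i j y {y, u, v} (by
    intro w hw
    simp only [Finset.mem_insert, Finset.mem_singleton] at hw
    rcases hw with rfl | rfl | rfl
    · exact ⟨mem_comp_self, Or.inr hy⟩
    · exact ⟨Fan.mem_comp hG hxy hc hy rfl h hu, Or.inl hu⟩
    · exact ⟨Fan.mem_comp hG hxy hc hy rfl h' hv, Or.inl hv⟩)
  rw [Finset.card_eq_three.2 ⟨y, u, v, (h.ne hc hxy.ne (by simp)).symm,
    (h'.ne hc hxy.ne (by simp)).symm, e, rfl⟩] at this
  omega

theorem Fan.exists_step {l : List V} {w v : V} {k : κ} (h : Fan c x y (w :: l))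
    (hw : Missing c w k) (hv : c y v = some k) : ∃ l', Fan c x y (v :: l') := by
  by_cases e : v ∈ w :: l
  · exact (h.exists_of_mem e).imp fun _ h => h.1
  · exact ⟨_, h.step hw hv e⟩

/-- Vizing's adjacency lemma. -/
theorem vizing_adjacency [Fintype V] [Fintype κ] (hG : Uncolorable κ G)
    (hd : ∀ v, deg G v ≤ Fintype.card κ) (hxy : G.Adj x y)
    (hc : IsColoring (G.deleteEdges {s(x, y)}) c) :
    Fintype.card κ + 1 ≤
      deg G x + {w | G.Adj y w ∧ w ≠ x ∧ deg G w = Fintype.card κ}.ncard := by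
  classical
  let F : Finset V := Finset.univ.filter fun v => ∃ l, Fan c x y (v :: l)
  let M : V → Finset κ := fun v => Finset.univ.filter (Missing c v)
  have hF : ∀ {v}, v ∈ F ↔ ∃ l, Fan c x y (v :: l) := by simp [F]
  have hM : ∀ {v k}, k ∈ M v ↔ Missing c v k := by simp [M]
  have hMcard : ∀ v, (M v).card + deg (G.deleteEdges {s(x, y)}) v = Fintype.card κ := by
    intro v
    rw [← card_missing_add hc v]
    congr 1
    rw [← Set.ncard_coe_finset]
    congr 1
    ext k
    simp [hM]
  have hxF : x ∈ F := hF.2 ⟨_, .base⟩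
  have hadj : ∀ v ∈ F, v ≠ x → (G.deleteEdges {s(x, y)}).Adj y v := by
    intro v hv hvx
    obtain ⟨l, h⟩ := hF.1 hv
    cases h with
    | base => exact absurd rfl hvx
    | step _ _ h _ => exact (hc.dom _ _).1 ⟨_, h⟩
  have hyx : ∀ k, c y x ≠ some k := fun k hk => by
    have := (hc.dom _ _).1 ⟨k, hk⟩
    simp [deleteEdges_adj, Sym2.eq_swap] at this
  obtain ⟨j, hj⟩ : ∃ j, Missing c y j := by
    have h1 := hMcard y
    have h2 := deg_delete hxy.symm
    rw [Sym2.eq_swap] at h2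
    have h3 := hd y
    obtain ⟨j, hj⟩ := Finset.card_pos.1 (show 0 < (M y).card by omega)
    exact ⟨j, hM.1 hj⟩
  have hdisj : (F.biUnion M).card = ∑ v ∈ F, (M v).card := by
    refine Finset.card_biUnion fun u hu v hv huv => ?_
    rw [Function.onFun, Finset.disjoint_left]
    intro k hk hk'
    obtain ⟨l, h⟩ := hF.1 hu
    obtain ⟨l', h'⟩ := hF.1 hv
    exact huv (Fan.unique hG hxy hc hj h h' (hM.1 hk) (hM.1 hk'))
  have hinj : (F.biUnion M).card ≤ (F.erase x).card := by
    have : ∀ k ∈ F.biUnion M, ∃ v ∈ F.erase x, c y v = some k := by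
      intro k hk
      obtain ⟨w, hw, hk⟩ := Finset.mem_biUnion.1 hk
      obtain ⟨l, h⟩ := hF.1 hw
      have := Fan.not_both_missing hG hxy hc h (hM.1 hk)
      simp only [Missing, not_forall, not_not] at this
      obtain ⟨v, hv⟩ := this
      exact ⟨v, Finset.mem_erase.2 ⟨fun e => hyx k (e ▸ hv),
        hF.2 (h.exists_step (hM.1 hk) hv)⟩, hv⟩
    choose f hf hf' using this
    refine Finset.card_le_card_of_injOn (fun k => if h : k ∈ F.biUnion M then f k h else x) ?_ ?_
    · intro k hk
      simp only [Finset.mem_coe] at hk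
      simpa only [hk, dif_pos, Finset.mem_coe] using hf k hk
    · intro k hk k' hk' e
      simp only [Finset.mem_coe] at hk hk'
      simp only [hk, hk', dif_pos] at e
      have := hf' k hk
      rw [e, hf' k' hk'] at this
      exact (Option.some.inj this).symm
  rw [hdisj, ← Finset.add_sum_erase _ _ hxF] at hinj
  have hlow : ((F.erase x).filter fun v => deg G v ≠ Fintype.card κ).card ≤
      ∑ v ∈ F.erase x, (M v).card := by
    rw [Finset.card_filter]
    refine Finset.sum_le_sum fun v hv => ?_
    split_ifs with h
    · have h1 := hMcard v
      have hv' := Finset.mem_erase.1 hv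
      rw [deg_delete_of_ne hv'.1 (by
        obtain ⟨l, h⟩ := hF.1 hv'.2
        exact h.ne hc hxy.ne (by simp))] at h1
      have := hd v
      omega
    · exact Nat.zero_le _
  have hsplit := Finset.card_filter_add_card_filter_not (s := F.erase x)
    (fun v => deg G v = Fintype.card κ)
  have hx := hMcard x
  have hx' := deg_delete hxy
  have hfin : ((F.erase x).filter fun v => deg G v = Fintype.card κ).card ≤
      {w | G.Adj y w ∧ w ≠ x ∧ deg G w = Fintype.card κ}.ncard := by
    rw [← Set.ncard_coe_finset]
    refine Set.ncard_le_ncard (fun v hv => ?_) (Set.toFinite _)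
    simp only [Finset.coe_filter, Set.mem_ofPred_eq, Finset.mem_erase] at hv
    exact ⟨(deleteEdges_adj.1 (hadj v hv.1.2 hv.1.1)).1, hv.1.1, hv.2⟩
  have := hd x
  simp only [ne_eq] at hlow
  omega

/-- Vizing's theorem. -/
theorem vizing [Fintype V] [Fintype κ] (hd : ∀ v, deg G v < Fintype.card κ) :
    ∃ c : V → V → Option κ, IsColoring G c := by
  classical
  induction h : G.edgeSet.ncard generalizing G with
  | zero =>
    rw [Set.ncard_eq_zero (Set.toFinite _), edgeSet_eq_empty] at h
    subst h
    exact ⟨fun _ _ => none, fun _ _ => rfl, by simp, by simp⟩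
  | succ n ih =>
    obtain ⟨e, he⟩ : G.edgeSet.Nonempty := by
      rw [← Set.ncard_pos (Set.toFinite _)]
      omega
    induction e using Sym2.inductionOn with
    | hf x y =>
    have hxy : G.Adj x y := he
    by_contra hG
    have hle : ∀ v, deg (G.deleteEdges {s(x, y)}) v ≤ deg G v := fun v =>
      Set.ncard_le_ncard (fun u hu => (deleteEdges_adj.1 hu).1) (Set.toFinite _)
    obtain ⟨c, hc⟩ := ih (G := G.deleteEdges {s(x, y)}) (fun v => (hle v).trans_lt (hd v)) (by
      rw [edgeSet_deleteEdges, Set.ncard_sdiff_singleton_of_mem he, h]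
      rfl)
    have := vizing_adjacency (fun c hc => hG ⟨c, hc⟩) (fun v => (hd v).le) hxy hc
    rw [show {w | G.Adj y w ∧ w ≠ x ∧ deg G w = Fintype.card κ} = ∅ from
      Set.eq_empty_of_forall_notMem fun w hw => (hd w).ne hw.2.2, Set.ncard_empty] at this
    have := hd x
    omega

end Kempe

namespace Kempe

theorem IsColoring.comap {W κ : Type*} {H : SimpleGraph W} {K : SimpleGraph V}
    {c : W → W → Option κ} (hc : IsColoring H c) (f : V → W) (hf : Function.Injective f)
    (h : ∀ u v, K.Adj u v ↔ H.Adj (f u) (f v)) : IsColoring K fun u v => c (f u) (f v) :=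
  ⟨fun _ _ => hc.symm _ _, fun h1 h2 => hf (hc.inj h1 h2), fun _ _ => by rw [h, ← hc.dom]⟩

theorem IsColoring.map {κ κ' : Type*} {H : SimpleGraph V} {c : V → V → Option κ}
    (hc : IsColoring H c) (f : κ ↪ κ') : IsColoring H fun u v => (c u v).map f := by
  refine ⟨fun u v => by simp only [hc.symm u v], fun {u v w k} h1 h2 => ?_, fun u v => ?_⟩
  · simp only [Option.map_eq_some_iff] at h1 h2
    obtain ⟨a, ha, rfl⟩ := h1
    obtain ⟨b, hb, e⟩ := h2
    exact hc.inj ha (f.injective e ▸ hb)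
  · rw [← hc.dom]
    simp only [Option.map_eq_some_iff]
    exact ⟨fun ⟨_, a, h, _⟩ => ⟨a, h⟩, fun ⟨a, h⟩ => ⟨f a, a, h, rfl⟩⟩

theorem exists_isProperEdgeColoring_iff (G : SimpleGraph V) (n : ℕ) :
    (∃ c, IsProperEdgeColoring G n c) ↔ ∃ c : V → V → Option (Fin n), IsColoring G c := by
  classical
  constructor
  · rintro ⟨c, h1, h2⟩
    refine ⟨fun u v => if h : G.Adj u v then some ⟨c s(u, v), h1 _ h⟩ else none,
      fun u v => ?_, fun {u v w k} ha hb => ?_, fun u v => ?_⟩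
    · simp only [G.adj_comm u v, Sym2.eq_swap (a := u)]
    · split_ifs at ha hb with h3 h4
      by_contra e
      refine h2 s(u, v) h3 s(u, w) h4 (by simp; grind) ⟨u, by simp, by simp⟩ ?_
      rw [← hb] at ha
      simpa using ha
    · by_cases h : G.Adj u v <;> simp [h]
  · rintro ⟨c, hc⟩
    refine ⟨Sym2.lift ⟨fun u v => (c u v).elim 0 Fin.val, fun u v => by simp only [hc.symm u v]⟩,
      ?_, ?_⟩
    · intro e he
      induction e using Sym2.inductionOn with
      | hf u v =>
      obtain ⟨k, hk⟩ := (hc.dom u v).2 he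
      simp [hk]
    · rintro e he e' he' hne ⟨v, hv, hv'⟩
      obtain ⟨u, rfl⟩ := hv
      obtain ⟨w, rfl⟩ := hv'
      obtain ⟨k, hk⟩ := (hc.dom _ _).2 he
      obtain ⟨l, hl⟩ := (hc.dom _ _).2 he'
      simp only [Sym2.lift_mk, hk, hl, Option.elim_some, ne_eq]
      intro e
      rw [Fin.ext e] at hk
      have := hc.inj hk hl
      exact hne (by simp_all)

theorem edgeChromaticNumber_le {G : SimpleGraph V} {n : ℕ} {c : V → V → Option (Fin n)}
    (hc : IsColoring G c) : edgeChromaticNumber G ≤ n :=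
  Nat.sInf_le ((exists_isProperEdgeColoring_iff G n).2 ⟨c, hc⟩)

theorem exists_isColoring_of_le {G : SimpleGraph V} {n m : ℕ} {c : V → V → Option (Fin n)}
    (hc : IsColoring G c) (hm : edgeChromaticNumber G ≤ m) :
    ∃ c : V → V → Option (Fin m), IsColoring G c := by
  have : {n | ∃ c, IsProperEdgeColoring G n c}.Nonempty :=
    ⟨n, (exists_isProperEdgeColoring_iff G n).2 ⟨c, hc⟩⟩
  obtain ⟨c', hc'⟩ := (exists_isProperEdgeColoring_iff G _).1 (Nat.sInf_mem this)
  exact ⟨_, hc'.map (Fin.castLEEmb hm)⟩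

/-- The properties of critical graphs of maximum degree `k` used below. -/
structure Critical (k : ℕ) (G : SimpleGraph V) : Prop where
  deg_le : ∀ v, deg G v ≤ k
  exists_deg : ∃ v, deg G v = k
  exists_adj : ∀ v, ∃ w, G.Adj v w
  uncolorable : Uncolorable (Fin k) G
  colorable : ∀ {x y}, G.Adj x y →
    ∃ c : V → V → Option (Fin k), IsColoring (G.deleteEdges {s(x, y)}) c

theorem Critical.of_isKCritical [Fintype V] {G : SimpleGraph V} {k : ℕ} (hk : k ≠ 0)
    (hG : IsKCritical G k) : Critical k G := by
  obtain ⟨⟨h1, h2⟩, h3⟩ := hG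
  rw [h3] at h1
  have hfin : {d | ∃ v, deg G v = d}.Finite := Set.finite_range (deg G)
  have hle : ∀ v, deg G v ≤ k := fun v => h3 ▸ le_csSup hfin.bddAbove ⟨v, rfl⟩
  have hex : ∃ v, deg G v = k := by
    have : {d | ∃ v, deg G v = d}.Nonempty := by
      by_contra h
      rw [Set.not_nonempty_iff_eq_empty] at h
      rw [maxDeg, h, csSup_empty] at h3
      exact hk h3.symm
    have := Nat.sSup_mem this hfin.bddAbove
    rwa [← maxDeg, h3] at this
  obtain ⟨c, hc⟩ := vizing (κ := Fin (k + 1)) (G := G) fun v => by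
    simpa using Nat.lt_succ_of_le (hle v)
  have hunc : Uncolorable (Fin k) G := by
    intro c hc
    refine h1 (le_antisymm (edgeChromaticNumber_le hc) ?_)
    obtain ⟨c', hc'⟩ := exists_isColoring_of_le hc le_rfl
    obtain ⟨v, hv⟩ := hex
    have := card_missing_add hc' v
    rw [Fintype.card_fin] at this
    omega
  refine ⟨hle, hex, fun v => ?_, hunc, fun {x y} hxy => ?_⟩
  · classical
    by_contra! hv
    let H : G.Subgraph := (⊤ : G.Subgraph).deleteVerts {v}
    have hverts : ∀ u, u ∈ H.verts ↔ u ≠ v := by simp [H]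
    have hH : ∀ u w : H.verts, H.coe.Adj u w ↔ G.Adj u w := fun u w => by
      have hu := (hverts u).1 u.2
      have hw := (hverts w).1 w.2
      simp [H, hu, hw]
    have hne : H ≠ ⊤ := fun h => by
      have := hverts v
      simp [h] at this
    obtain ⟨c', hc'⟩ := exists_isColoring_of_le (m := k)
      (hc.comap _ Subtype.val_injective fun u w => hH u w) (by
        have := h2 H hne
        have := edgeChromaticNumber_le hc
        omega)
    have hadj : ∀ {u w}, G.Adj u w → u ∈ H.verts ∧ w ∈ H.verts := fun {u w} h =>
      ⟨(hverts u).2 fun e => hv w (e ▸ h), (hverts w).2 fun e => hv u (e ▸ h.symm)⟩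
    refine hunc (fun u w => if h : u ∈ H.verts ∧ w ∈ H.verts then c' ⟨u, h.1⟩ ⟨w, h.2⟩ else none)
      ⟨fun u w => ?_, fun {u w z l} h1 h2 => ?_, fun u w => ⟨?_, fun h => ?_⟩⟩
    · by_cases h : u ∈ H.verts ∧ w ∈ H.verts
      · rw [dif_pos h, dif_pos h.symm, hc'.symm]
      · rw [dif_neg h, dif_neg fun h' => h h'.symm]
    · split_ifs at h1 h2
      exact congrArg Subtype.val (hc'.inj h1 h2)
    · rintro ⟨l, h⟩
      split_ifs at h
      exact (hH _ _).1 ((hc'.dom _ _).1 ⟨l, h⟩)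
    · rw [dif_pos (hadj h)]
      exact (hc'.dom _ _).2 ((hH _ _).2 h)
  let H : G.Subgraph := (⊤ : G.Subgraph).deleteEdges {s(x, y)}
  have hH : ∀ u v, H.Adj u v ↔ (G.deleteEdges {s(x, y)}).Adj u v := by
    simp [H, deleteEdges_adj]
  have hv : ∀ v, v ∈ H.verts := by simp [H]
  have hne : H ≠ ⊤ := fun h => by
    have := (hH x y).1 (by rw [h]; exact hxy)
    simp [deleteEdges_adj] at this
  have hc' : IsColoring H.coe fun u v => recolor c x y none u v :=
    (hc.erase x y).comap _ Subtype.val_injective fun u v => hH u v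
  obtain ⟨c', hc'⟩ := exists_isColoring_of_le (m := k) hc' (by
    have := h2 H hne
    have := edgeChromaticNumber_le hc
    omega)
  exact ⟨_, hc'.comap (fun v => ⟨v, hv v⟩) (fun u v h => congrArg Subtype.val h)
    fun u v => (hH u v).symm⟩

theorem Critical.adjacency [Fintype V] {G : SimpleGraph V} {k : ℕ} (hG : Critical k G) {x y : V}
    (hxy : G.Adj x y) :
    k + 1 ≤ deg G x + {w | G.Adj y w ∧ w ≠ x ∧ deg G w = k}.ncard := by
  obtain ⟨c, hc⟩ := hG.colorable hxy
  simpa using vizing_adjacency hG.uncolorable (by simpa using hG.deg_le) hxy hc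

end Kempe

namespace Kempe

/-- A configuration: for each vertex a mask whose bit `e` tells whether the edge `e` is incident and
whose bit `16 + w` marks the vertex `w` itself, the edges, guaranteed numbers of missing colors at
the vertices, and patterns that are exempted for the initial coloring. -/
structure Config where
  masks : List ℕ
  edges : List (ℕ × ℕ)
  slack : List ℕ
  exempt : List (List (ℕ × ℕ))

/-- Partial knowledge about a coloring is stored in six lanes of 24 bits, one for each color: bit
`e` says that the edge `e` has the color and bit `16 + w` that the color is missing at the vertex
`w`. -/
def lane (s k : ℕ) : ℕ := Nat.mod (Nat.shiftRight s (Nat.mul (nat_lit 24) k)) (nat_lit 16777216)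

/-- Some lane contains both bits `p` and `q`. -/
def meets (s p q : ℕ) : Bool :=
  cond (Nat.beq (Nat.land (Nat.land (Nat.shiftRight s p) (Nat.shiftRight s q))
    (nat_lit 1329228075013083109534908998462996481)) (nat_lit 0)) false true

/-- The bit of `s` at the position `p`. -/
def bit (s p : ℕ) : ℕ := Nat.mod (Nat.shiftRight s p) (nat_lit 2)

/-- The number of lanes containing the bit `p`. -/
def missCount (s p : ℕ) : ℕ :=
  bit s p + bit s (24 + p) + bit s (48 + p) + bit s (72 + p) + bit s (96 + p) + bit s (120 + p)

/-- Consider all ways in which the two-colored components split the known part, where `inn` and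
`out` are the masks of the vertices inside and outside the component of `v`, and call `f` on them.
-/
def swapGo (X O v : ℕ) (f : ℕ → List ℕ → Option (List ℕ)) (l : List ℕ) :
    ℕ → ℕ → ℕ → ℕ → List ℕ → Option (List ℕ) :=
  List.rec (motive := fun _ => ℕ → ℕ → ℕ → ℕ → List ℕ → Option (List ℕ))
  (fun _ inn _ _ st => f inn st)
  (fun m _ go w inn out ends st =>
    cond (Nat.beq (Nat.land X m) (nat_lit 0)) (go (Nat.succ w) inn out ends st)
    (Option.rec (motive := fun _ => Option (List ℕ)) none
     (fun st' =>
      cond (Nat.beq w v) (some st') (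
      cond (Nat.beq (Nat.land inn (Nat.land (Nat.lor out m) O)) (nat_lit 0))
        (go (Nat.succ w) inn (Nat.lor out m) ends st') (some st')))
     (cond (Nat.beq (Nat.land (Nat.lor inn m) (Nat.land out O)) (nat_lit 0))
        (cond (Nat.ble (nat_lit 65536) (Nat.land X m))
          (cond (Nat.ble (nat_lit 2) ends) (some st)
            (go (Nat.succ w) (Nat.lor inn m) out (Nat.succ ends) st))
          (go (Nat.succ w) (Nat.lor inn m) out ends st))
        (some st)))) l

/-- One of the first lanes equals `t`. -/
def isDup (s t : ℕ) : ℕ → Bool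
  | 0 => false
  | k + 1 => Nat.beq (lane s k) t || isDup s t k

/-- Set the bit `b` in every lane that is consistent with it and differs from all earlier lanes, and
call `f` on the result. -/
def queryGo (s msk b : ℕ) (f : ℕ → List ℕ → Option (List ℕ)) :
    ℕ → ℕ → List ℕ → Option (List ℕ)
  | 0, _, st => some st
  | n + 1, k, st =>
    bif !Nat.beq (lane s k &&& msk) 0 || isDup s (lane s k) k then queryGo s msk b f n (k + 1) st
    else match f (s ||| (1 <<< (24 * k + b))) st with
      | none => none
      | some st' => queryGo s msk b f n (k + 1) st'

/-- Check that the vertices in the set `F` form a union of complete two-colored components and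
return their mask. -/
def inMask (O A B F : ℕ) : List ℕ → ℕ → ℕ → ℕ → Option ℕ
  | [], _, inn, out => bif Nat.beq (inn &&& out &&& O) 0 then some inn else none
  | m :: l, w, inn, out =>
    bif Nat.beq (bit F w) 0 then inMask O A B F l (w + 1) inn (out ||| m) else
    bif Nat.beq (A &&& m) 0 || Nat.beq (B &&& m) 0 then none else
    inMask O A B F l (w + 1) (inn ||| m) out

/-- Exchange the bits of the lanes `i` and `j`, where `D` contains the bits that differ. -/
def exch (s i j D : ℕ) : ℕ := s ^^^ (D <<< (24 * i)) ^^^ (D <<< (24 * j))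

/-- One of the exempted patterns is known to occur. -/
def isExempt (s : ℕ) (l : List (List (ℕ × ℕ))) : Bool :=
  l.any fun c => c.all fun p => meets s p.1 p.2

/-- The next move together with the remaining ones, which are packed in blocks of 16 bits. -/
def fetch : List ℕ → ℕ × List ℕ
  | [] => (255, [])
  | a :: l => (a % 65536, bif Nat.ble (a / 65536) 1 then l else (a / 65536) :: l)

/-- If `e` and `f` share an endpoint, call `g` on their other endpoints. -/
def hinge (e f : ℕ × ℕ) (g : ℕ → ℕ → Option (List ℕ)) : Option (List ℕ) :=
  bif Nat.beq e.1 f.1 then g e.2 f.2 else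
  bif Nat.beq e.1 f.2 then g e.2 f.1 else
  bif Nat.beq e.2 f.1 then g e.1 f.2 else
  bif Nat.beq e.2 f.2 then g e.1 f.1 else none

/-- Evaluate `n` before passing it to `f`. -/
def force (n : ℕ) (f : ℕ → Option (List ℕ)) : Option (List ℕ) :=
  Nat.rec (motive := fun _ => Option (List ℕ)) (f (nat_lit 0)) (fun k _ => f (Nat.succ k)) n

/-- Distinguish the possible colors of the edge `hi`. -/
def queryEdge (D : Config) (rec : ℕ → List ℕ → Option (List ℕ)) (u s hi : ℕ) (st : List ℕ) :
    Option (List ℕ) :=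
  bif Nat.beq hi u || Nat.ble D.edges.length hi || meets s hi hi then none else
  queryGo s
    (D.masks.getD (D.edges.getD hi (0, 0)).1 0 ||| D.masks.getD (D.edges.getD hi (0, 0)).2 0)
    hi rec 6 0 st

/-- Distinguish the possibilities for a further color missing at the vertex `hi`. -/
def queryVertex (D : Config) (rec : ℕ → List ℕ → Option (List ℕ)) (u s hi : ℕ) (st : List ℕ) :
    Option (List ℕ) :=
  bif Nat.ble (missCount s (16 + hi) + 1) (D.slack.getD hi 0 +
      bif Nat.beq (D.edges.getD u (0, 0)).1 hi || Nat.beq (D.edges.getD u (0, 0)).2 hi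
      then 1 else 0) && Nat.ble (hi + 1) D.masks.length then
    queryGo s (D.masks.getD hi 0) (16 + hi) rec 6 0 st
  else none

/-- Give the uncolored edge `u` the color `k` of the adjacent edge `hi`, which becomes uncolored. -/
def shiftStep (D : Config) (rec : ℕ → ℕ → List ℕ → Option (List ℕ)) (u s k hi : ℕ)
    (st : List ℕ) : Option (List ℕ) :=
  hinge (D.edges.getD u (0, 0)) (D.edges.getD hi (0, 0)) fun y z =>
    bif Nat.beq (bit s (24 * k + hi)) 1 && Nat.beq (bit s (24 * k + (16 + y))) 1 &&
        Nat.ble (hi + 1) D.edges.length then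
      rec hi (s ^^^ ((1 <<< (24 * k + hi)) ||| (1 <<< (24 * k + u)) |||
        (1 <<< (24 * k + (16 + y))) ||| (1 <<< (24 * k + (16 + z))))) st
    else none

/-- Exchange the colors `i` and `j` on the component of the vertex `v`. -/
def swapStep (D : Config) (rec : ℕ → List ℕ → Option (List ℕ)) (s i j v : ℕ) (st : List ℕ) :
    Option (List ℕ) :=
  force (Nat.xor (lane s i) (lane s j)) fun X =>
  force (Nat.mod (Nat.lor (lane s i) (lane s j)) (nat_lit 65536)) fun O =>
    swapGo X O v (fun inn st => rec (exch s i j (Nat.land X inn)) st) D.masks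
      (nat_lit 0) (nat_lit 0) (nat_lit 0) (nat_lit 0) st

/-- Exchange the colors `i` and `j` on the union of components formed by the vertices in `F`. -/
def fragStep (D : Config) (rec : ℕ → List ℕ → Option (List ℕ)) (s i j F : ℕ) (st : List ℕ) :
    Option (List ℕ) :=
  match inMask ((lane s i ||| lane s j) % 65536) (lane s i) (lane s j) F D.masks 0 0 0 with
  | none => none
  | some inn => rec (exch s i j ((lane s i ^^^ lane s j) &&& inn)) st

/-- Perform the move with code `lo` and argument `hi`. -/
def step (D : Config) (rec : Bool → ℕ → ℕ → List ℕ → Option (List ℕ)) (fresh : Bool)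
    (u s lo hi : ℕ) (st : List ℕ) : Option (List ℕ) :=
  cond (Nat.ble (nat_lit 36) lo) (
    cond (Nat.ble (nat_lit 72) lo) (
      cond (Nat.ble (nat_lit 78) lo)
        (cond (Nat.beq lo (nat_lit 78)) (queryEdge D (rec fresh u) u s hi st)
          (queryVertex D (rec fresh u) u s hi st))
        (shiftStep D (rec false) u s (lo - 72) hi st))
      (swapStep D (rec false u) s ((lo - 36) / 6) (lo % 6) hi st))
    (fragStep D (rec false u) s (lo / 6) (lo % 6) hi st)

/-- Replay a case analysis on partial edge colorings; the list holds the remaining moves. -/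
def run (D : Config) (n : ℕ) : Bool → ℕ → ℕ → List ℕ → Option (List ℕ) :=
  Nat.rec (motive := fun _ => Bool → ℕ → ℕ → List ℕ → Option (List ℕ)) (fun _ _ _ _ => none)
    (fun _ rec fresh u s st => force s fun s =>
      bif meets s (16 + (D.edges.getD u (0, 0)).1) (16 + (D.edges.getD u (0, 0)).2) ||
        (fresh && isExempt s D.exempt) then some st else
      force (Nat.mod (fetch st).1 (nat_lit 256)) fun lo =>
      force (Nat.div (fetch st).1 (nat_lit 256)) fun hi =>
        step D rec fresh u s lo hi (fetch st).2) n

/-- The moves lead to a color missing at both ends of the uncolored edge in every case. -/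
def refutes (D : Config) (st : List ℕ) : Bool := (run D 200 true 0 0 st).isSome

end Kempe

namespace Kempe

section Bits

theorem testBit_lane (s k p : ℕ) :
    (lane s k).testBit p = (decide (p < 24) && s.testBit (24 * k + p)) := by
  change ((s >>> (24 * k)) % 2 ^ 24).testBit p = _
  rw [Nat.testBit_mod_two_pow, Nat.testBit_shiftRight]

theorem lane_lt (s k : ℕ) : lane s k < 2 ^ 24 := Nat.mod_lt _ (by norm_num)

theorem meets_eq (s p q : ℕ) : meets s p q = true ↔
    ∃ k < 6, s.testBit (24 * k + p) = true ∧ s.testBit (24 * k + q) = true := by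
  have h : meets s p q = !decide (((s >>> p) &&& (s >>> q)) &&&
      1329228075013083109534908998462996481 = 0) := by
    change (cond (Nat.beq (((s >>> p) &&& (s >>> q)) &&& 1329228075013083109534908998462996481) 0)
      false true) = _
    cases h : Nat.beq _ 0
    · simpa using Nat.ne_of_beq_eq_false h
    · simpa using Nat.eq_of_beq_eq_true h
  have hb : ∀ n, Nat.testBit 1329228075013083109534908998462996481 n = true ↔
      ∃ k < 6, n = 24 * k := by
    intro n
    by_cases hn : n < 121
    · have : ∀ n < 121, Nat.testBit 1329228075013083109534908998462996481 n = true ↔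
        ∃ k < 6, n = 24 * k := by decide +kernel
      exact this n hn
    · rw [Nat.testBit_lt_two_pow (lt_of_lt_of_le (by norm_num) (Nat.pow_le_pow_right (n := 2)
        (by norm_num) (not_lt.1 hn)))]
      simp only [Bool.false_eq_true, false_iff, not_exists, not_and]
      omega
  rw [h, Bool.not_eq_true', decide_eq_false_iff_not]
  constructor
  · intro h0
    obtain ⟨n, hn⟩ := Nat.exists_testBit_of_ne_zero h0
    simp only [Nat.testBit_and, Bool.and_eq_true, Nat.testBit_shiftRight] at hn
    obtain ⟨k, hk, rfl⟩ := (hb n).1 hn.2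
    exact ⟨k, hk, by rw [add_comm]; exact hn.1.1, by rw [add_comm]; exact hn.1.2⟩
  · rintro ⟨k, hk, h1, h2⟩ h0
    have := congrArg (fun m => Nat.testBit m (24 * k)) h0
    simp only [Nat.testBit_and, Nat.testBit_shiftRight, Nat.zero_testBit,
      (hb _).2 ⟨k, hk, rfl⟩] at this
    rw [add_comm p, add_comm q, h1, h2] at this
    exact absurd this (by decide)

theorem bit_eq (s p : ℕ) : bit s p = if s.testBit p then 1 else 0 := by
  change (s >>> p) % 2 = _
  rw [Nat.testBit_eq_decide_div_mod_eq, Nat.shiftRight_eq_div_pow]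
  simp only [decide_eq_true_eq]
  split_ifs with h <;> omega

theorem missCount_eq (s p : ℕ) : missCount s p =
    (Finset.univ.filter fun k : Fin 6 => s.testBit (24 * k + p) = true).card := by
  rw [Finset.card_filter, Fin.sum_univ_six]
  simp only [missCount, bit_eq]
  simp

theorem testBit_exch {s i j D k p : ℕ} (hD : D < 2 ^ 24) (hp : p < 24) :
    (exch s i j D).testBit (24 * k + p) = ((s.testBit (24 * k + p) ^^
      (decide (k = i) && D.testBit p)) ^^ (decide (k = j) && D.testBit p)) := by
  have : ∀ i, (D <<< (24 * i)).testBit (24 * k + p) = (decide (k = i) && D.testBit p) := by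
    intro i
    rw [Nat.testBit_shiftLeft]
    rcases lt_trichotomy k i with h | rfl | h
    · have : ¬ 24 * k + p ≥ 24 * i := by omega
      simp [this, h.ne]
    · simp
    · have h2 : 2 ^ 24 ≤ 2 ^ (24 * k + p - 24 * i) :=
        Nat.pow_le_pow_right (by norm_num) (by omega)
      rw [Nat.testBit_lt_two_pow (hD.trans_le h2)]
      simp [h.ne']
  rw [exch, Nat.testBit_xor, Nat.testBit_xor, this, this]

theorem testBit_one_shift {k l p q : ℕ} (hp : p < 24) (hq : q < 24) :
    (1 <<< (24 * k + p)).testBit (24 * l + q) = true ↔ l = k ∧ q = p := by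
  rw [Nat.one_shiftLeft, Nat.testBit_two_pow]
  simp only [decide_eq_true_eq]
  omega

theorem force_eq (n : ℕ) (f : ℕ → Option (List ℕ)) : force n f = f n := by
  cases n <;> rfl

end Bits

section Moves

theorem swapGo_cons {X O v m w inn out ends : ℕ} {f : ℕ → List ℕ → Option (List ℕ)}
    {l st : List ℕ} : swapGo X O v f (m :: l) w inn out ends st =
      bif Nat.beq (X &&& m) 0 then swapGo X O v f l (w + 1) inn out ends st else
      ((bif Nat.beq ((inn ||| m) &&& (out &&& O)) 0 then
        (bif Nat.ble 65536 (X &&& m) then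
          (bif Nat.ble 2 ends then some st
            else swapGo X O v f l (w + 1) (inn ||| m) out (ends + 1) st)
          else swapGo X O v f l (w + 1) (inn ||| m) out ends st)
        else some st).bind fun st' =>
        bif Nat.beq w v then some st' else
        bif Nat.beq (inn &&& ((out ||| m) &&& O)) 0 then
          swapGo X O v f l (w + 1) inn (out ||| m) ends st' else some st') := by
  have key : ∀ (o : Option (List ℕ)) g,
      o.bind g = Option.rec (motive := fun _ => Option (List ℕ)) none g o := by
    rintro (_ | _) _ <;> rfl
  rw [key]
  rfl

variable {masks : List ℕ}

theorem swapGo_sound {X O v : ℕ} {f : ℕ → List ℕ → Option (List ℕ)} {In : ℕ → Prop}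
    (hv : In v)
    (hedge : ∀ w w' p, w < masks.length → w' < masks.length → In w → ¬ In w' →
      O.testBit p = true → (masks.getD w 0).testBit p = true →
      (masks.getD w' 0).testBit p = true → False)
    (hends : ∀ T : Finset ℕ,
      (∀ w ∈ T, w < masks.length ∧ In w ∧ 65536 ≤ X &&& masks.getD w 0) → T.card ≤ 2)
    (l : List ℕ) : ∀ (w inn out : ℕ) (T : Finset ℕ) (st r : List ℕ), l = masks.drop w →
      w ≤ masks.length →
      (∀ p, X.testBit p = true → ((∃ w' < w, In w' ∧ (masks.getD w' 0).testBit p = true) →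
        inn.testBit p = true)) →
      (∀ p, inn.testBit p = true → ∃ w' < w, In w' ∧ (masks.getD w' 0).testBit p = true) →
      (∀ p, out.testBit p = true → ∃ w' < w, ¬ In w' ∧ (masks.getD w' 0).testBit p = true) →
      (∀ w' ∈ T, w' < w ∧ In w' ∧ 65536 ≤ X &&& masks.getD w' 0) →
      swapGo X O v f l w inn out T.card st = some r →
      ∃ inn' st' r', f inn' st' = some r' ∧ ∀ p, X.testBit p = true →
        (inn'.testBit p = true ↔
          ∃ w < masks.length, In w ∧ (masks.getD w 0).testBit p = true) := by
  induction l with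
  | nil =>
    intro w inn out T st r hl hw h1 h2 h3 h4 h
    have : w = masks.length := le_antisymm hw (List.drop_eq_nil_iff.1 hl.symm)
    subst this
    exact ⟨inn, st, r, h, fun p hp => ⟨h2 p, h1 p hp⟩⟩
  | cons m l ih =>
    intro w inn out T st r hl hw h1 h2 h3 h4 h
    have hw : w < masks.length := by
      by_contra hn
      rw [List.drop_eq_nil_iff.2 (not_lt.1 hn)] at hl
      exact List.cons_ne_nil _ _ hl
    rw [List.drop_eq_getElem_cons hw, List.cons.injEq] at hl
    have hm : m = masks.getD w 0 := by
      rw [hl.1, List.getD_eq_getElem _ _ hw]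
    rw [swapGo_cons] at h
    cases hX : Nat.beq (X &&& m) 0 with
    | true =>
      rw [hX, cond_true] at h
      have hX := Nat.eq_of_beq_eq_true hX
      refine ih (w + 1) inn out T st r hl.2 hw (fun p hp => ?_) (fun p hp => ?_) (fun p hp => ?_)
        (fun w' hw' => ?_) h
      · rintro ⟨w', hw', hi, hp'⟩
        rcases Nat.lt_succ_iff_lt_or_eq.1 hw' with hlt | rfl
        · exact h1 p hp ⟨w', hlt, hi, hp'⟩
        · have := congrArg (fun n => Nat.testBit n p) hX
          rw [Nat.testBit_and, hp, hm, hp'] at this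
          simp at this
      · obtain ⟨w', hw', h⟩ := h2 p hp
        exact ⟨w', by omega, h⟩
      · obtain ⟨w', hw', h⟩ := h3 p hp
        exact ⟨w', by omega, h⟩
      · obtain ⟨hw', h⟩ := h4 w' hw'
        exact ⟨by omega, h⟩
    | false =>
      rw [hX, cond_false, Option.bind_eq_some_iff] at h
      obtain ⟨st', hin, hout⟩ := h
      by_cases hi : In w
      · clear hout
        cases ho : Nat.beq ((inn ||| m) &&& (out &&& O)) 0 with
        | false =>
          exfalso
          have := Nat.ne_of_beq_eq_false ho
          obtain ⟨p, hp⟩ := Nat.exists_testBit_of_ne_zero this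
          simp only [Nat.testBit_and, Nat.testBit_or, Bool.and_eq_true, Bool.or_eq_true] at hp
          obtain ⟨w2, hw2, hi2, hp2⟩ := h3 p hp.2.1
          rcases hp.1 with hp1 | hp1
          · obtain ⟨w1, hw1, hi1, hp1⟩ := h2 p hp1
            exact hedge w1 w2 p (by omega) (by omega) hi1 hi2 hp.2.2 hp1 hp2
          · exact hedge w w2 p (by omega) (by omega) hi hi2 hp.2.2 (hm ▸ hp1) hp2
        | true =>
          rw [ho, cond_true] at hin
          have g1 : ∀ p, X.testBit p = true →
              ((∃ w' < w + 1, In w' ∧ (masks.getD w' 0).testBit p = true) →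
                (inn ||| m).testBit p = true) := by
            rintro p hp ⟨w', hw', hi, hp'⟩
            simp only [Nat.testBit_or, Bool.or_eq_true]
            rcases Nat.lt_succ_iff_lt_or_eq.1 hw' with hlt | rfl
            · exact Or.inl (h1 p hp ⟨w', hlt, hi, hp'⟩)
            · exact Or.inr (hm ▸ hp')
          have g2 : ∀ p, (inn ||| m).testBit p = true →
              ∃ w' < w + 1, In w' ∧ (masks.getD w' 0).testBit p = true := by
            intro p hp
            simp only [Nat.testBit_or, Bool.or_eq_true] at hp
            rcases hp with hp | hp
            · obtain ⟨w', hw', h⟩ := h2 p hp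
              exact ⟨w', by omega, h⟩
            · exact ⟨w, by omega, hi, hm ▸ hp⟩
          have g3 : ∀ p, out.testBit p = true →
              ∃ w' < w + 1, ¬ In w' ∧ (masks.getD w' 0).testBit p = true := by
            intro p hp
            obtain ⟨w', hw', h⟩ := h3 p hp
            exact ⟨w', by omega, h⟩
          cases he : Nat.ble 65536 (X &&& m) with
          | false =>
            rw [he, cond_false] at hin
            refine ih (w + 1) _ out T _ _ hl.2 hw g1 g2 g3 (fun w' hw' => ?_) hin
            obtain ⟨hw', h⟩ := h4 w' hw'
            exact ⟨by omega, h⟩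
          | true =>
            have he' := Nat.le_of_ble_eq_true he
            have hT : ∀ w' ∈ insert w T, w' < w + 1 ∧ In w' ∧ 65536 ≤ X &&& masks.getD w' 0 := by
              intro w' hw'
              rcases Finset.mem_insert.1 hw' with rfl | hw'
              · exact ⟨by omega, hi, hm ▸ he'⟩
              · obtain ⟨hw', h⟩ := h4 w' hw'
                exact ⟨by omega, h⟩
            have hc : (insert w T).card = T.card + 1 :=
              Finset.card_insert_of_notMem fun hw' => absurd (h4 w hw').1 (lt_irrefl _)
            have h2 := hends (insert w T) fun w' hw' => by
              obtain ⟨hw', h⟩ := hT w' hw'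
              exact ⟨by omega, h⟩
            have h2 : Nat.ble 2 T.card = false := by
              rw [Bool.eq_false_iff]
              intro h
              have := Nat.le_of_ble_eq_true h
              omega
            rw [he, cond_true, h2, cond_false, ← hc] at hin
            exact ih (w + 1) _ out (insert w T) _ _ hl.2 hw g1 g2 g3 hT hin
      · clear hin
        have hwv : Nat.beq w v = false := by
          rw [Bool.eq_false_iff]
          intro h
          exact hi (Nat.eq_of_beq_eq_true h ▸ hv)
        rw [hwv, cond_false] at hout
        cases ho : Nat.beq (inn &&& ((out ||| m) &&& O)) 0 with
        | false =>
          exfalso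
          have := Nat.ne_of_beq_eq_false ho
          obtain ⟨p, hp⟩ := Nat.exists_testBit_of_ne_zero this
          simp only [Nat.testBit_and, Nat.testBit_or, Bool.and_eq_true, Bool.or_eq_true] at hp
          obtain ⟨w1, hw1, hi1, hp1⟩ := h2 p hp.1
          rcases hp.2.1 with hp2 | hp2
          · obtain ⟨w2, hw2, hi2, hp2⟩ := h3 p hp2
            exact hedge w1 w2 p (by omega) (by omega) hi1 hi2 hp.2.2 hp1 hp2
          · exact hedge w1 w p (by omega) (by omega) hi1 hi hp.2.2 hp1 (hm ▸ hp2)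
        | true =>
          rw [ho, cond_true] at hout
          refine ih (w + 1) inn _ T _ _ hl.2 hw (fun p hp => ?_) (fun p hp => ?_)
            (fun p hp => ?_) (fun w' hw' => ?_) hout
          · rintro ⟨w', hw', hi', hp'⟩
            rcases Nat.lt_succ_iff_lt_or_eq.1 hw' with hlt | rfl
            · exact h1 p hp ⟨w', hlt, hi', hp'⟩
            · exact absurd hi' hi
          · obtain ⟨w', hw', h⟩ := h2 p hp
            exact ⟨w', by omega, h⟩
          · simp only [Nat.testBit_or, Bool.or_eq_true] at hp
            rcases hp with hp | hp
            · obtain ⟨w', hw', h⟩ := h3 p hp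
              exact ⟨w', by omega, h⟩
            · exact ⟨w, by omega, hi, hm ▸ hp⟩
          · obtain ⟨hw', h⟩ := h4 w' hw'
            exact ⟨by omega, h⟩

theorem inMask_sound {O A B F r : ℕ} (l : List ℕ) : ∀ (w inn out : ℕ), l = masks.drop w →
    w ≤ masks.length → inMask O A B F l w inn out = some r →
    (∀ p, r.testBit p = true ↔ inn.testBit p = true ∨ ∃ w' < masks.length, w ≤ w' ∧
      F.testBit w' = true ∧ (masks.getD w' 0).testBit p = true) ∧
    (∀ w' < masks.length, w ≤ w' → F.testBit w' = true →
      A &&& masks.getD w' 0 ≠ 0 ∧ B &&& masks.getD w' 0 ≠ 0) ∧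
    (∀ p, r.testBit p = true → O.testBit p = true → out.testBit p = false ∧
      ∀ w' < masks.length, w ≤ w' → (masks.getD w' 0).testBit p = true →
        F.testBit w' = true) := by
  induction l with
  | nil =>
    intro w inn out hl hw h
    have : w = masks.length := le_antisymm hw (List.drop_eq_nil_iff.1 hl.symm)
    subst this
    rw [inMask] at h
    cases h0 : Nat.beq (inn &&& out &&& O) 0 with
    | false => simp [h0] at h
    | true =>
      rw [h0, cond_true, Option.some.injEq] at h
      subst h
      refine ⟨fun p => ⟨Or.inl, ?_⟩, fun w' h1 h2 => absurd h1 (not_lt.2 h2),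
        fun p hp hO => ⟨?_, fun w' h1 h2 => absurd h1 (not_lt.2 h2)⟩⟩
      · rintro (h | ⟨w', h1, h2, -⟩)
        · exact h
        · exact absurd h1 (not_lt.2 h2)
      · have := congrArg (fun n => Nat.testBit n p) (Nat.eq_of_beq_eq_true h0)
        simpa [hp, hO] using this
  | cons m l ih =>
    intro w inn out hl hw h
    have hw : w < masks.length := by
      by_contra hn
      rw [List.drop_eq_nil_iff.2 (not_lt.1 hn)] at hl
      exact List.cons_ne_nil _ _ hl
    rw [List.drop_eq_getElem_cons hw, List.cons.injEq] at hl
    have hm : m = masks.getD w 0 := by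
      rw [hl.1, List.getD_eq_getElem _ _ hw]
    rw [inMask] at h
    cases hF : F.testBit w with
    | false =>
      have h0 : Nat.beq (bit F w) 0 = true := by rw [bit_eq, hF]; rfl
      rw [h0, cond_true] at h
      obtain ⟨i1, i2, i3⟩ := ih _ _ _ hl.2 hw h
      refine ⟨fun p => ?_, fun w' h1 h2 h3 => ?_, fun p hp hO => ?_⟩
      · rw [i1]
        refine or_congr_right (exists_congr fun w' => and_congr_right fun h1 => ?_)
        constructor
        · rintro ⟨h2, h3⟩
          exact ⟨by omega, h3⟩
        · rintro ⟨h2, h3⟩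
          refine ⟨Nat.lt_of_le_of_ne h2 ?_, h3⟩
          rintro rfl
          simp [hF] at h3
      · refine i2 w' h1 (Nat.lt_of_le_of_ne h2 ?_) h3
        rintro rfl
        simp [hF] at h3
      · obtain ⟨h1, h2⟩ := i3 p hp hO
        simp only [Nat.testBit_or, Bool.or_eq_false_iff] at h1
        refine ⟨h1.1, fun w' h3 h4 h5 => ?_⟩
        rcases Nat.eq_or_lt_of_le h4 with rfl | h4
        · rw [← hm, h1.2] at h5
          exact absurd h5 (by simp)
        · exact h2 w' h3 h4 h5
    | true =>
      have h0 : Nat.beq (bit F w) 0 = false := by rw [bit_eq, hF]; rfl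
      rw [h0, cond_false] at h
      cases hAB : Nat.beq (A &&& m) 0 || Nat.beq (B &&& m) 0 with
      | true => simp [hAB] at h
      | false =>
        rw [hAB, cond_false] at h
        rw [Bool.or_eq_false_iff] at hAB
        obtain ⟨i1, i2, i3⟩ := ih _ _ _ hl.2 hw h
        refine ⟨fun p => ?_, fun w' h1 h2 h3 => ?_, fun p hp hO => ?_⟩
        · rw [i1, Nat.testBit_or, Bool.or_eq_true, or_assoc]
          refine or_congr_right ?_
          constructor
          · rintro (h | ⟨w', h1, h2, h3⟩)
            · exact ⟨w, hw, le_rfl, hF, hm ▸ h⟩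
            · exact ⟨w', h1, by omega, h3⟩
          · rintro ⟨w', h1, h2, h3⟩
            rcases Nat.eq_or_lt_of_le h2 with rfl | h2
            · exact Or.inl (hm ▸ h3.2)
            · exact Or.inr ⟨w', h1, h2, h3⟩
        · rcases Nat.eq_or_lt_of_le h2 with rfl | h2
          · exact hm ▸ ⟨Nat.ne_of_beq_eq_false hAB.1, Nat.ne_of_beq_eq_false hAB.2⟩
          · exact i2 w' h1 h2 h3
        · obtain ⟨h1, h2⟩ := i3 p hp hO
          refine ⟨h1, fun w' h3 h4 h5 => ?_⟩
          rcases Nat.eq_or_lt_of_le h4 with rfl | h4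
          · exact hF
          · exact h2 w' h3 h4 h5

theorem isDup_eq {s t : ℕ} : ∀ k, isDup s t k = true ↔ ∃ l < k, lane s l = t
  | 0 => by simp [isDup]
  | k + 1 => by
    rw [isDup, Bool.or_eq_true, isDup_eq k, Nat.beq_eq]
    constructor
    · rintro (h | ⟨l, hl, h⟩)
      · exact ⟨k, by omega, h⟩
      · exact ⟨l, by omega, h⟩
    · rintro ⟨l, hl, h⟩
      rcases Nat.lt_succ_iff_lt_or_eq.1 hl with hl | rfl
      · exact Or.inr ⟨l, hl, h⟩
      · exact Or.inl h

theorem queryGo_sound {s msk b : ℕ} {f : ℕ → List ℕ → Option (List ℕ)} (n : ℕ) :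
    ∀ {k : ℕ} {st r : List ℕ}, queryGo s msk b f n k st = some r → ∀ t, k ≤ t → t < k + n →
      lane s t &&& msk = 0 → (∀ l < t, lane s l ≠ lane s t) →
      ∃ st' r', f (s ||| 1 <<< (24 * t + b)) st' = some r' := by
  induction n with
  | zero => intros; omega
  | succ n ih =>
    intro k st r h t h1 h2 h3 h4
    rw [queryGo] at h
    cases h0 : !Nat.beq (lane s k &&& msk) 0 || isDup s (lane s k) k with
    | true =>
      rw [h0, cond_true] at h
      rcases Nat.eq_or_lt_of_le h1 with rfl | h1
      · exfalso
        rw [Bool.or_eq_true, isDup_eq] at h0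
        rcases h0 with h0 | ⟨l, hl, h0⟩
        · simp [h3] at h0
        · exact h4 l hl h0
      · exact ih h t h1 (by omega) h3 h4
    | false =>
      rw [h0, cond_false] at h
      cases hf : f (s ||| 1 <<< (24 * k + b)) st with
      | none => simp [hf] at h
      | some st' =>
        rw [hf] at h
        rcases Nat.eq_or_lt_of_le h1 with rfl | h1
        · exact ⟨_, _, hf⟩
        · exact ih h t h1 (by omega) h3 h4

end Moves

end Kempe

namespace Kempe

namespace Config

/-- First endpoint of an edge of a configuration. -/
def fst (D : Config) (e : ℕ) : ℕ := (D.edges.getD e (0, 0)).1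

/-- Second endpoint of an edge of a configuration. -/
def snd (D : Config) (e : ℕ) : ℕ := (D.edges.getD e (0, 0)).2

/-- The masks of a configuration list the edges at each vertex, and the edges are distinct. -/
def Valid (D : Config) : Prop :=
  D.masks.length ≤ 8 ∧ D.edges.length ≤ 16 ∧ 0 < D.edges.length ∧
  (∀ e < D.edges.length, D.fst e < D.masks.length ∧ D.snd e < D.masks.length ∧ D.fst e ≠ D.snd e) ∧
  (∀ e < D.edges.length, ∀ f < D.edges.length, e ≠ f →
    ¬ (D.fst e = D.fst f ∧ D.snd e = D.snd f) ∧ ¬ (D.fst e = D.snd f ∧ D.snd e = D.fst f)) ∧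
  (∀ w < D.masks.length, ∀ p < 24, (D.masks.getD w 0).testBit p = true ↔
    (p < D.edges.length ∧ (D.fst p = w ∨ D.snd p = w)) ∨ p = 16 + w) ∧
  ∀ l ∈ D.exempt, ∀ q ∈ l, q.1 < 24 ∧ q.2 < 24

instance (D : Config) : Decidable D.Valid := by
  unfold Valid
  iterate 6 refine @instDecidableAnd _ _ ?_ ?_; rotate_left 1
  all_goals infer_instance

variable {G : SimpleGraph V} {c c' : V → V → Option (Fin 6)} {D : Config} {τ : ℕ → V}

/-- The vertices `τ w` form an instance of the configuration `D` in `G`. -/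
structure Embeds (D : Config) (G : SimpleGraph V) (τ : ℕ → V) : Prop where
  inj : ∀ w < D.masks.length, ∀ w' < D.masks.length, τ w = τ w' → w = w'
  adj : ∀ e < D.edges.length, G.Adj (τ (D.fst e)) (τ (D.snd e))
  slack : ∀ w < D.masks.length, deg G (τ w) + D.slack.getD w 0 ≤ 6

/-- Position `p` has color `k`: for `p < 16` the edge `p` is colored `k`, otherwise `k` is missing
at the vertex `p - 16`. -/
def Holds (D : Config) (τ : ℕ → V) (c : V → V → Option (Fin 6)) (p : ℕ) (k : Fin 6) : Prop :=
  if p < 16 then p < D.edges.length ∧ c (τ (D.fst p)) (τ (D.snd p)) = some k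
  else p - 16 < D.masks.length ∧ Missing c (τ (p - 16)) k

theorem holds_edge {e : ℕ} (h : e < 16) {k : Fin 6} : D.Holds τ c e k ↔
    e < D.edges.length ∧ c (τ (D.fst e)) (τ (D.snd e)) = some k := by rw [Holds, if_pos h]

theorem holds_vertex {w : ℕ} {k : Fin 6} :
    D.Holds τ c (16 + w) k ↔ w < D.masks.length ∧ Missing c (τ w) k := by
  rw [Holds, if_neg (by omega), Nat.add_sub_cancel_left]

/-- The coloring `c` agrees with the state `s` when lane `k` of `s` stands for the color `σ k`. -/
def Realizes (D : Config) (τ : ℕ → V) (s : ℕ) (c : V → V → Option (Fin 6))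
    (σ : Equiv.Perm (Fin 6)) : Prop :=
  ∀ (k : Fin 6) (p : ℕ), p < 24 → s.testBit (24 * k + p) = true → D.Holds τ c p (σ k)

/-- The coloring shows one of the exempted patterns. -/
def Exempt (D : Config) (τ : ℕ → V) (c : V → V → Option (Fin 6)) : Prop :=
  ∃ l ∈ D.exempt, ∀ q ∈ l, ∃ k, D.Holds τ c q.1 k ∧ D.Holds τ c q.2 k

theorem Realizes.exempt (hV : D.Valid) {s : ℕ} {σ : Equiv.Perm (Fin 6)}
    (hR : D.Realizes τ s c σ) (h : isExempt s D.exempt = true) : D.Exempt τ c := by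
  simp only [isExempt, List.any_eq_true, List.all_eq_true] at h
  obtain ⟨l, hl, h⟩ := h
  refine ⟨l, hl, fun q hq => ?_⟩
  obtain ⟨k, hk, h1, h2⟩ := (meets_eq _ _ _).1 (h q hq)
  obtain ⟨h3, h4⟩ := hV.2.2.2.2.2.2 l hl q hq
  exact ⟨σ ⟨k, hk⟩, hR ⟨k, hk⟩ _ h3 h1, hR ⟨k, hk⟩ _ h4 h2⟩

theorem Valid.testBit (hV : D.Valid) {w p : ℕ} (hw : w < D.masks.length) (hp : p < 24) :
    (D.masks.getD w 0).testBit p = true ↔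
      (p < D.edges.length ∧ (D.fst p = w ∨ D.snd p = w)) ∨ p = 16 + w :=
  hV.2.2.2.2.2.1 w hw p hp

theorem Embeds.sym2_ne (hV : D.Valid) (hE : D.Embeds G τ) {e f : ℕ} (he : e < D.edges.length)
    (hf : f < D.edges.length) (h : e ≠ f) :
    s(τ (D.fst e), τ (D.snd e)) ≠ s(τ (D.fst f), τ (D.snd f)) := by
  obtain ⟨h1, h2⟩ := hV.2.2.2.2.1 e he f hf h
  obtain ⟨e1, e2, -⟩ := hV.2.2.2.1 e he
  obtain ⟨f1, f2, -⟩ := hV.2.2.2.1 f hf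
  simp only [ne_eq, Sym2.eq_iff]
  rintro (⟨h3, h4⟩ | ⟨h3, h4⟩)
  · exact h1 ⟨hE.inj _ e1 _ f1 h3, hE.inj _ e2 _ f2 h4⟩
  · exact h2 ⟨hE.inj _ e1 _ f2 h3, hE.inj _ e2 _ f1 h4⟩

/-- A vertex attached to the position `p`. -/
def site (D : Config) (p : ℕ) : ℕ := if p < 16 then D.fst p else p - 16

theorem holds_swapOn {i j k : Fin 6} {S : Set V} {p : ℕ} :
    (τ (D.site p) ∈ S → (D.Holds τ (swapOn c i j S) p k ↔ D.Holds τ c p (Equiv.swap i j k))) ∧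
    (τ (D.site p) ∉ S → (D.Holds τ (swapOn c i j S) p k ↔ D.Holds τ c p k)) := by
  unfold Holds site
  split_ifs with hp
  · exact ⟨fun h => and_congr_right' ((swapOn_of_mem h _).trans (by congr!)),
      fun h => by rw [swapOn_of_notMem h]⟩
  · exact ⟨fun h => and_congr_right' ((missing_swapOn_of_mem h _).trans (by congr!)),
      fun h => and_congr_right' (missing_swapOn_of_notMem h _)⟩

theorem site_mem_iff (hV : D.Valid) {i j : Fin 6} {S : Set V}
    (hS : Closed c i j S) {p : ℕ} (hp : p < 24) (h : D.Holds τ c p i ∨ D.Holds τ c p j) :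
    (∃ w < D.masks.length, τ w ∈ S ∧ (D.masks.getD w 0).testBit p = true) ↔
      τ (D.site p) ∈ S := by
  unfold Holds at h
  unfold site
  split_ifs at h ⊢ with h16
  · rw [← and_or_left] at h
    obtain ⟨hpe, h⟩ := h
    have hcl := hS _ _ h
    obtain ⟨e1, e2, -⟩ := hV.2.2.2.1 p hpe
    constructor
    · rintro ⟨w, hw, hwS, hb⟩
      rcases (hV.testBit hw hp).1 hb with ⟨-, rfl | rfl⟩ | rfl
      · exact hwS
      · exact hcl.2 hwS
      · omega
    · intro h
      exact ⟨_, e1, h, (hV.testBit e1 hp).2 (Or.inl ⟨hpe, Or.inl rfl⟩)⟩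
  · rw [← and_or_left] at h
    constructor
    · rintro ⟨w, hw, hwS, hb⟩
      have : p = 16 + w := by
        rcases (hV.testBit hw hp).1 hb with h | h
        · have := hV.2.1
          omega
        · exact h
      rwa [this, Nat.add_sub_cancel_left]
    · intro h'
      exact ⟨_, h.1, h', (hV.testBit h.1 hp).2 (Or.inr (by omega))⟩

theorem Realizes.swap (hV : D.Valid) {s : ℕ} {σ : Equiv.Perm (Fin 6)}
    (hR : D.Realizes τ s c σ) {i j : Fin 6} {S : Set V} (hS : Closed c (σ i) (σ j) S) {I : ℕ}
    (hI : ∀ p, (lane s i ^^^ lane s j).testBit p = true → (I.testBit p = true ↔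
      ∃ w < D.masks.length, τ w ∈ S ∧ (D.masks.getD w 0).testBit p = true)) :
    D.Realizes τ (exch s i j ((lane s i ^^^ lane s j) &&& I)) (swapOn c (σ i) (σ j) S) σ := by
  intro k p hp h
  have hlt : (lane s i ^^^ lane s j) &&& I < 2 ^ 24 :=
    Nat.and_le_left.trans_lt (Nat.xor_lt_two_pow (lane_lt _ _) (lane_lt _ _))
  rw [testBit_exch hlt hp] at h
  have hX : (lane s i ^^^ lane s j).testBit p =
      (s.testBit (24 * i + p) ^^ s.testBit (24 * j + p)) := by
    simp only [Nat.testBit_xor, testBit_lane, hp, decide_true, Bool.true_and]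
  rw [Nat.testBit_and] at h
  obtain ⟨g1, g2⟩ := holds_swapOn (D := D) (τ := τ) (c := c) (i := σ i) (j := σ j) (k := σ k)
    (S := S) (p := p)
  have hi := hR i p hp
  have hj := hR j p hp
  have hk := hR k p hp
  have hu := fun h => site_mem_iff (D := D) (τ := τ) hV hS hp h
  have hI := hI p
  rw [hX] at h hI
  by_cases hki : k = i
  · subst hki
    rw [Equiv.swap_apply_left] at g1
    by_cases hkj : k = j
    · subst hkj
      simp only [Bool.xor_self, Bool.false_and, Bool.and_false, Bool.xor_false] at h
      by_cases hm : τ (D.site p) ∈ S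
      · exact (g1 hm).2 (hk h)
      · exact (g2 hm).2 (hk h)
    · have hkj' : (k : ℕ) ≠ j := fun e => hkj (Fin.ext e)
      simp only [hkj', decide_true, decide_false, Bool.true_and, Bool.false_and,
        Bool.xor_false] at h
      by_cases hm : τ (D.site p) ∈ S
      · refine (g1 hm).2 ?_
        grind
      · refine (g2 hm).2 ?_
        grind
  · have hki' : (k : ℕ) ≠ i := fun e => hki (Fin.ext e)
    by_cases hkj : k = j
    · subst hkj
      rw [Equiv.swap_apply_right] at g1
      simp only [hki', decide_true, decide_false, Bool.true_and, Bool.false_and,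
        Bool.xor_false] at h
      by_cases hm : τ (D.site p) ∈ S
      · refine (g1 hm).2 ?_
        grind
      · refine (g2 hm).2 ?_
        grind
    · have hkj' : (k : ℕ) ≠ j := fun e => hkj (Fin.ext e)
      rw [Equiv.swap_apply_of_ne_of_ne (fun e => hki (σ.injective e))
        fun e => hkj (σ.injective e)] at g1
      simp only [hki', hkj', decide_false, Bool.false_and, Bool.xor_false] at h
      by_cases hm : τ (D.site p) ∈ S
      · exact (g1 hm).2 (hk h)
      · exact (g2 hm).2 (hk h)

/-- No coloring of the graph without the edge `u` agrees with the state `s`, except possibly an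
exempted one if `fresh` holds. -/
def Bad (G : SimpleGraph V) (D : Config) (τ : ℕ → V) (fresh : Bool) (u s : ℕ) : Prop :=
  u < D.edges.length → ∀ (c : V → V → Option (Fin 6)) (σ : Equiv.Perm (Fin 6)),
    IsColoring (G.deleteEdges {s(τ (D.fst u), τ (D.snd u))}) c → D.Realizes τ s c σ →
    (fresh = true → ¬ D.Exempt τ c) → False

theorem bad_swapStep [Fintype V] (hV : D.Valid) (hE : D.Embeds G τ)
    {rec : ℕ → List ℕ → Option (List ℕ)} {u : ℕ}
    (hrec : ∀ s st r, rec s st = some r → D.Bad G τ false u s) {s v : ℕ} {i j : Fin 6}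
    {fresh : Bool} {st r : List ℕ}
    (h : swapStep D rec s i j v st = some r) : D.Bad G τ fresh u s := by
  intro hu c σ hc hR _
  rw [swapStep, force_eq, force_eq] at h
  have hbit : ∀ p, (lane s i ^^^ lane s j).testBit p = true →
      p < 24 ∧ (D.Holds τ c p (σ i) ∨ D.Holds τ c p (σ j)) := by
    intro p hp
    simp only [Nat.testBit_xor, testBit_lane] at hp
    have : p < 24 := by
      by_contra h
      simp [h] at hp
    refine ⟨this, ?_⟩
    simp only [this, decide_true, Bool.true_and] at hp
    by_cases h : s.testBit (24 * i + p) = true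
    · exact Or.inl (hR i p this h)
    · exact Or.inr (hR j p this (by simpa [h] using hp))
  have hbitO : ∀ p, (Nat.mod (Nat.lor (lane s i) (lane s j)) 65536).testBit p = true →
      p < 16 ∧ (D.Holds τ c p (σ i) ∨ D.Holds τ c p (σ j)) := by
    intro p hp
    change (((lane s i) ||| (lane s j)) % 2 ^ 16).testBit p = true at hp
    simp only [Nat.testBit_mod_two_pow, Nat.testBit_or, testBit_lane, Bool.and_eq_true,
      Bool.or_eq_true, decide_eq_true_eq] at hp
    exact ⟨hp.1, hp.2.imp (fun h => hR i p h.1 h.2) fun h => hR j p h.1 h.2⟩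
  set S := comp c (σ i) (σ j) (τ v) with hSdef
  have hS : Closed c (σ i) (σ j) S := comp_closed hc _ _ _
  obtain ⟨I, st', r', hI, hI'⟩ := swapGo_sound (masks := D.masks) (In := fun w => τ w ∈ S)
    (O := Nat.mod (Nat.lor (lane s i) (lane s j)) 65536)
    (X := Nat.xor (lane s i) (lane s j)) (v := v)
    mem_comp_self (by
      intro w w' p hw hw' hin hout hp hpw hpw'
      obtain ⟨h16, hp⟩ := hbitO p hp
      have h1 := (site_mem_iff hV hS (by omega) hp).1 ⟨w, hw, hin, hpw⟩
      rw [holds_edge h16, holds_edge h16, ← and_or_left] at hp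
      have hcl := hS _ _ hp.2
      rw [site, if_pos h16] at h1
      rcases (hV.testBit hw' (by omega)).1 hpw' with ⟨-, rfl | rfl⟩ | rfl
      · exact hout h1
      · exact hout (hcl.1 h1)
      · omega)
    (by
      intro T hT
      classical
      rw [← Finset.card_image_of_injOn (s := T) (f := τ) fun a ha b hb hab =>
        hE.inj _ (hT a ha).1 _ (hT b hb).1 hab]
      refine card_ends_le_two hc (σ i) (σ j) (τ v) _ fun x hx => ?_
      obtain ⟨w, hw, rfl⟩ := Finset.mem_image.1 hx
      obtain ⟨h1, h2, h3⟩ := hT w hw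
      refine ⟨h2, ?_⟩
      obtain ⟨p, hp16, hp⟩ := Nat.exists_ge_and_testBit_of_ge_two_pow (n := 16) h3
      rw [Nat.testBit_and, Bool.and_eq_true] at hp
      obtain ⟨h24, hp'⟩ := hbit p hp.1
      have : p = 16 + w := by
        rcases (hV.testBit h1 h24).1 hp.2 with h | h
        · have := hV.2.1
          omega
        · exact h
      rw [this, holds_vertex, holds_vertex] at hp'
      exact hp'.imp And.right And.right)
    D.masks 0 0 0 ∅ st r rfl (Nat.zero_le _) (by simp) (by simp) (by simp) (by simp) h
  exact hrec _ _ _ hI hu _ σ (hc.swapOn hS) (hR.swap hV hS hI') (by simp)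

theorem bad_fragStep (hV : D.Valid) (hE : D.Embeds G τ)
    {rec : ℕ → List ℕ → Option (List ℕ)} {u : ℕ}
    (hrec : ∀ s st r, rec s st = some r → D.Bad G τ false u s) {s F : ℕ} {i j : Fin 6}
    {fresh : Bool} {st r : List ℕ}
    (h : fragStep D rec s i j F st = some r) : D.Bad G τ fresh u s := by
  intro hu c σ hc hR _
  rw [fragStep] at h
  cases hm : inMask ((lane s i ||| lane s j) % 65536) (lane s i) (lane s j) F D.masks 0 0 0 with
  | none => simp [hm] at h
  | some I =>
  rw [hm] at h
  obtain ⟨h1, h2, h3⟩ := inMask_sound D.masks 0 0 0 rfl (Nat.zero_le _) hm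
  simp only [Nat.zero_testBit, Bool.false_eq_true, false_or, Nat.zero_le, true_and,
    forall_true_left] at h1 h2 h3
  have hbit : ∀ (a : Fin 6) p, (lane s a).testBit p = true → p < 24 ∧ D.Holds τ c p (σ a) := by
    intro a p hp
    simp only [testBit_lane, Bool.and_eq_true, decide_eq_true_eq] at hp
    exact ⟨hp.1, hR a p hp.1 hp.2⟩
  let S : Set V := {x | ∃ w < D.masks.length, F.testBit w = true ∧ τ w = x}
  have key : ∀ a : Fin 6, (∀ p, (lane s a).testBit p = true →
      ((lane s i ||| lane s j)).testBit p = true) →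
      (∀ w < D.masks.length, F.testBit w = true → lane s a &&& D.masks.getD w 0 ≠ 0) →
      ∀ x y, c x y = some (σ a) → x ∈ S → y ∈ S := by
    rintro a ha ha' x y hxy ⟨w, hw, hF, rfl⟩
    obtain ⟨p, hp⟩ := Nat.exists_testBit_of_ne_zero (ha' w hw hF)
    rw [Nat.testBit_and, Bool.and_eq_true] at hp
    obtain ⟨h24, hp'⟩ := hbit a p hp.1
    rcases (hV.testBit hw h24).1 hp.2 with ⟨hpe, h5⟩ | rfl
    · have h16 : p < 16 := lt_of_lt_of_le hpe hV.2.1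
      have h4 := ((holds_edge h16).1 hp').2
      have hr := h3 p ((h1 p).2 ⟨w, hw, hF, hp.2⟩) (by
        change ((lane s i ||| lane s j) % 2 ^ 16).testBit p = true
        rw [Nat.testBit_mod_two_pow, ha p hp.1]
        simpa using h16)
      obtain ⟨e1, e2, -⟩ := hV.2.2.2.1 p hpe
      rcases h5 with rfl | rfl
      · exact ⟨_, e2, hr _ e2 ((hV.testBit e2 h24).2 (Or.inl ⟨hpe, Or.inr rfl⟩)), hc.inj h4 hxy⟩
      · rw [hc.symm] at h4
        exact ⟨_, e1, hr _ e1 ((hV.testBit e1 h24).2 (Or.inl ⟨hpe, Or.inl rfl⟩)), hc.inj h4 hxy⟩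
    · exact absurd hxy ((holds_vertex.1 hp').2 y)
  have key' : ∀ x y, c x y = some (σ i) ∨ c x y = some (σ j) → x ∈ S → y ∈ S := by
    rintro x y (h | h)
    · exact key i (fun p hp => by simp [hp]) (fun w hw hF => (h2 w hw hF).1) x y h
    · exact key j (fun p hp => by simp [hp]) (fun w hw hF => (h2 w hw hF).2) x y h
  have hS : Closed c (σ i) (σ j) S := fun x y h =>
    ⟨key' x y h, key' y x (by rwa [hc.symm y x])⟩
  refine hrec _ _ _ h hu _ σ (hc.swapOn hS) (hR.swap (S := S) hV hS fun p _ => ?_) (by simp)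
  rw [h1]
  refine exists_congr fun w => and_congr_right fun hw => and_congr_left fun _ => ?_
  constructor
  · exact fun hF => ⟨w, hw, hF, rfl⟩
  · rintro ⟨w', hw', hF, e⟩
    rwa [← hE.inj _ hw' _ hw e]

end Config

end Kempe

namespace Kempe

namespace Config

variable {G : SimpleGraph V} {c : V → V → Option (Fin 6)} {D : Config} {τ : ℕ → V}
  {s : ℕ} {σ : Equiv.Perm (Fin 6)}

theorem Realizes.query (hR : D.Realizes τ s c σ) {b msk : ℕ} (hb : b < 24) {t : Fin 6}
    (hbt : D.Holds τ c b (σ t)) (hmsk : lane s t &&& msk = 0)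
    {f : ℕ → List ℕ → Option (List ℕ)} {st r : List ℕ}
    (h : queryGo s msk b f 6 0 st = some r) :
    ∃ s' σ' st' r', f s' st' = some r' ∧ D.Realizes τ s' c σ' := by
  classical
  have hex : ∃ l, lane s l = lane s t := ⟨t, rfl⟩
  obtain ⟨hl, hmin⟩ := Nat.find_spec hex, fun m => Nat.find_min (m := m) hex
  have hlt : Nat.find hex < 6 := (Nat.find_le (h := hex) rfl).trans_lt t.2
  generalize Nat.find hex = l at hl hmin hlt
  obtain ⟨st', r', hr⟩ := queryGo_sound 6 h l (Nat.zero_le _) (by omega) (by rw [hl]; exact hmsk)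
    fun m hm => by rw [hl]; exact hmin m hm
  refine ⟨_, (Equiv.swap ⟨l, hlt⟩ t).trans σ, st', r', hr, fun k p hp hk => ?_⟩
  rw [Nat.testBit_or, Bool.or_eq_true] at hk
  rw [Equiv.trans_apply]
  have hbits : s.testBit (24 * l + p) = s.testBit (24 * t + p) := by
    have := congrArg (·.testBit p) hl
    simpa [testBit_lane, hp] using this
  rcases hk with hk | hk
  · by_cases h1 : k = ⟨l, hlt⟩
    · subst h1
      rw [Equiv.swap_apply_left]
      exact hR t p hp (by rw [← hbits]; exact hk)
    · by_cases h2 : k = t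
      · subst h2
        rw [Equiv.swap_apply_right]
        exact hR _ p hp (by rw [← hk]; exact hbits)
      · rw [Equiv.swap_apply_of_ne_of_ne h1 h2]
        exact hR k p hp hk
  · obtain ⟨h1, rfl⟩ := (testBit_one_shift hb hp).1 hk
    have : k = ⟨l, hlt⟩ := Fin.ext h1
    rw [this, Equiv.swap_apply_left]
    exact hbt

/-- A position at `w` showing a color which is present at `w`. -/
theorem Realizes.eq_edge (hV : D.Valid) (hc : IsColoring H c) (hR : D.Realizes τ s c σ)
    {w p : ℕ} {t : Fin 6} {x : V} (hw : w < D.masks.length) (hx : c (τ w) x = some (σ t))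
    (h : (lane s t).testBit p = true) (hp : (D.masks.getD w 0).testBit p = true) :
    p < D.edges.length ∧ s(τ (D.fst p), τ (D.snd p)) = s(τ w, x) := by
  rw [testBit_lane, Bool.and_eq_true, decide_eq_true_eq] at h
  have hh := hR t p h.1 h.2
  rcases (hV.testBit hw h.1).1 hp with ⟨hpe, hpw⟩ | rfl
  · have h2 := ((holds_edge (hpe.trans_le hV.2.1)).1 hh).2
    refine ⟨hpe, ?_⟩
    rcases hpw with rfl | rfl
    · rw [hc.inj hx h2]
    · rw [hc.symm] at h2
      rw [hc.inj hx h2, Sym2.eq_swap]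
  · exact absurd hx ((holds_vertex.1 hh).2 _)

theorem bad_queryEdge (hV : D.Valid) (hE : D.Embeds G τ)
    {rec : ℕ → List ℕ → Option (List ℕ)} {fresh : Bool} {u : ℕ}
    (hrec : ∀ s st r, rec s st = some r → D.Bad G τ fresh u s) {hi : ℕ}
    {st r : List ℕ} (h : queryEdge D rec u s hi st = some r) : D.Bad G τ fresh u s := by
  intro hu c σ hc hR hex
  rw [queryEdge] at h
  cases hb : Nat.beq hi u || Nat.ble D.edges.length hi || meets s hi hi with
  | true => simp [hb] at h
  | false =>
  rw [hb, cond_false] at h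
  simp only [Bool.or_eq_false_iff] at hb
  obtain ⟨⟨h1, h2⟩, h3⟩ := hb
  have h1 : hi ≠ u := Nat.ne_of_beq_eq_false h1
  have h2 : hi < D.edges.length := by
    by_contra h
    rw [Nat.ble_eq_true_of_le (not_lt.1 h)] at h2
    cases h2
  obtain ⟨k, hk⟩ := (hc.dom (τ (D.fst hi)) (τ (D.snd hi))).2
    ((deleteEdges_adj).2 ⟨hE.adj _ h2, by simpa using hE.sym2_ne hV h2 hu h1⟩)
  obtain ⟨t, rfl⟩ := σ.surjective k
  obtain ⟨e1, e2, -⟩ := hV.2.2.2.1 hi h2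
  have h16 := h2.trans_le hV.2.1
  obtain ⟨s', σ', st', r', hr, hR'⟩ := hR.query (b := hi) (t := t) (by omega)
    ((holds_edge h16).2 ⟨h2, hk⟩) (by
      refine Nat.eq_of_testBit_eq fun p => ?_
      rw [Nat.zero_testBit, Bool.eq_false_iff]
      intro hp
      rw [Nat.testBit_and, Nat.testBit_or, Bool.and_eq_true, Bool.or_eq_true] at hp
      obtain ⟨hp1, hp2⟩ := hp
      have : p < D.edges.length ∧
          s(τ (D.fst p), τ (D.snd p)) = s(τ (D.fst hi), τ (D.snd hi)) := by
        rcases hp2 with hp2 | hp2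
        · exact hR.eq_edge hV hc e1 hk hp1 hp2
        · rw [Sym2.eq_swap (a := τ (D.fst hi))]
          exact hR.eq_edge hV hc e2 (by rw [hc.symm]; exact hk) hp1 hp2
      have hpe : p = hi := by
        by_contra hne
        exact hE.sym2_ne hV this.1 h2 hne this.2
      subst hpe
      rw [testBit_lane, Bool.and_eq_true] at hp1
      rw [(meets_eq s p p).2 ⟨t, t.2, hp1.2, hp1.2⟩] at h3
      cases h3) h
  exact hrec _ _ _ hr hu c σ' hc hR' hex

theorem bad_queryVertex [Finite V] (hV : D.Valid) (hE : D.Embeds G τ)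
    {rec : ℕ → List ℕ → Option (List ℕ)} {fresh : Bool} {u : ℕ}
    (hrec : ∀ s st r, rec s st = some r → D.Bad G τ fresh u s) {hi : ℕ}
    {st r : List ℕ} (h : queryVertex D rec u s hi st = some r) : D.Bad G τ fresh u s := by
  intro hu c σ hc hR hex
  rw [queryVertex] at h
  cases hb : Nat.ble (missCount s (16 + hi) + 1) (D.slack.getD hi 0 +
      bif Nat.beq (D.edges.getD u (0, 0)).1 hi || Nat.beq (D.edges.getD u (0, 0)).2 hi
      then 1 else 0) && Nat.ble (hi + 1) D.masks.length with
  | false =>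
    rw [hb] at h
    cases h
  | true =>
  rw [hb, cond_true] at h
  rw [Bool.and_eq_true] at hb
  have h1 := Nat.le_of_ble_eq_true hb.1
  have h2 : hi < D.masks.length := Nat.le_of_ble_eq_true hb.2
  have h8 := hV.1
  have hcard := card_missing_add hc (τ hi)
  rw [Fintype.card_fin] at hcard
  have hsl := hE.slack hi h2
  have hdeg : deg (G.deleteEdges {s(τ (D.fst u), τ (D.snd u))}) (τ hi) +
      (bif Nat.beq (D.edges.getD u (0, 0)).1 hi || Nat.beq (D.edges.getD u (0, 0)).2 hi
        then 1 else 0) = deg G (τ hi) := by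
    by_cases ha : D.fst u = hi
    · have : Nat.beq (D.edges.getD u (0, 0)).1 hi = true := Nat.beq_eq.mpr ha
      rw [this, Bool.true_or, cond_true, ← ha]
      exact deg_delete (hE.adj u hu)
    · have h5 : Nat.beq (D.edges.getD u (0, 0)).1 hi = false := by
        rw [← Bool.not_eq_true, Nat.beq_eq]; exact ha
      rw [h5, Bool.false_or]
      obtain ⟨u1, u2, -⟩ := hV.2.2.2.1 u hu
      by_cases hb : D.snd u = hi
      · have : Nat.beq (D.edges.getD u (0, 0)).2 hi = true := Nat.beq_eq.mpr hb
        rw [this, cond_true, ← hb, Sym2.eq_swap]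
        exact deg_delete (hE.adj u hu).symm
      · have h6 : Nat.beq (D.edges.getD u (0, 0)).2 hi = false := by
          rw [← Bool.not_eq_true, Nat.beq_eq]; exact hb
        rw [h6, cond_false, Nat.add_zero]
        exact deg_delete_of_ne (fun e => ha (hE.inj _ u1 _ h2 e.symm))
          fun e => hb (hE.inj _ u2 _ h2 e.symm)
  have hlt : missCount s (16 + hi) < {k | Missing c (τ hi) k}.ncard := by omega
  obtain ⟨t, ht, ht'⟩ : ∃ t : Fin 6, Missing c (τ hi) (σ t) ∧
      ¬ s.testBit (24 * t + (16 + hi)) = true := by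
    by_contra! hall
    refine hlt.not_ge ?_
    rw [missCount_eq, ← Set.ncard_coe_finset, ← Set.ncard_preimage_of_injective_subset_range
      σ.injective (by simp [σ.surjective.range_eq])]
    exact Set.ncard_le_ncard fun t ht => by simpa using hall t ht
  obtain ⟨s', σ', st', r', hr, hR'⟩ := hR.query (b := 16 + hi) (t := t) (by omega)
    (holds_vertex.2 ⟨h2, ht⟩) (by
      refine Nat.eq_of_testBit_eq fun p => ?_
      rw [Nat.zero_testBit, Bool.eq_false_iff]
      intro hp
      rw [Nat.testBit_and, testBit_lane, Bool.and_eq_true, Bool.and_eq_true,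
        decide_eq_true_eq] at hp
      obtain ⟨⟨hp0, hp1⟩, hp2⟩ := hp
      rcases (hV.testBit h2 hp0).1 hp2 with ⟨hpe, hpw⟩ | rfl
      · have h7 := ((holds_edge (hpe.trans_le hV.2.1)).1 (hR t p hp0 hp1)).2
        rcases hpw with rfl | rfl
        · exact ht _ h7
        · rw [hc.symm] at h7
          exact ht _ h7
      · exact ht' hp1) h
  exact hrec _ _ _ hr hu c σ' hc hR' hex

theorem hinge_sound {e f : ℕ × ℕ} {g : ℕ → ℕ → Option (List ℕ)} {r : List ℕ}
    (h : hinge e f g = some r) :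
    ∃ x y z, g y z = some r ∧ s(e.1, e.2) = s(x, y) ∧ s(f.1, f.2) = s(x, z) := by
  unfold hinge at h
  cases h1 : Nat.beq e.1 f.1
  · cases h2 : Nat.beq e.1 f.2
    · cases h3 : Nat.beq e.2 f.1
      · cases h4 : Nat.beq e.2 f.2
        · simp [h1, h2, h3, h4] at h
        · have h4' := Nat.beq_eq.mp h4
          exact ⟨e.2, e.1, f.1, by simpa [h1, h2, h3, h4] using h, Sym2.eq_swap,
            by rw [h4', Sym2.eq_swap]⟩
      · have h3' := Nat.beq_eq.mp h3
        exact ⟨e.2, e.1, f.2, by simpa [h1, h2, h3] using h, Sym2.eq_swap, by rw [h3']⟩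
    · have h2' := Nat.beq_eq.mp h2
      exact ⟨e.1, e.2, f.1, by simpa [h1, h2] using h, rfl, by rw [h2', Sym2.eq_swap]⟩
  · have h1' := Nat.beq_eq.mp h1
    exact ⟨e.1, e.2, f.2, by simpa [h1] using h, rfl, by rw [h1']⟩

theorem bad_shiftStep (hV : D.Valid) (hE : D.Embeds G τ)
    {rec : ℕ → ℕ → List ℕ → Option (List ℕ)}
    (hrec : ∀ u s st r, rec u s st = some r → D.Bad G τ false u s) {u hi : ℕ} {k : Fin 6}
    {fresh : Bool} {st r : List ℕ}
    (h : shiftStep D rec u s k hi st = some r) : D.Bad G τ fresh u s := by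
  intro hu c σ hc hR _
  obtain ⟨x, y, z, h, hxy, hxz⟩ := hinge_sound h
  change s(D.fst u, D.snd u) = s(x, y) at hxy
  change s(D.fst hi, D.snd hi) = s(x, z) at hxz
  cases hb : Nat.beq (bit s (24 * k + hi)) 1 && Nat.beq (bit s (24 * k + (16 + y))) 1 &&
      Nat.ble (hi + 1) D.edges.length with
  | false => simp [hb] at h
  | true =>
  rw [hb, cond_true] at h
  simp only [Bool.and_eq_true, Nat.beq_eq, bit_eq] at hb
  obtain ⟨⟨b1, b2⟩, b3⟩ := hb
  have b1 : s.testBit (24 * k + hi) = true := by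
    by_contra h
    simp [h] at b1
  have b2 : s.testBit (24 * k + (16 + y)) = true := by
    by_contra h
    simp [h] at b2
  have hhi : hi < D.edges.length := Nat.le_of_ble_eq_true b3
  have h8 := hV.1
  have h16 := hV.2.1
  have hτ : ∀ {a b a' b' : ℕ}, s(a, b) = s(a', b') → s(τ a, τ b) = s(τ a', τ b') := by
    intro a b a' b' h
    simpa using congrArg (Sym2.map τ) h
  have hlt : ∀ {e a b : ℕ}, e < D.edges.length → s(D.fst e, D.snd e) = s(a, b) →
      a < D.masks.length ∧ b < D.masks.length ∧ G.Adj (τ a) (τ b) := by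
    intro e a b he h
    obtain ⟨e1, e2, -⟩ := hV.2.2.2.1 e he
    have := hE.adj e he
    rcases Sym2.eq_iff.1 h with ⟨rfl, rfl⟩ | ⟨rfl, rfl⟩
    · exact ⟨e1, e2, this⟩
    · exact ⟨e2, e1, this.symm⟩
  have hcol : ∀ {e a b : ℕ} {l : Fin 6}, s(D.fst e, D.snd e) = s(a, b) →
      c (τ (D.fst e)) (τ (D.snd e)) = some l → c (τ a) (τ b) = some l := by
    intro e a b l h h'
    rcases Sym2.eq_iff.1 h with ⟨rfl, rfl⟩ | ⟨rfl, rfl⟩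
    · exact h'
    · rwa [hc.symm]
  obtain ⟨hx, hy, axy⟩ := hlt hu hxy
  obtain ⟨-, hz, axz⟩ := hlt hhi hxz
  rw [hτ hxy] at hc
  have my := (holds_vertex.1 (hR k _ (by omega) b2)).2
  have cz : c (τ x) (τ z) = some (σ k) :=
    hcol hxz ((holds_edge (by omega)).1 (hR k _ (by omega) b1)).2
  have cu : ∀ l, c (τ x) (τ y) ≠ some l := fun l hl => by
    simpa using (hc.dom _ _).1 ⟨l, hl⟩
  have hne : u ≠ hi := by
    rintro rfl
    rw [hxy] at hxz
    have : y = z := Sym2.congr_right.1 hxz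
    subst this
    exact cu _ cz
  have hyz : τ x ≠ τ y ∧ τ x ≠ τ z := ⟨axy.ne, axz.ne⟩
  have hyz' : τ y ≠ τ z := fun h => cu (σ k) (by rw [h, cz])
  have ndist : s(τ x, τ y) ≠ s(τ x, τ z) := fun h => hyz' (Sym2.congr_right.1 h)
  have hcoll := hc.shift axy my cz
  rw [← hτ hxz] at hcoll
  refine hrec _ _ _ _ h hhi _ σ hcoll (fun l p hp hb => ?_) (by simp)
  rw [Nat.testBit_xor, Nat.testBit_or, Nat.testBit_or, Nat.testBit_or] at hb
  have t1 := testBit_one_shift (k := k) (l := l) (p := hi) (q := p) (by omega) hp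
  have t2 := testBit_one_shift (k := k) (l := l) (p := u) (q := p) (by omega) hp
  have t3 := testBit_one_shift (k := k) (l := l) (p := 16 + y) (q := p) (by omega) hp
  have t4 := testBit_one_shift (k := k) (l := l) (p := 16 + z) (q := p) (by omega) hp
  have hnb : ∀ a b, s(a, b) ≠ s(τ x, τ y) → s(a, b) ≠ s(τ x, τ z) →
      recolor (recolor c (τ x) (τ z) none) (τ x) (τ y) (some (σ k)) a b = c a b :=
    fun a b h1 h2 => by rw [recolor_of_ne h1, recolor_of_ne h2]
  have hnxz : ∀ a b, s(a, b) = s(τ x, τ z) →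
      recolor (recolor c (τ x) (τ z) none) (τ x) (τ y) (some (σ k)) a b = none :=
    fun a b h => by
      rw [recolor_of_ne (by rw [h]; exact ndist.symm), recolor, if_pos h]
  have hnxy : ∀ a b, s(a, b) = s(τ x, τ y) →
      recolor (recolor c (τ x) (τ z) none) (τ x) (τ y) (some (σ k)) a b = some (σ k) :=
    fun a b h => by rw [recolor, if_pos h]
  by_cases c2 : (l : ℕ) = k ∧ p = u
  · obtain ⟨e, rfl⟩ := c2
    obtain rfl : l = k := Fin.ext e
    rw [holds_edge (by omega)]
    exact ⟨hu, hnxy _ _ (hτ hxy)⟩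
  by_cases c4 : (l : ℕ) = k ∧ p = 16 + z
  · obtain ⟨e, rfl⟩ := c4
    obtain rfl : l = k := Fin.ext e
    rw [holds_vertex]
    refine ⟨hz, fun w hw => ?_⟩
    by_cases e1 : s(τ z, w) = s(τ x, τ y)
    · rcases Sym2.eq_iff.1 e1 with ⟨e, -⟩ | ⟨e, -⟩
      · exact hyz.2 e.symm
      · exact hyz' e.symm
    · by_cases e2 : s(τ z, w) = s(τ x, τ z)
      · rw [hnxz _ _ e2] at hw
        cases hw
      · rw [hnb _ _ e1 e2] at hw
        rw [hc.symm] at cz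
        exact e2 (by rw [hc.inj hw cz, Sym2.eq_swap])
  have c13 : ¬ ((l : ℕ) = k ∧ p = hi) ∧ ¬ ((l : ℕ) = k ∧ p = 16 + y) := by
    constructor
    · rintro ⟨e1, e2⟩
      rw [t1.2 ⟨e1, e2⟩, e1, e2, b1] at hb
      simp at hb
    · rintro ⟨e1, e2⟩
      rw [t3.2 ⟨e1, e2⟩, e1, e2, b2] at hb
      simp at hb
  have hs : s.testBit (24 * l + p) = true := by
    have f1 := Bool.eq_false_iff.2 (fun h => c13.1 (t1.1 h))
    have f2 := Bool.eq_false_iff.2 (fun h => c2 (t2.1 h))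
    have f3 := Bool.eq_false_iff.2 (fun h => c13.2 (t3.1 h))
    have f4 := Bool.eq_false_iff.2 (fun h => c4 (t4.1 h))
    rw [f1, f2, f3, f4] at hb
    simpa using hb
  have hh := hR l p hp hs
  by_cases hp16 : p < 16
  · rw [holds_edge hp16] at hh ⊢
    refine ⟨hh.1, ?_⟩
    rw [hnb _ _ ?_ ?_]
    · exact hh.2
    · intro e
      have := hh.2
      rcases Sym2.eq_iff.1 e with ⟨e1, e2⟩ | ⟨e1, e2⟩
      · rw [e1, e2] at this
        exact cu _ this
      · rw [e1, e2, hc.symm] at this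
        exact cu _ this
    · intro e
      have hpe : p = hi := by
        by_contra hne
        exact hE.sym2_ne hV hh.1 hhi hne (by rw [e, hτ hxz])
      subst hpe
      have := hcol hxz hh.2
      rw [cz, Option.some.injEq] at this
      exact c13.1 ⟨congrArg Fin.val (σ.injective this).symm, rfl⟩
  · obtain ⟨w, rfl⟩ := Nat.exists_eq_add_of_le (not_lt.1 hp16)
    rw [holds_vertex] at hh ⊢
    refine ⟨hh.1, fun v hv => ?_⟩
    by_cases e1 : s(τ w, v) = s(τ x, τ y)
    · rw [hnxy _ _ e1, Option.some.injEq] at hv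
      have hlk := σ.injective hv
      subst hlk
      rcases Sym2.eq_iff.1 e1 with ⟨e, -⟩ | ⟨e, -⟩
      · rw [e] at hh
        exact hh.2 _ cz
      · have := hE.inj _ hh.1 _ hy e
        exact c13.2 ⟨rfl, by rw [this]⟩
    · by_cases e2 : s(τ w, v) = s(τ x, τ z)
      · rw [hnxz _ _ e2] at hv
        cases hv
      · rw [hnb _ _ e1 e2] at hv
        exact hh.2 _ hv

theorem bad_step [Fintype V] (hV : D.Valid) (hE : D.Embeds G τ)
    {rec : Bool → ℕ → ℕ → List ℕ → Option (List ℕ)}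
    (hrec : ∀ fresh u s st r, rec fresh u s st = some r → D.Bad G τ fresh u s)
    {fresh : Bool} {u lo hi : ℕ} {st r : List ℕ}
    (h : step D rec fresh u s lo hi st = some r) : D.Bad G τ fresh u s := by
  unfold step at h
  cases h36 : Nat.ble 36 lo with
  | false =>
    rw [h36, cond_false] at h
    have : lo < 36 := by
      by_contra h
      rw [Nat.ble_eq_true_of_le (not_lt.1 h)] at h36
      cases h36
    exact bad_fragStep (i := ⟨lo / 6, by omega⟩) (j := ⟨lo % 6, by omega⟩) hV hE
      (fun s st r => hrec false u s st r) h
  | true =>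
    rw [h36, cond_true] at h
    have h36 := Nat.le_of_ble_eq_true h36
    cases h72 : Nat.ble 72 lo with
    | false =>
      rw [h72, cond_false] at h
      have : lo < 72 := by
        by_contra h
        rw [Nat.ble_eq_true_of_le (not_lt.1 h)] at h72
        cases h72
      exact bad_swapStep (i := ⟨(lo - 36) / 6, by omega⟩) (j := ⟨lo % 6, by omega⟩) hV hE
        (fun s st r => hrec false u s st r) h
    | true =>
      rw [h72, cond_true] at h
      have h72 := Nat.le_of_ble_eq_true h72
      cases h78 : Nat.ble 78 lo with
      | false =>
        rw [h78, cond_false] at h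
        have : lo < 78 := by
          by_contra h
          rw [Nat.ble_eq_true_of_le (not_lt.1 h)] at h78
          cases h78
        exact bad_shiftStep (k := ⟨lo - 72, by omega⟩) hV hE (hrec false) h
      | true =>
        rw [h78, cond_true] at h
        cases hq : Nat.beq lo 78 with
        | true =>
          rw [hq, cond_true] at h
          exact bad_queryEdge hV hE (hrec fresh u) h
        | false =>
          rw [hq, cond_false] at h
          exact bad_queryVertex hV hE (hrec fresh u) h

theorem run_succ (n : ℕ) (fresh : Bool) (u s : ℕ) (st : List ℕ) :
    run D (n + 1) fresh u s st =
      bif meets s (16 + D.fst u) (16 + D.snd u) || (fresh && isExempt s D.exempt) then some st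
      else step D (run D n) fresh u s ((fetch st).1 % 256) ((fetch st).1 / 256) (fetch st).2 := by
  have : run D (n + 1) fresh u s st = force s fun s =>
      bif meets s (16 + D.fst u) (16 + D.snd u) || (fresh && isExempt s D.exempt) then some st else
      force (Nat.mod (fetch st).1 (nat_lit 256)) fun lo =>
      force (Nat.div (fetch st).1 (nat_lit 256)) fun hi =>
        step D (run D n) fresh u s lo hi (fetch st).2 := rfl
  simp only [this, force_eq]
  rfl

theorem bad_run [Fintype V] (hV : D.Valid) (hG : Uncolorable (Fin 6) G) (hE : D.Embeds G τ)
    (n : ℕ) : ∀ (fresh : Bool) (u s : ℕ) (st r : List ℕ), run D n fresh u s st = some r →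
      D.Bad G τ fresh u s := by
  induction n with
  | zero => intro _ _ _ _ _ h; cases h
  | succ n ih =>
    intro fresh u s st r h
    rw [run_succ] at h
    cases h1 : meets s (16 + D.fst u) (16 + D.snd u) with
    | true =>
      intro hu c σ hc hR _
      obtain ⟨k, hk, b1, b2⟩ := (meets_eq _ _ _).1 h1
      obtain ⟨e1, e2, -⟩ := hV.2.2.2.1 u hu
      have h8 := hV.1
      exact not_both_missing hG (hE.adj u hu) hc
        (holds_vertex.1 (hR ⟨k, hk⟩ _ (by omega) b1)).2
        (holds_vertex.1 (hR ⟨k, hk⟩ _ (by omega) b2)).2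
    | false =>
      rw [h1, Bool.false_or] at h
      cases h2 : fresh && isExempt s D.exempt with
      | true =>
        rw [Bool.and_eq_true] at h2
        exact fun hu c σ hc hR hex => hex h2.1 (hR.exempt hV h2.2)
      | false =>
        rw [h2, cond_false] at h
        exact bad_step hV hE ih h

end Config

/-- A configuration with a successful replay does not occur in a critical graph, unless every
coloring shows an exempted pattern. -/
theorem Config.exempt_of_refutes [Fintype V] {G : SimpleGraph V} {D : Config} {τ : ℕ → V}
    {st : List ℕ} (h : refutes D st = true) (hV : D.Valid) (hG : Uncolorable (Fin 6) G)
    (hE : D.Embeds G τ) {c : V → V → Option (Fin 6)}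
    (hc : IsColoring (G.deleteEdges {s(τ (D.fst 0), τ (D.snd 0))}) c) : D.Exempt τ c := by
  obtain ⟨r, hr⟩ := Option.isSome_iff_exists.1 h
  by_contra hex
  exact bad_run hV hG hE 200 true 0 0 st r hr hV.2.2.1 c 1 hc
    (fun k p _ h => by simp at h) fun _ => hex

theorem Config.not_embeds [Fintype V] {G : SimpleGraph V} {D : Config} {st : List ℕ}
    (h : refutes D st = true) (hV : D.Valid) (hD : D.exempt = []) (hG : Critical 6 G)
    (τ : ℕ → V) : ¬ D.Embeds G τ := fun hE => by
  obtain ⟨c, hc⟩ := hG.colorable (hE.adj 0 hV.2.2.1)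
  obtain ⟨l, hl, -⟩ := Config.exempt_of_refutes h hV hG.uncolorable hE hc
  rw [hD] at hl
  cases hl

end Kempe

namespace Kempe

/-- A path `x y w u` from a vertex of degree two to one of degree at most four. -/
def pathTwoFour : Config :=
  ⟨[65537, 131075, 262150, 524292], [(0, 1), (1, 2), (2, 3)], [4, 0, 0, 2], []⟩

def pathTwoFour_cert : List ℕ :=
  [169351695488284845730190077192656217960651269982617173465632531075461111979653030779821735207168910602772559787254465172537423]

theorem pathTwoFour_refuted : refutes pathTwoFour pathTwoFour_cert = true := by decide +kernel

/-- A triangle `x y z` with `x` of degree two and a path `y w y' x'` to a vertex of degree two. -/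
def triangleTailTwo : Config :=
  ⟨[65539, 131085, 262150, 524312, 1048624, 2097184],
  [(0, 1), (0, 2), (1, 2), (1, 3), (3, 4), (4, 5)], [4, 0, 0, 0, 0, 4], []⟩

def triangleTailTwo_cert : List ℕ :=
  [158053893468040814781914924386157604581417210999833483779301740594532333996042628246261109500241520527169754974340320781938256453717329154936490720103918473073299716113507682138669871088650196054889588108256300723672016474886937127210210888579433062497871246894804517419466673167626535241268092677815887527585441807442237969561389532601332644408785134166526866562857786338342824677739666801411930397535385591323350883901182541714567425019135711339798150212805385453902]

theorem triangleTailTwo_refuted : refutes triangleTailTwo triangleTailTwo_cert = true := by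
  decide +kernel

/-- Two 4-cycles sharing `w` whose vertices opposite to `w` have degree two. -/
def squaresTwoTwo : Config :=
  ⟨[65539, 131077, 262154, 524348, 1048656, 2097344, 4194464],
  [(0, 1), (0, 2), (1, 3), (2, 3), (3, 4), (3, 6), (4, 5), (5, 6)], [4, 0, 0, 0, 0, 4, 0], []⟩

def squaresTwoTwo_cert : List ℕ :=
  [30804000318729684046705836263497416773071711225485540498085493824462551995304100438624156719097223633258824796468312609837398400766848095425547640837946095727983620532867676412187345091356741380204554605277810560253302798399385003132220037674721034810794084845491856479580587584445384413314368576278828293438149469016103128483733379488755932920766671663394631851247257819484087310256626356677822187294706472202092930282213365802532943]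

theorem squaresTwoTwo_refuted : refutes squaresTwoTwo squaresTwoTwo_cert = true := by decide +kernel

/-- A path `x' x z u` with degrees at most 4, 4, 6, 5. -/
def pathFourFourFive : Config :=
  ⟨[65539, 131073, 262150, 524292], [(0, 1), (0, 2), (2, 3)], [2, 2, 0, 1], []⟩

def pathFourFourFive_cert : List ℕ :=
  [39439883848961539105685622477159264230434253804932830479437394391547647992725870111153992850240276440139881906110543]

theorem pathFourFourFive_refuted : refutes pathFourFourFive pathFourFourFive_cert = true := by
  decide +kernel

/-- A path `x' x z w u` with degrees at most 4, 4, 6, 6, 4. -/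
def pathFourFourFour : Config :=
  ⟨[65539, 131073, 262150, 524300, 1048584], [(0, 1), (0, 2), (2, 3), (3, 4)], [2, 2, 0, 0, 2], []⟩

def pathFourFourFour_cert : List ℕ :=
  [1274540113207310982620791392860983777893326658020417516121905808666912093690470968637664459906240478956738527997601449814355540081847089173045863131292433409492861245479955570199649578873598689012966615193195681808203973188168761417856816609127700442360266231919275309082217400088444415236168598613712426031093499791315667754726634998370259201190399544714374340240005194609726909493068033943774583021476262173853561264684354107261353148503502985310713036250509231258053579763475796071236814372290586972683447585512754010448602608883768724747389601734543268099007890572052612144871498701206097088868490145742321372510548821884989998478228570359955141332963918691444244917915897219621179443154741571288858025981879001484927632627662927]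

theorem pathFourFourFour_refuted : refutes pathFourFourFour pathFourFourFour_cert = true := by
  decide +kernel

/-- A vertex `x` of degree three with a neighbor of degree five and a path `x z w u` to a vertex of
degree at most four. -/
def threeFiveFarFour : Config :=
  ⟨[65543, 131073, 262154, 524292, 1048600, 2097168], [(0, 1), (0, 2), (0, 3), (2, 4), (4, 5)],
  [3, 1, 0, 0, 0, 2], []⟩

def threeFiveFarFour_cert : List ℕ :=
  [933999604856528602898871410624157886257086007744231619783981439329500990306562712377989340808369957357878092417266157436722280455652610069294149910743921187864090433802259177767494950482837913022536736843333849871215638843675136888833116821516649995298840862913627136488671926833412604455046221126176005741015229523772163968606518138486325327]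

theorem threeFiveFarFour_refuted : refutes threeFiveFarFour threeFiveFarFour_cert = true := by
  decide +kernel

/-- A vertex `x` of degree three with a neighbor of degree five and a path `x z u` to a vertex of
degree at most four. -/
def threeFiveFour : Config :=
  ⟨[65539, 131073, 262150, 524292], [(0, 1), (0, 2), (2, 3)], [3, 1, 0, 2], []⟩

def threeFiveFour_cert : List ℕ :=
  [2137486314292816393482170657944770287449378443635354971510714908980871570680446828899358687035471]

theorem threeFiveFour_refuted : refutes threeFiveFour threeFiveFour_cert = true := by decide +kernel

/-- A vertex `x` of degree three and paths `x y u` and `x z w` to distinct vertices of degree at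
most four. -/
def threeFourFour : Config :=
  ⟨[65543, 131081, 262162, 524292, 1048584, 2097168], [(0, 1), (0, 2), (0, 3), (1, 4), (2, 5)],
  [3, 0, 0, 0, 2, 2], []⟩

def threeFourFour_cert : List ℕ :=
  [926046282759141790123229338313483780219350730347079354084809767568344198895586472145303618875617350479512281593333413290327455286725084677195931675535235401352006953258073662151602810905671537433605088485104482777219543349506631504058235017376436098591241958730474981056031005788479759480303302613975032113242835617278288800590581948211598169405558505397327797561412189515265601572470642838633998595186994155674379421600438163536321482242221631462704648747018745166532840960826711555864854219510084996814888028515014024639390614244043914028068490663391935395088950945402667806251110877835074147013415870773178445864293552260415690137864292684245454622647233184782957959470783539912877905846477361357222585338645257740600661479185235041862386663567263686200848659974103448104324443640259571707424318806972982542814924294525094894579515412840294706273519910654751735887,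
   74777]

theorem threeFourFour_refuted : refutes threeFourFour threeFourFour_cert = true := by decide +kernel

/-- A 4-cycle `x y u z` with `x` of degree three and `u` of degree at most four. -/
def threeSquareFour : Config :=
  ⟨[65543, 131081, 262162, 524292, 1048600], [(0, 1), (0, 2), (0, 3), (1, 4), (2, 4)],
  [3, 0, 0, 0, 2], []⟩

def threeSquareFour_cert : List ℕ :=
  [2583868151236603094289470405218427027631364391739265402355770009299596296595925072352183632779301194355293187021384646735]

theorem threeSquareFour_refuted : refutes threeSquareFour threeSquareFour_cert = true := by
  decide +kernel

/-- A vertex `x` of degree four with two neighbors of degree five and a path `x t u` to a vertex of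
degree at most four. -/
def fourFiveFiveFour : Config :=
  ⟨[65543, 131073, 262146, 524300, 1048584], [(0, 1), (0, 2), (0, 3), (3, 4)], [2, 1, 1, 0, 2], []⟩

def fourFiveFiveFour_cert : List ℕ :=
  [3291381726053528654409567367933256489468100654394271946328235259933081157927487316988193619431392397878907011375719130379900565891412895435873666055925121962850956373374074469434165070705670288246429462164397444455703467840420557821413173201926111905126997840098369228841691949409946806897847534765349519405463609468916601882236590229112461169022863208630063328087177917634902198980640409036727025700364915905460810689662317437831135888023112016830689652747089276419292099131503999795829780684343707296096194665827551919886608617080019183494643200492475039775559523337175775256633469986335820119223766573061981671572622306655468443523792942151754490639547271430711953643448678467348925251377479195584702643110451157219612859195660195099857234200453127213875911409489602159173381582470691058138800971449512032187577770643692522425153164332333236516487247]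

theorem fourFiveFiveFour_refuted : refutes fourFiveFiveFour fourFiveFiveFour_cert = true := by
  decide +kernel

/-- A vertex `x` of degree four with a neighbor of degree five and paths `x z u` and `x t w` to
distinct vertices of degree at most four. -/
def fourFiveFourFour : Config :=
  ⟨[65551, 131073, 262162, 524324, 1048584, 2097168, 4194336],
  [(0, 1), (0, 2), (0, 3), (0, 4), (2, 5), (3, 6)], [2, 1, 0, 0, 0, 2, 2], []⟩

def fourFiveFourFour_cert : List ℕ :=
  [1186250950197937741830805304162115046125165050429630849550868582323272087121241034863114100361091975405993822261461183669423782344392884862935041317217262818842519501455435813735541369520063660790218730436568325135947342452848256969589811595065513358747446372705573289100738821082028326030921776192867178403063828933783183965885600022164821981379657685444717482653369343078282389464200176160121419383493179331385391440472697455925846722600689801451470923031144472393255331453049785144408597562427994880834295887759719221212524102292052064960677406093822406205993420634673315045929915811512851195016305323044065252444377776754633243565718576927272528258944000792055037019981576390647378942441168394493899987753597935198060446155577984745173881542517536811906069946942114890424705031928491355149370863165588756676758765958120936971972072002732728359622686190386589663311,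
   941086493103141191180744820072268667727919163973850681769287136334352144449706236314695881663918738128394129854250503062568964336055551494578037672409203529081045821446822746910416718007809511425213277786592400106558482267861739501843599715996959587985342345711991397720072438435515492146527662002848945291088213324491494024446099835904368173712776964664739324608462158437089846526676131734554147348743704071220384532406767425268750378031485679996266298688092562285419118778418911944112851333428465704390726154879888368422010297074397033012192640609765134959767327507129062494730828556876350738869830779482189821084172381517914375278489304399327665904274044022221252019976447786341864678403001465014789029309931410192058956026727180866667406255512735960256298339910895715610250770802500868112009685129652410249501203272334767957059325871320682937087307852057112543291,
   926243881076693406399294645771492728339219741559142640780660826839801976207445694409929613364911473037228296353719452171465599738524036427708212258423333345490140577440849612465060655171706592099469344348684035216207679424456527566469477485436015583946405653404792291540450354196855489935845131457991785844834588801195413801847684430265455719018929801058652450293764640282910925406065849966349455144293785304456959615414143147340452628774977904261298433823262118225666957684777601472446473545498980508232531358723237563350849294120476129593583499333427840858848575526953961985539578323505698611636262912827517017465587469987825354394842283721964602996349646753178252257107176901267209380444327512414219755982592382885675428476174161673835398392695391799580290277596922292864577143633032511939471964954330723750758838760924839003425678184611468852816950166404320929035,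
   926060290920014338323869415293311407255413392280623524437809155298348040206921430191672068564013766222193953464389486833118474957672593043085531195739159116915672663974072572896995161859532860123794989394546396461752370895121979912021262997743429487817451802100963336067251032691856624248423087030475119710570756690511113958942408723902615344752616394720603232154693941552741977722944245384481842414470538663691238226828799468655137145446777776322464400011528595487743895927825352055451485810256966241806164082618985887528572195395029674654772797239883240405876861514058625111707422359651379593502213172130984702561469591519461558434398737133935268916359740267204942155341970278589184472773773527493654997427296897238698707237161577871663257057930089217973243429706060963947869332362338012386048385152894762994854753895911151011936119515813589069014491549832502444073,
   926159375923654487862323068259429154706404566716639105511080229238500949266548663519128569337962908636402059700636710536735575703506293442485515625493475165525249008322527426827466268476390989651930855864189032421709370130403481681655891531625761127483138013824438505090669820962609460280966541789240220825981402783167231965860738513144242919998351867843373652479667170414969505076381886921037516187164720684455045549683064438183420790665401354044893738617820417096823726250390113188439934800654007693616251913296826380329971044306846795757894566036460739320530479871494839655660134915932666219171304451843257208949154826241775991202858581870685188154291181013135626752945289165629040332366938867058209782139508344087958269372871209084631130082622350536565881866241152633319853197520357805803106737533379571981990033033302888833436894679426447911538492436297276391468,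
   204802315501247949514280722891835463946118784832988672674295852966984763756335491810478802977936983468375645364336007641584016281951418391796962885671]

theorem fourFiveFourFour_refuted : refutes fourFiveFourFour fourFiveFourFour_cert = true := by
  decide +kernel

/-- A vertex `x` of degree four with a neighbor of degree five in a 4-cycle `x z u t` with `u` of
degree at most four. -/
def fourFiveSquareFour : Config :=
  ⟨[65551, 131073, 262162, 524324, 1048584, 2097200],
  [(0, 1), (0, 2), (0, 3), (0, 4), (2, 5), (3, 5)], [2, 1, 0, 0, 0, 2], []⟩

def fourFiveSquareFour_cert : List ℕ :=
  [12523651164143631701608735783314894533959611119929782189999216351307451085554262303131564911086578414796840400225451402794324950083403503097846030587901274109001087232844802223531424621342533606070873999956739921311358576309961304292159444581991625981989704315981522638059339622710683933010754560284281871465150389579581945575731260844408834080833358734528731633537896531322310873933202960340066051019671277110147549481941326818194718085412300085087220202862219976593461752129370231522844556066895]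

theorem fourFiveSquareFour_refuted : refutes fourFiveSquareFour fourFiveSquareFour_cert = true := by
  decide +kernel

/-- A 4-cycle `x y u z` and another neighbor `v` of `y`, where `x`, `u` and `v` have degree at most
four. -/
def squareFourFour : Config :=
  ⟨[65539, 131085, 262162, 524308, 1048584], [(0, 1), (0, 2), (1, 3), (1, 4), (2, 3)],
  [2, 0, 0, 2, 2], []⟩

def squareFourFour_cert : List ℕ :=
  [926357851290837082523920540809991409913761009227899105110108824876860337191570928273655953327889680120725449885677030876247569851226861216464938655189134591599928242408365402673965448164966051779946345139437470899881728562551078773132360195974562478618441992782544809503963620396711109099800752099676982348004813949182226696843499655194843026714738739757912168556176764469347465242983152066217847318452846217382814992027310340154304455669692063522073151606706217993753100712984723775346342474218048601897197261681638701158285575398806630734165691234658906713787693385948177161633030795242014198037811061209434952945540817721459256366329471773664710181092663496045927491223285019338589261173864240872254204192186442546185371443350306391792067427584461096943009272533293671130575363842776041454849889348801669057664360186206055879422883042468518803532737228410910081103,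
   246414235537873265529295716090711188781241950498486531481710384825250380643935931513359232605492999088755665347722483301641923363310859716723371584727343173377842377107930471938159235163415314474283947781063420767168659104266459756779782447905222493380476554314187214502829281125824537796333267297797894930616074842599319233661773550248668078164894729568414506919903505183842765203050620584669493246788753240082530827697126860385318465806049218988923856344907443627089352810211328024730110510923934840085597673012556523790423120716900042029980338741657962717057413724317957947143575906020501771402136258506621354906011675629676472045368953757936552892133195742506489549851534356466227429313314357287]

theorem squareFourFour_refuted : refutes squareFourFour squareFourFour_cert = true := by
  decide +kernel

/-- A vertex `x` of degree three with a neighbor `y` in a 4-cycle `y v u v'`, where `u` has degree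
three. -/
def threeSquareThree : Config :=
  ⟨[65543, 131113, 262146, 524292, 1048600, 2097232, 4194400],
  [(0, 1), (0, 2), (0, 3), (1, 4), (4, 5), (1, 6), (6, 5)], [3, 0, 0, 0, 0, 3, 0], []⟩

def threeSquareThree_cert : List ℕ :=
  [178374483497101113096738692167625752797431718212082630253434100715861878914066922813007294166420085745213667546668767896446947177690720811051371103987199569892897447576502615690268460416069453547194991403361568882046703632661208798000088586152623848948086346149175844186469539226533796014307280883478617532029747459346434165371761276565871581318705601080661986842485921500310809109346802054128203048564146909956632359832387551431826057791558398207390587122523430657899547535535764014558828577826094602190559530220422580426957514146384281367954224746314987572428896408851017117042811657242384475041785401276544707418442583503691221860473507511744506763724458113471487185141343464982193906125818078865993791661243342901536358526315950374267747950338768259276158368478660198855940187407882172372768347835744841510089110018364858306592847]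

theorem threeSquareThree_refuted : refutes threeSquareThree threeSquareThree_cert = true := by
  decide +kernel

/-- A triangle `x y t` and a 4-cycle `y t p a`, where `x` and `p` have degree three. -/
def triangleSquareThree : Config :=
  ⟨[65543, 131121, 262146, 524316, 1048648, 2097248],
  [(0, 1), (0, 2), (0, 3), (3, 4), (1, 3), (1, 5), (5, 4)], [3, 0, 0, 0, 3, 0], []⟩

def triangleSquareThree_cert : List ℕ :=
  [109053528816777651760923743233885535322060582741824092851859465066983243336610915149552332688357281458300700834322541748132672035061463700983392887153381542067249546548217272384877927262816911058044047124549060205169801818001788912756586090061373724733406419348366877811740068159152156276468403176416596919547840681970384236354910411048643440893696371191145981694301168987269231350974993130286894510013810188869901942863]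

theorem triangleSquareThree_refuted : refutes triangleSquareThree triangleSquareThree_cert = true := by
  decide +kernel

/-- A triangle `x y t` and 4-cycles `y t p a` and `y t p b`, where `x` has degree three and `p` has
degree at most four. -/
def triangleSquaresFour : Config :=
  ⟨[65543, 131249, 262146, 524316, 1048904, 2097248, 4194688],
  [(0, 1), (0, 2), (0, 3), (3, 4), (1, 3), (1, 5), (5, 4), (1, 6), (6, 4)], [3, 0, 0, 0, 2, 0, 0],
  []⟩

def triangleSquaresFour_cert : List ℕ :=
  [109053528816777651760923743233885535322060582741824092851859465066983243336610915149552332688357281457528643541108715561005473799687762928042728456524083739731559320489295986672054116836247547731770983387435553589989843081547256243439913467421443265703121143350584090965988397064998483658398504789023051325116464989459821851175132592927488226707618219073452728215452231675055578117284954524676588240847861562768941318223]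

theorem triangleSquaresFour_refuted : refutes triangleSquaresFour triangleSquaresFour_cert = true := by
  decide +kernel

/-- A vertex `x` of degree four with two neighbors of degree five and a path `x t w u` to a vertex
of degree at most four. -/
def fourFiveFiveFarFour : Config :=
  ⟨[65551, 131073, 262146, 524308, 1048584, 2097200, 4194336],
  [(0, 1), (0, 2), (0, 3), (0, 4), (3, 5), (5, 6)], [2, 1, 1, 0, 0, 0, 2], []⟩

def fourFiveFiveFarFour_cert : List ℕ :=
  [926300370125206091536395923143159573609105670980147349089942204262755999337191285472252601384979253419922643068659881034167939159102619170988625875307931943504277355985751296719030999464460359811362374831056829818897878194894029973584036822762778755520626878929073837809466005538535701404052646370416847656479896984557309801328832943457778552918200057097586505563819863063242250289217497639753470398189141927275763055966952995956316158650597405856658779096416793438876420925948214101290026821311590033467136798799039738786381659986602792043463633720957120379510021407612356614758329605513007024295426116196371366827941366323406066432655880421490456453236583437161660641241682207555926652166165688095446709826990889831761649840484994048021313439491672398002404572277302344032339025149357991925651600229930878161778202461568218877041683860821979517227237848173140443215,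
   926088539105912005203970085960207811796237480683373444829106730689643067565705698030499647331874795509322268555628190457779663679900749026192286189740444741608009563561310868967418489328162705258419825110571575110303631399486593051022468837551124801914784136766634002294143845081575144272781311239719608691117453363436112449785084113283579949791205937953437860448544060612575625642693643752676558240813248826541627519646363723995621870977637229810016043815772124916958700434297825142395535928103241489204455630965158928635451835102996657200416472139707921304406145774883852518229681080171781641164525530745555418155001936120837292214195910512954820110196643690910294507868641332134566972105056214594634071061418497357720230568013802638790884809859202196126823707446583742970509440468689236417590363114300444481393560232012854155888141119806047880599299449459139739715,
   926201517199426611687634203789365409585326652290178381104951025971810493899600456243411123685070632251379362001432113819330547309907955987228286274623223634223385065154140004991493090721179899674571022504801618071790877736536032710174643810374284057166055253019594631568510311022079529808144390386180099003639643876852550891499068646719279231479536900129603470991198475038452456146783028664657224243431431390279485389214296690224682961843779551910195263545221751459848804770662393627716379094478294515948882678268600588775909135089297736143612945807943857019427651510870304391431097233613403812766428489557900293067355226792635947023978772595402013630119422054817892990474245842791920946844076959226421883173307135476579010847729134634178589410099589766092916940733250145005622475877244430924052477359110425136726276440045607032651760529172877432335976025226132521012,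
   944066314443846558826190880528234958506836000230648907833291075385134143508342170438312423961822696273302841067410729341351454357385739132500498670738333777718882432333184043106562162876420971594190975791517530531195435696272543007696218569229193130527979454049606351348476504811314605813400709637551129427492213474568483031946042548667917187771322885820233643201572508337412515404403936137210815481144220722310626514681352173251564683773594486491955268381297035266385055871700017222340139705589609172856305354483962382358201460465567805730056876628578807716942432224850820300727408514429403417688859754074294149481664522252276065436322482764128158670546390583900958697451960140538337696082574138807806448155296732135517097072444779732702550290153011942683425801418982593351158498402675852298385190862293627447376373012942774630274383978508466956750571106703226306602,
   941086776041941883610670692080314294767768973477541169143259481916461867603531122466544994409018756051740301371540530617770932312987129432682165595645076195677071134060575068600004443445426185829531331230070607225206308172676422461640783139454558498315960730748940544396266626148142964090297724649488124301645488309273758885192537754241777507524375747874604299469918780850125117598481470815728572137173683134018919122747006758585325971509790403478701710062988283457886624048514939120518127625755467085357277313783388014533861865441296709636596988841254286088005573357881809916456213391187357448287405897490585349526311930022555847209642672813583788244039317364053192828410802247563523127903156864989860369992767660942701325301170012070610470095392570967173095815297835085155973732110474438533239581751258555529055663543714922147905989022398583536254757810922944921666,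
   926074413931179821736827544581890137949774323844161430948197592446545319557013587372358240588134342734467827572964743798851930318503432894186746171805845843620093990608388378862146706433353361280181802755567408937532098038096194922854179655958634385851947025255635288239725503341140456466502073869880698883622406326161345199866280708536517814906388539272294014854586624433785139406313701388433041251061774145939991418950524190192632657854583200515646663268948801155894739893796446988608819225828863743388572458932154401675424755523401370378424793816735788235521935075172496786470721963543764651579769692477344538070461696049298391046473056546235898178135827281357286150338373021451827435513699798612429727872263005423424890287713195991561867501898867853240690224732376049275548318882519224698783263208648307050631525999070636512374405704664596130100092270942719967284,
   926116781687366166589255976833448309403182217836417048815741403208006353016104683752597813389095188688464013623886685373180562603668501101211011509057374081853710557129892934363845749507153876356419317989512931300941492226343934487937461700506385651848063382186091929462646655162630416341688118371884686433066423196251068520973862390323168970117788061381438353276935804032506968501436636192435478449756270005267465062496740587213565097320064267304525330401967835210819949347251320580775025320219094553332255062108743363250634993812662784684050130845716870263249192210403938618958143586295856222208208389332560927785052625397556067504891981967790527129685039177813297150923977467038655406269250497148199119057345672368866595150316340545454313627542007700357325985917550577031367583430243259143518534171849160493778659022762214093262763033983555457530276909876985528371,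
   930240511751732646342072616982576394445789580397697838131479747395199626923419093278970486555177141540935334986141279166590058256477169163052745412488953761084005817667438311366174822449754302245559913651654009764690520460468336875363211280197927537720962489701741506213626647209665975846813091437143240204202932117627754111874406325773181084739009562336794163582553937223111513861186142926246132128295858206431731037509002380703607317369050255120829773318801593691738923220739699567971782799301747844760181357570831850757467550743285722195851928067070875334377305795757112692940375161444824244962014212548842372385583154104510128279497730168480369073876224220788431390792006639868414179652950318793443127489657694790061509537850591845999928620026085586663485824276842691358436114933871045894949932022539663874033845414419164562900400619142044450451936118649362513974,
   943642912058947875975857009041551295775226091030790568480619033483515809311023885625483295784258937284516945552720934990559830222694783461635549794141757947000994741628310840909672942103484089747322198903529859316028713595378302317230441986987975194542231518626756672623232234773463031425465303546125988477958282756334250607665130548832720720931741361468136255296229522792178204374289478233993858361758881706620225307415940404118795743754694336542988017122199310135843106184384233259204853920053347297929719531168524799581183615892169749899567341773112855388347241282614411049577083750530934192219218741070361043536821110187200211888335008912971257886372519004581197072054613400898460128209901953467012992309831190970892486483603398466421724151287791748626803829560143569046402404837597513155852531892653356051931821733299271907300667918489291927116368061055095472460,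
   926074531373412502341825164509403044796592913034525338909248936606437519289670824424403459626012257045288769424650948850982348647896622523640553901457537433356090266570795972334315194009447613326208920661364926888150707156267824150717454274581412482680688658632488893737589525960340117154545762133466925569922202980199645679583170366272403456961878582663490568706366069411493235014406090420903206805699890604162025411269204925385753559976558400380509863368728921838894053379304047407895052763336570420641041700544986798383128940431525513078442501676670669557254568090947010648185307218798624021703748934743163146137276727346797799184543396366113153282344306571769182844878446260133688203988799243872688999633172762259823079841302169202617044031446789789028577764999482642781585332731543044468030646977324161888324779165767803509670482323803842188170196292801615888444,
   50636852713143744421276681113401584209410277507277251636892166549796809971391099840797439891220905726932196319931696984014640745184534970896346296360840178318990144723909665283174124679452085220680969424840159654155709300956079116812756866617610402903288317857009589695826304843624263891153900184787209034324476753283711017]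

theorem fourFiveFiveFarFour_refuted : refutes fourFiveFiveFarFour fourFiveFiveFarFour_cert = true := by
  decide +kernel

/-- A vertex `x` of degree four, a neighbor `y` with neighbors `u`, `v` of degrees four and five,
  and a
neighbor `z` with a neighbor `w` of degree five. -/
def fourFourFiveFive : Config :=
  ⟨[65551, 131121, 262210, 524292, 1048584, 2097168, 4194336, 8388672],
  [(0, 1), (0, 2), (0, 3), (0, 4), (1, 5), (1, 6), (2, 7)], [2, 0, 0, 0, 0, 2, 1, 1], []⟩

def fourFourFiveFive_cert : List ℕ :=
  [926217504853092264107437533567926621728770053040061856721828446241120529462315809052112429803051261462626383841861554117035679931987106474840576668325932333629269038041060640534993504662564837373179056201985680563953365490987705487152077081876150726433112463383077631524244414654213950787957860619632559694568350762579338931678290961162419144586120509404361568537183306731491827061278709738657452095421088390316680680427093018248072991659667189179050371766052293880599815180595530777285278039140996260853767348537371868217038515050416914546849195356740781801074187932416647758752522088841561696450294529508526804322236681753563822700913752134608299718107058029196598727547803180698493587400643525604968234910286135531500723729197088182740913584828631952390123575836500085091606839451357720655322839811415078147069369584400772142483204467468634424632130319329772109903,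
   930071045251822634076785682104375351406124507772112461740980175492619299223220320129614848081457205310085910840667706484016319859239367280651202787373398543867171172532062086673131801660663627848923303724873633826309611389202156328053444512014124759351050881924896153556420560872110787479494109419452296039110400642041138333103695421647862660811369312001402528088748966683666113871473423982164819587784913871084330220369410074175946893670434509801680230460250669257812626995646117669613793914550313484425344022868224704780639363396800194594048924961889904453147321519518222011058776025473131650707950241701853552766508278162958552915743669181107539348300393355399883384614792230295683554922662675306618509382018338686168835166205350704858431647668819757364845032789366967848479705457048314320790469239328072686300325168883326774763494780624161418693073978663622213685,
   929732335098290338378688617908317724257152027649189661192389871785642856498917972793976623998132309426352699665561469551385772925890931751989920501419410251205350800079161202670900505145586211650997253972015834602979875417230627654230647527370071359086214488414875403201991320242171102549595071978163200587943212805516380889593951081871134753404215093365303114144439837263335249682983334538748193044342083928346999378390805506678194730722735301708841023010536534203323523952711726141261225158168596531894470159299035580146218760235796214277054922265668798586722639366822696111665727286160748310190449485991465383245801775524907171886965069345396436988816916519534104622954258900322856695850747089430932076164488962285193018076057110146461063053242140716827910629411373891807132077360202114819875469816411396261556175838937655593841289587374959807414322151773163814985,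
   926314549169038452366369626687481637316514785567864177195174649000422510370865355324634686403568936875193562913665600236240650835674955840204461933651585456041781842759839407115438092516493658986078330509730560460504163447333750725717286693395999754977805878988273907768645281686972392770954001252527867933605744590429917339483184651575808645560006298898859857142314420153844713365941358347526623455538265572747544936551500397193099436773259750888580159050601788714096919268150603632578490723930501827584041930608351404184143965587334957690704645327897372465363186435230679280893864503800698362638572736244428896422101461713172402805586673994659607091697649725147463985152706249713502767655331792748989331901754054299192042683490937555883829307452087706543997184973789395189398971071950748032800887670841600927006489670924743887756077018789414041697371352487575028034,
   929719856459663143870907566745043009476700855605346197596304537267695736907154111883653865679991865586666856403229554212787864323107940688179182645544345501084110713858010433943508109129823627619595953649352296196408127220197242054868193965677908354677868296832907901140860011656875837076065574618456025464370754113733978924673126672699810396693024048137542449165760989638324507490224655997955153394409740356996277331487776924567333839879669373437525935797071875019471338834406333454754444976733208691681992290238537982982929553914840937466525343642401235120824449043361029839007348779820646843177264378039573461908130570237564345273342517525117877515848601716973088395884243940316479688193695449917311004409514956826774505530208132016701297816105789856801622536179522813952970974336996714312427742547039913390792037978557099408241751365390335993923532977122852143148,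
   926217505714993283175476249533683560189891400458067033513022468047210440039779392095843967510471846855943532670558773135930050734329344074635729862605709384655556929284936976879606840541796704517380712922303934254258977318110518681340114995647638386940601328077041899939141536995506083372014457489394263730929617998527637493590040342460129723868557467712310879483343281738196429198693423380107847639798008858338106461121526411092899791221850795762779596566539124905445547226938987940020625600777358115545473958116460493245336207777612513935316299300980562389844848626973288505354314486303395273609459769943849507587368715219364993473591953415045167242219754494834474827465602244178239766533314696966925821609381355985965608267254797611522238464872178749369244562608191019704082276373348463918790631017543459917479184279477387514857667202788726994412381807612270280751,
   926370984344959949104427877343420265689466260541101986865254876098587546865648318332798472099351166076700092003075222555467436433208309358582878815176799731604726765800073778533019236367858961866325005233964641410034601568043891887787252639982539187131278348218251217477080819836267042142419265201316554356490916768859617559458867229438505225466529697157609333604840838170288424168412289250368853309493047961066963220195408028554562603574065713784664956614379967830071709935132555959610173776071122807697475144011337809663107009528812796027892500877810139755173623240221683450962491660091906291026702283877158316344882991829865949274349540133003082416711729585375189711465288674017817218640821156688128404670239585983312033698627624979859580343411723131144861450748506704840637835153087755602858662969573289900799707346768116195064286232946383193114667661257977298997,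
   1164375287673607232763538064913757774234993503901808096741033357562979298942935111165822364761408104497437082826686860675976565537177178261010008787255489287045232124964346966164332283023312405473697878397338477685627540182244565918416048358961155882491435943336881645488872433657253952417739810596573171421430877698434883929542544797499995045816536061337269997757052566280519369024430206194505925639996047747912295172716836303340210196362958599234210999486853621130878571348058449674681376978703032324956723640381281450635532956388617181817155808463933590246326276330434873084871409079259200298574279231987865086388104559529837141051378849157001360617112784471232882344628244413923100510537671045947967168574943115446550517844759497105462202032880351154923286436064786069325656379766010383314801274121472106459384577614616804884302136302127600665220856877049247834634,
   1048585979019302826345599247707973090198070398662729535764471151321420994914197927497311435944198607847306830768290064055009854942399815420581552683397960624153365004886841059158235917161575333065401973078688409778890919168499710292336651052664917287127394199649564046873731871298347585191495383787949356792396744987692221484678375451252394335392319533171309971916617530493369349977498668896899165348383123425793246710036373596398400146316028302370069516337967895925635414332470265554388241209286573476391249254651910240318578977834682852638236347684349258470721738253328124890951884962740826935284124634527978211365439215779078199314178443366645350231735108183623643109017794788343224309838225972088337690858078404747521223486644734961919792625538258617137514617887087028331312524315020956738976029292179812243278356154292501674102996812224873108868163438540089983024,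
   948317151001958051856970991759221712592827983859734171191383895666145882683289000435666064272875163112793355867173897451858122953536499361171317577266523965854767187751749173242149051274511493455617010393902419778971828821241361565594766085886510670157871914672920221054458207764443191401538331184594200339235567631450184795006861301837918872577951864943259504499848966686840447845541436281076089494718905743414385114500255335517420892186879983865850366131213214560283112512302542138400674940394985900268746109187174383658746161861479686979978712176956907078845378825994235691339437916225358033274359602257556415988181682228441922465608947463257179951645401055107418311991382444280436759422770557999534715740953773444774032978504917727500137917523855210408877418518601020434939957404809027145906637947201774859253658157497867951516771638760929448159000618616774131778,
   926455718564186889763972468376557843978698443729570159771244138747378482731668812152143832242777264705451119503988576225395153478604697267479361334888642988555163977173866340115480236577713514278811596133862881170803368600728616080434275475748942871346477351608879816895160494140204131981055539232278206876032188956894973815053664387435398709065372638536684686422266556838490395924661475543047045729765997231323922946827530262607923055025084961476215672545084423784831308900429716930974586472304918746215711095217889376713025840014447172314681512282950186099573409849231750515092557712841246499245437248976732853297930660473870561501051846972525185576779363742798209577025179874040730067897220986149721578847589731591133833627953252564787837666197843020535214402535122859598016029479487506619060348154545285843540030111677750212215554413052148605121487598177176059946,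
   926173331101535997200299738623704051503608289659637078468338190439809501659684505278117172361048148658791527506933413853405988813492282042435812151135770053353074095424162827902494488247807296038030054833915303225140519377541200478967761174378419921382939916127791055461882622548964459909091554387609141566042290423662678732731215656055058106774983031628972013538454111988841941574526179708722309723324437671324522259085599638445643584968948659878180411734220060123855826325274407426876128523474033020972926921335029353194925479900189710679987241333289422664446412372260787099155372211374537107641831553728543167591778941279386571490963742445436047377718335403891111899970482389488384529640287662674111818232348666966597017070214716181040775459924366080387817815022279358875310015893246593036848631193590505366372830428221581836020171575719119943336775749455596617782,
   926371043444778584087155860340620729511693263481625783872511668727162110529041263868640199454580253845597674333356245294494004763546334773514786268438461454965841213847899796614916393226995566042982375094175259474673522057877629568602198165669492704508941223555461723912146064698427742679481187305798712865900541563746982817839847810898801479048326259403688099243965451394129805380023180504400916569996970157583818332830308588531413813314672740498161234295772640055303031044047288018628736343433236871011698143468499007807951949241530206567148784827500668942146552522590851637658031398404345584483267925527416886489326535122153214101404984621338461935552404950329801736821294321271246947220187928579596078024369740215935811738545687746571992346643580312416268159736640520125021296220052374557649604381427290284148807874019831953485125963799793081166678282166700876289,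
   1048797807456189298778287872817143336786491491386766817972827718466105081451626826568235968730407636385187452107004342798397892197483391718888445141828138859374848163794693803341664430314081494536043703775364760906206941046248434116569365556685666153176626706381586610564590844856212652662224133731333129094705243342779108853583597600925956532326000155520084500132236390535835278518337839187364240229014775501513649994682689739554468734861260928280541906745388243106758090289534590248990037404786255443540299641667092575008769458350311476665583127815004672277803394844022039314148856846134128765755150354638185879465897614126640122410745267059130264391472333793873417378671753530908694224325684522399086256596331436862020745940538297599528606777359165993366294087304566650075161870561913846728524064421241681739841640005374008895052537690790481693503750416680662794561,
   926146893866540363727262896128295984348847013709888784251351909532561000506767931453305626785373167778078553516007108004178543919520213167320745015844281585218306673817202706150712717452190893044175911936896309984899866641540820907475473111521848349033570469618818046614874106566980832748099074607606063330925694507349111814994512143917623748015529814677834055903654453676636645970496863371562887662369304647644995189875978057069312632694973516639067747776783923441382417788193699288544467148664980327819444216770698748427460459528078410346542012281395920869294582393450134161758038737731299056588941316631462432801483016440093352147173653161262345761663517118748718426515104214590608013059916662333573334830230958993604173922627898372627557577245113886229953523989718770930401054737719105653671963654737299327564933228410977347484336398416783493333925427733556232252,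
   926243882800641417784416769014386854401648877100352786785406627565065192485196574276548941276559538149229396288813106712553413961118570059151135352644369209767354842965351601531068339139376364080426862510387704940863211859948682023405747021661713363320911748490967010057206904907432930072881342818461817990696710372043653479668717776456537930837901834909564697498095698749310020007251770418482691624913170711799119716217158375843737375371081413575496486373471021379815739791651226404184663989572792460689954058221596047566448656668766518536374704653010968456886021627002975045946765175426723226758809488366773769719574626904294318032497742156781633058958851072418983335723343263806658876681440429906635252150415141855826882127614693980761660143424920128025561104124658641887575251178137352637366747542816955832497347952762619543113832530682172735921511382626182299686,
   1164544751990134198950575072505093504766900589652934639629708731404770362031941794467863973419004195432104738652205559615099210403075549241016333208198393210827754098405067253290733055755144671629495692606565008230014958321774635691127369785455234224614097148119982670091832591607050368051915689103448469715300227837288414307932041484870615258696646068469891977411323977153624140822236225671143728087418188495071224797197220777353232177254388215608271056502535907685650447770436412597036244445101123496869143059562779707124034557966633768973877908519756356127752628715747795427845493093676324765719171033970224930827879558484244132143960255229256733584842619009080477851836253607961831382545976065869710045705353401419403673762770624915034930004557887223514990281648872921634336726370971848409325781166330229568614034524537849324601245484952081747910332467567242970440,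
   1048797807461338509170156924955673155660398241001933254035114460378749178283983772093953543494123513742317395628180503826328062755841811785247904731760302074808998093929770900890014846298601181631884090773776600594298005787155860774782119537957732707196438423998311763618188340368358792161203224627757132174983353254774803332616577920019656271828010052183713797379936612828767817362856573515491049887480695834140363777782086914848864137722764092656337632357139103099802728823315854390313719107054683295554069714213931639131270535762304810686104922739600241946484213918070335109771783817035256080621489438566326568745219592095113054055247587907681292775476727163890865697457854661172326607613145719727677821157734109310903381450168511095188593053476225298804842314301029182537217659951564217121752986848970100101421457792968794161970694558997330242314782053387920482826,
   926314549169038452366369626687481636631107588106676255845300465732844452433969117552192744226185739623582110366205209708357649877875388079951939961531097395390424931690555881133179222832224006824700971843357346342792746733149724897757509370446857695351897705712152086217168344025144392361432950943265073537604836548504650081667484734372078437088323809867129386502619111974103247825684939495545135932214425570567473856276819560993986360659931158173072418997331774884890694073721061193319774026985386326415267400397663186657498406732047651739235426985393030455499033093845876173782195122250207239354672776348742907586520376229356516057192669007752741969298689154840597136150973530607700183821297887164647944795508126278216436758626617560514110805250762172542122383141115684641711291814754730757735223759256597702886183610315688972562363365655740056901642589341259661372,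
   1164615367932898503420741293733446365433182122879120229982002546452474938102492989624938676524997015988130873286045827673682542385214699888303599789384274348361471243685303089515421058760273094148994833114709017519829551584912324647894680860508674265791996454452867531038482497158224242577125704341620915551877266719398892018655270032525182447199323388804334953495289176626619393902664331833462548029821034461664850848559006526892752583611047996288084848647061533544428576299587351189320779859553951823721921339799943894440668931183743197722535960085240943205715100059341439642937406993808905228529092493125052695204598602484207231141499939628597727571786166218405334061798977053142331711287372558147873692094810924967640298629011981524926276650238933055873683211639441974289337909614068799067704949343467158963279350646690502294764110041545357344938732623662271824172,
   926401100617587128686619824705230862543586289140132793123524274470468509364049595080946105543820612239260512730740979686611219834313726569212655428049136661602075629834995371500221908471452598402953803458224506804594048701380070482680036289831370666210815996718348295803397172739361831284569907505269501318532027167673463972067246677019430292959460422338648518324171096704851546864124488421315200796398592362288235633721184355388659281288962765553205727318755252600776742689919300255066011745230777191453206527776290216879544217913215915556171801552313677860942599181223426923306524306579863623633553865926447787808979796688383330438965666309335592613897434604338596925419231042474311130119424423790512088053973415851585942228043781763280761757040958755468233289021820572021053838373499847184921695516361625278046916465869091716577071195323810860545550316418283668034,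
   926286248832783984248025996325711372337680655551042653644797982613477564115189163735753464147644100265862868071477305322832769015811992542556459666712205546473288129772208124127368340217684413587503450137975613048980311011558336813929973444274986158578351541374017616545556967779158185885081735865004733600126710844321332540626765516739320772231105058744578905431619031350404864576246177625706805095137113310566472103226230154948192272060073413749905757829071737801578814377792382092972044543091490980409933318518408057761143360122056463953035953759297687893682082235584393977911992478471570926388588449606528195649892290288652585763287901231278008320015998147864399400648100247774403968616584126024615139600866975154302223325663759412573568387932915806156973136102712143724347662000509686744994694061439547442667522861696159185478560067721203937414401820736153976870,
   926415222125519227420965576877843371135467735049808860386984136079584819590652302791615760074385678558953253362519649038360983580331991005930208465186064846099563940639573014298006230847061877798430849077352484062870829908837840283389419037714795033641846453598016100563443054610370095869081958443141134958498557329530864659691569337855074103453584158234157238729204140986216516651068888739815543475296579471055837831483379974506240807615548248017259081560094822486222003781284357461639946132526600032414139135428686166734489516198750370581736334002701276051927238184504294028269420902804361503377963343093426170313722282810770969277282875850103775485433922021247814719780619295792195435622297469972309520831809940220520224478948741603789185430344353715259835313018537984473501194262440597568827736581678783179964696460590595150274144880939823628360929137786707780121,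
   1164587175127139835895987154033665280404709588703289096895034033671862352046545192988405279564801050363065507952574387448098043221261966917364967307778538753466685079351762084646095103497481100398713746418901481306971505876268071208408700763255873500819332907280466551157478461547814047849461012480655796509553948471269470426463773091216737646948145733109606339895950988311917965799460736916191905488221527502575266606018641845658204972434399214578911902151252862958388330082849927925234645141795113595819819222992892456600383704531402308621444581843930138372923548374737836960210448714883058263373039893766405694077186690168911187148960584364248708255089872722174742209685963961398613800613580337676753164371942907964942258119153563624500825260919040847814876602246722096906492555389279029520723923048444450890584710057888476849492907140495032801225869467289234243653,
   926074476207905197435337682685062653951102838203079487075635294792094589385614198112634275501391886396756855084352950555086945209758330222240696574574196817722412023747242644692945721335595563120393289525552312455970483001310974623282278620538123127761365950761325255577962991315194551218572604168548705772382613171144400862931405093870924671519515730574497789944921322181006934585343513377474310376880391046965791522252664709879289366021563832627736678245326684459451787172243773538570350949453194476018490174850149355997216176638333548225759340307309996308397488879418002766968473191181614861245552264766592823387345086158767206128014065977527531145714464534154387883243770823847830252280920775777478133805961006801031182383934681018006625356656026830099617244823088928443100583215207238200725129189893120818525022831210561150620283465086187918013997608059125891113,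
   926554634844143122984361464519781274398721075429032854486529570043208458489123215910575614884705879324738457832302487157744667619848237936739960070215511728565934901446538157814441490918943320091781542393715142608090808633201805441120737649507335920522680965181790816893612661062724974144676369450512064620482401945749014112444962626763805453486037876453482065442444087376418893129592152204618193088267858805969501692040846081699593032119064000441026040356301671894562048674164295097120878071172977443369343365332632304007439429698945258817282728401879205516629983037397218470218281447876162267432359158107288894359136850778800596770499569627295638357397719870951305916677056172615754586101422069761265379200161628827298699724627948653913525002675621204136533307850371352829119171781370855803982891206687748101583755650681894515732429392993683834978724289299509347918,
   926173329564622457591325973292405760326168442664919959889308115740775452155967369053159394963160988008789008083725200307694038158176193256843854045161870214859338246132576402965829205097051044597038678134273314941081631747789012235051902114478212124220790181584156048702385441441100704006292308329024419637569160442999784776903610978390018039405700315759957339132176858417888972211287113417468215445755555577197875101669874167507738915129403202637382977304183803204460902593784598515437882813080170991233036059169297653281146857328711203157477419443545983669626350130890521612236808152712385468342123082854012936537708604432828791470203197371060059136456444174279577879989091448091990635187339388170605327388656058403459549826522510664421620062349714797826919922329554345896563146080835775890874443702448241259998965231013936167418048481475315465948492007689077327439,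
   929661496744465375815276700216013599307779569935149459883660732936562374011250301245832620152360438226225852259168063756199440856446439122733774699275911660550588065053725085375072843913891611602036778864858690186919009339222141586429982616643829413241410758319537550851437888814541541479059942378245529123801569450304661163663841322846844096586935751216436303874928897930920390596488039020203959717944286263956595792510614729285095073182992777896262870867788534646377892050464446125085790447348531421711418198384150665649439803051356586284829662386313447523100653474692224455815001807060917390795991177522911378747699040991821673905793823905332919186391711060363542003799089804513435675278425766738618624346889092309240722348804129743234909346062986499677595517897315765386409655009915327336482975214177379160656957043078308583387176993877019974409489974020509664847,
   930113415592856438228513521827039029358667484220092376863859504477541016033049268086750879455061832209007697014759626224887611837476989881191536931691020079687545789598736198188113538788237746965767461382960831596516760170913202687215038049373519276219737504986420410986032851906671928414671568261158046658409325712927079277654758382823389100390028125253564891038237450138507731149175560384191193596692824498700492223029414704792780160461241467682616567083023909655335950102519680093171547354625580626179807820924707040933707670732162980654333091594073129355921707520165756758326104974038556421825406241191272332776907811243594923735596164905802340970243156918076227422811779970300891238357998311830045308096611638048790686973509840256518419499637946642638195075731006877312208448670252713068559033430257484508408214007494572765731045346033159649635647401242552238129,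
   1048826051118521432088718138422269509421915717178657858646641315545146254149772945444645752064337640907595893933416335490711144503656944131185281390618309463530946272554624806337088890904723443624508413702478485678879311910730627891228999333137951700670677010109592466216635804084733787823917101905128097806822274838193072345553167879090749656274107761386931183444659041943400115834768791545300915113076891306830928308647476111353677243675500779568366826374949654427116912663387266468278528548414082632961560666925253563852306026257709319004158146158328499569334246191855503970262290928215160762598161062322061120599136817077842095977798659713267579715141796567663317539322904512892159433446018172653143740489597707292665414275177645603366787984093945996502570436695787315084341988212848481609361585722222676071639881454148998501326798241507323026068704910481266713093,
   926175142755194775130717689528895528866915683816963047327104818911283419865857435967882477130753181155038910298548476462535745378749341020383429562734452954194411553913167183587404897079589286081537615250585822324470015485023961308582681358271722176310883051017266889391300923223733604754642539403298699092357076913502044555623186677661039214727997257557316242903952166624840080235299753281865777107527546059887459641979176878634742841888446289138566461003314376949597803583443977095707389412664279007307871834783787696804699735838386716925433306702765071301809634232987412860706460465378974094639492149752144266349712918384583448931277986909942557700934656899878181511562737642481190829267536898143833366739439750735890998724451451036041239084813353482473183414103373258316812365601841671501261614637190369128959852877357573757066972058524581653511846338231701667901,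
   930058792905542797113713232497487337555690380776299465010969601167291002785574396172107460321779865123190466015202345261941144531767861121952025705597600443347976427955060753035624369296249360720143944415389894586688698019031197188641534389314213264900064187709192793247349783844737986351870567762883160023554327344080471512685409651563208037796439660616268406589346522388663834060283365917889405640676569807439646905022715777824376697366950995813684006633034771170620757206076299394649951926647534828464803475930321250120576270829964309913255486908507572485406484935716062556624122423195816985635395558982183265292757290636278134441808810239288181345469887425985656327233203271742552235807471094403913805160555443518262918373504948495869840181134399707737493338063125358486257822728513462870537106483640608605565172210328391920751592785303330130932420212449805795393,
   930032314970474714023668245016083357619075869161726154705913391023363608790684621643667049757800096843689509029417752431847521027647508247356008797626286443800878458033894088222680435517866736364028491277828355443414283019595292589755572657740231686477194558088769539656493545705934306937767205812049406131617391586134162631841236972115170756973073273874146808899172735518575886920802676433460479000611969395480651437032093286794796108098502711348289001631502222055350720172634819519770931599680892032421826406257699384035716895468641177969917355240794109842630491151597576634650039276863455032149145698633947612689977091233022036417710894713641679049206240462727754865599848330381007848842454791018911269076995754039425234631108525876918026630613211503416727256783846658158373932388130960039491230423202950819201293197992656033056463454504793124702735996841398239273,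
   926498090845622798322518629842856035639252808330343141696638658084256784305678873321821270364550654801374063074888057092293154938561130997196837640108800866458188703436190145782064713876725400463418888436917168191717910329852224750100819862847462052238206079865916050779337628460666114041174019358371997180395453202000095260128542303373856110110161500718549446290760908515840140271026925340480244414485146887707103471962643252082755546527932908448574071415633133189876582570300759406671820725633005929427782846160054974003747581523387375145924150183442245491630046621545218471242432865054222773484264859309578865007593300700852197002607468429077262303669305746794584401931338421403566156081261790666212646634032441147552493969346167049491652763297354958319364832250126499758538537576730463426908668051187894076367316616230464418476746710484846061663450044073312256039,
   926088596639257345624504901254990548039153879078245301450921902916384883483052143199619951742690008204900188214423587925459909496740160698499494281989955879615558064176147426244716710608265659851350621135656029369344438151219106449723266977235800131844699104916018684968286427161755643999198653112084522764696001797961337952138216406795319727619007115832841116045058564696891514405998992576026480529661195128313070162796311493427619613027135593624367730689456873478922520036244188377030645832127173315602799956168758195588679765400618488407017564281015927719215719147385984036219512372023086608733208963902067652132112622330582142940920230657935896104667008990945547237416459011299041361578915659419064021687438892438292669038537615375729818056763055714642500050940260358275734208895548512504797203905121527914947658203837195783565471855119847216516871719251820683803,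
   930113410852063643450369086354416698945114222850196147706440133153096598865746841835558333078978125742516248498613001254744281817384670487488932799053146580176728088002912163859527592984808662899357422323293650739330345147722372881015868514523488504224482475375370449055335076232747739638458765882476241241029773507005439199697726263986384766058979377256542930018868734318237744718124756784359248129038462972823621924910181982564721150608067118116487770620054270948923908643548962698507332343364410681316800284645999772058638362844627069850597842570805818217941644363829863946193615367829964854451821880520026538423343436976924619198124321283700483290262122596847094433453668822323324926373991587834091417801774953983369277362916640831029754345200682548099405723859575363360866636416822184410793247344477222110376134607848578440220862326834122399971238994186208608582,
   926372855447796926674495596506138024847254845333514751973187242035109285259586545442982653203471082043446865278799234189365718816816206524480482433742441179788149614361631354951557461124531365340618322274207456330917202791187889428269030572322610624273932780127447975680854581242345098223806540524175936731661036079711431482943680314121548053842676313577109958976428288153687092960030467395144521357391769535726234175721445870512199179800156171964673083152526792962958903865445879811691872102447917730728651603947878350661757943516395432037415911070223631845850776054762647628341687383399342984896023761592914953758577092980383521824293183880585885739309530700972102598665980738513597266831685267757458866186795465930663641473744645370325155278796070604489345949148705348916272269198245732727798524768773882536769141044157387146448832946896836256714673590442417652031,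
   926243887541400819395489557832171667145387005599320319348084155866892169339043789966285756678561814436287655777017462342169055335105184293914556396591923390508904187324317724339608088419344228096811597072007836304980739528461244859944444903523555524204577825879837685206162503173926971603855590477674367495014890227307098324786659645855105153518484672138874766707498470460272497082702084060718542456246287655243688512538809571249581757136284989434156226507419139741587516631958433925292260873866034666636587833459539533264814254308359548969403118269185049440541270784771347755046821039908504063134134838196097119384819189115187111403572043598442650171602632454330883922998315017840439717772998234753501955038731134604478216465028504752106616041784362775402785925889614979787161247493631731762470446817017687026838059746805965818092068969766123544074416550288317956638,
   926088596882374384153373437820244254274460983330950913511863748910381178648591737274933948900162291383009331829719059195455189622087688459781982708155242833837685685078423740562444711715927794724254751865183674812416372149528410769157875112714721453702693383410379467797822810782166551300329965881939023167551985703221477826301171572260677083071654370955478206485751296705923147053887662526896305043707384078146931870858100600673016467363149632653161531615602402291219971368200421656213240979421888285883398330572718394053213754397371261273462622182118422464705974292621038808451969514467647289670355733993096561694721177937356555924944729895727341191050926599774102745745553525223656996349126280104944954501656606487339520037322947836855561157182958418526339704438282840558212071980351766156890405660226309020574804677541352494863590526234478836370928920972365398311,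
   930113410421169044460637777316325031245903469871812937619949714780284454454911085735591759018577286108271494644399470060525560204598921261733642323051651806610105967633587753699488927809050681054754205015871343566880724744156983852438880983099086306678282448179818613026905657066128016437580650731941196502042781805278474168032542480836422943043513800560968781729223544199301978560408608560592812704938395417016706396652652530506912288941467961257584386258572397349355443788944246782400982366794141677067274939730981934150211802292102993033560130123886848075645810312576982223539100904416100309511399306828263261973271889194683257646001794843963352324297962725372093661091522542226908981439323171345521565185492742028339536319963003483322952498194503704468132910705524110394566785927030046566613658184464253289446898335611469573373642280870233012620771402446752326162,
   926159148394454722939719870429186292969627330302311514651444405985114377943627832559046373062428529759164258698964523417211796819441903153159189809386238979550056564619388208192834125654167882742543231979967794407736599226921543914666648717297253704729645700871275657170010414053963125606836890892150416706000260242048354202240096493357813480903781946431356734661491524530605384801463352444116627544391045215819515347746902930788475319379769916125026368527095857450004779172632862045828602052378330484787540442465370641005944439697606330960913927544066147568387590456024931947807392529881637021516779150750997462802929507790587851559583366217618733528492684432118306043096853235780806984936413552371947707555411093091374539560738700442231484620102257491004194394758258522775344552117140333624830299424814196516882718581352563358269494800054105074272645663609668379165,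
   926048035984507853718143583223586662022422313827811671732023751041918180147417693570785343851942751351903673099487823577092391160898097132776741501691272077467047989638377636478806981661883359311496343493554554382738903902477524912827293296786503306088903018882413510678884957779593273912874497142620836574091778316438264473964325863230716238184872811534443148255614207365395733043812530360680122394935823956507807124361158816253889579630544983714568796231473424193694182873800188573270810234323189674781563826872761462405419409164929121526665532256684059354892635777956035882752266536347322149919598063296665422992547771494343014695042396761903407044600493202572685373093917215406237128056239371806464140457179965888013284219195458589109904181660346384700986242492498216186156055483106904186232994822132400448911116150733505332246912239161784363729569908027816034849,
   929972188015428583876732104936410055412625299159644927536248112860768789544702864414358152729005740573260687053039915059991425627091584867538264782104780120607413723201558201607895916041576825589344360706262275748993464244459621548920656011117708230999943855272634325982021777558991023143898952862092989614036957016498250188998872486851807413263399391396362640073087093406469757386352120746607626646339433627244052180075930943700103197373070267267426458245682919137745469825960950801631130835103052120356945065442280248037227843068493848297319828604877327312409011824826423452103579676318105347996955065270196446979392551683956574107361210495683315205590920841312906427936755479701860281051752599398343804438648353426754924592799689527249879833823380240022226854670473134524360450003703617119476280371085699054343811808188071701075786986207196529249977720068775411767,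
   1048504875811002224979572356607201257289317148311682033014550010865284608148610820464171998773536926508672887299772536270795089048525697686909317882777217310896828429386335151426928394857079722628182806846938316443574260957452615937208911449597427932477143831149635916720094658226506844806592053009324750407312862245451413115725400403274525550600397871618725728246608058913494747560771269675618697822925270425294587696238045438912768341270380537280146155236072574791361744655985661416830804091874875850169752000594226557950252143878751824807615957867337309623192396225840260804799507233366877759640136685898653182185537651798751839727944539182170460093933489095763834213470630170468116405120657942952120635573230773171414966989949384363192181365126492944560505548418946262521829439916504500641654309367731191626993976944801322322725893062741808114230717656223406556235,
   944631213763102320559145222827409919680407393290069107345890850617733431215171832032297876349926687636365928516429725801040137662169946858298362614497780407272027833321259471174170070527594268579392172143556123948995745106509169125121266652314691111531868133790976175243162180831531016541002529005431258985737030701297292678976298171402508071172899273001851810035955599117810208761786492411872044526756191114863269766570095764207330823644472225721269194820434392221941349860217454761968604478391067706565890998191017034006649229362262353997495727127198818630865928867628226055574155005303089000641348371907863905827181941121398614846386256401837458694088649813833315029278111705361805381295963621756458413592439309116550868323970153420179543270172973094328415687547794355714007733750420693409644781236561884143090594428185726525300163907363439946011634683128540759116,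
   926175137743395540374765632807738837624033145216873320924017959430666831750148605425594245703953810407208883685622424143514228495943198930612498993617397671620549755662488673790133468721317823593397128432125040990026749199358103893117381069477848174784322262008531102861485265224597511149679937381658806979731636711672836844255912231091465902706766369653322147805325584470118507081413094810545529402256709394890032332765083077214490952801287921648311463678466070574029606423600295093976032139348362901096968236695094648058000022827502554490588019405804769150998777604668069810187365852107217579802885777090805587190133945532527425320639390051873221792410024644463844411418885772879179011480835598890807665124636177607492848405424389697000127686901846582453063313459986500878950912428639908324573686191631080896631962434232790621031672811060837082411887933135392343631,
   930127539902247024981849096498726837657505179856035771083872188350287972562413179891810598758387727467364506448057078011753793441407938640763026645078293265340320463155202481065874403474277238186711687469298441661452418850792604224521040454664030836722482698472464421329328957323838153523185156263744662395209258309006934829154822502815961941209636591199964338263081920538375671852850385029206941501946189562444767306109739626238092272108936772628568477795923616308506163579000325947170892550710833465105148909060745265989983587556856914216327100799013390737474677642042728518794328076737544319383371602687831338886119096339229192203538736155240688502130610303122512633660284444260381402415730260658836809224031248247631792358867825552930837354786445056316231600535682713239331540556168865495498348362257206301604236539219929654142653201334683772298055377566472142900,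
   926243886679466150182838565815235114762965339512017934707409843984654901484408754720850850642417205606162407672055112667176505544514191789866989322750345738168285155771170135379526638844806279262705049715329891446480528376194686808302771429066075820788182038630179065570591906181752112078391366014853103398428749083950124543277197287913414264411470509991543088125778582397964881860866523318913512247532606912194747771188498109487127325938150295678555561996265073716289709264055336571115035797797081338771384208710215387907527623257823634727050020838435909112437396484395774209055727426104835994305049078427504517658432409395135478465356902146288958351111014957531540285532769008693925193728602391477064383813792159493333659376477402341475828238397762243287689624007150593293449497127321214819543647575759026240967057992950784637499321207326568793648262748302075363400,
   926258007540960699213630617134442789371473721821816354628512951390640462283002060098842236320803431745236621731577058099949564613794654718185600189330882654287828727120515910781883628342388866216501383109089050193756262624006206331887764443372224104026366054731975023071259573909165290502397248501562924924257139871252001391075974390494283806640634723968414471552595554886136717317599099751481670021684987299817898781373964938090264557413338168053078827826900938629692091484562284636047250913254747829371968667028466440573752932845699068147586838948389927460654622886593884813668358525265464692375139180751005236961933547096411770209903547538510062017938530992525980585291565366235286793837453506822793057784464079384921975197242146894175424150067141957148651315917347616888514034371767897896437870394165712535079847473986810127636916743774719825928567571069344613705,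
   926173272029545135789923450579904256587400953570463316368243924440877442970518471055664371811621789574015779460985826743371126009210261412853685236868893785467891988657825443179253847828876237038302892954598890015471730288357488382854218577114911739415102914959130827735179803450486746575825520735016217277826457216279333883674210383750942021995701415569888997986344006505831139433621371688772144010393305390170691704279065590290136519258573732405965571557337221701942108201993311102258720088200367012202817460741299954547399267498087395348861798442969757206183162656530561272352360960118048460861635594440856103608109084234101630122573082339171068273529163141189524438817864013133140376208887450570607725000428141377820646450215673190044486472953230003942231343986230156171219838125016523816838928866176676442777885146534165659558505976742888596924289846858492936248,
   926512210198566762716885944170866000906492284723572079083894455967731657652031239336149393622206404005836881493375245637839986652587215798493938649235119136101393192355296906764204416591528549543329721765942023582855978764050252607596833152727897904477821926778742258058162860102846258511613571586084253273470601288295360608963346471280388003617844076511041475058844561132540651655010527980939484471820439997167832439043497483125085530885265605418926533947837234668056360322099573511286914682596129314014423292314861958090272442807016603981475678544106176072785894946218707956059397485150772148681607114374496132632295416333844373432224805638902684174925835046618247162733990221098743006181009812168174343368115690753852641938615587650671169188584914575774312917277285848387976713304937678807559472871748137146558749148225322184398200884119070125771208780492941754405,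
   1048757308001601645992129993586167375677586408054844208380501722674885859726246650261780769460524067281144378276585697128902273905851110430620081123435700513121375445414843537785510453553856307494269437563584708603037616540492395903008796986332069627171979262056713473478057843526269092885217801441427076174858571407822094422216902400788036881110562992035630849945842537227024040423444987015598630933505408450717998169676466266894071061214628894757698570829105668515377074599226352969397669853422419469860472159787352093264154342642497270021935586561903922616479420079386695104474467669056547787600316893477163243892499745003651389231619450468075156297321431752581954414252386600973868476862874009300481654317010591648239534217480375664707790402714289579540698336123169358306302281146957831949987622000801089299301006890159380221999140032588270799820525521552534143028,
   926512210254047219503402059626592118245900863201080293449364299289100919406211596047755993277115254232535651835839764067116631643935246422585225555354355877649431987879157759106586764919336897374814295979446044105512985331516336622979202574539689537071852261968647882252327412024092506237744922541436004670792735906906823529625272713873123318671287114344503279951953534983467682724883457575149346151250471134958633763136414361101495365808936059083446530065667949075067457295916953393497285022408973246523984360094165146446187124759827832775886607990686649175169078653988660969552435718643492686384802632350703492310060075441888434836891071029652694143200937599365768042518764712010226171010644121848563076536296377643099573230696798252757260609094698985015854942347521705485060988008857109996403606717751969785347731452908394084795592746754867447598041512496106833486,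
   1048713074098903246142755078121168163289169177089543871482874971918410984319436627194998273192961432685667853069179274841255985663828492239721779008705136708482778561421731710648948233788527094946627666472654578539883111750072116844992464564422493966290587931787390122450652115583367810168404572860539425669901112891519106025600256189111727698331221338215799322559982258349085793750576292420191739403305018033291758180799616468416189290015012657492836790115578586388572830281073685694148273010935397760466449811374342896285423980213900703969446319765275242136905805246330616681921474394932829433340620966588730710350852393865230525683680722531354767046633585700670868875059462100417904860368422797490684001499009138024535017114178574175114669266800811911930484437959683771137335846681131611782865298027660162938114576063268274106100072595579106903609105122319821251094,
   926344608767720293435987302090203135814199791460267791283245797017096937716927518620584875171586728761940517305716197212279263966193138432100060804060532685377794543786771078954614698204746235306501727233066900990790563092987007649942248645263022473720601199320289663338171955921490132524797921443242318641352150550245215197979785263924044552026954631041322045918911330348337790186829044837356991783040958170744654661932275421402224704877585131124925935873785645430050739373455586237545406321496044592665099587842922683644503672022737549839110942656256957671615578090674569268153843447979426899072614125158890200711148160835582142461899256609616122665525246704893310816483625692430601298122528607028292045978105477767842903875285048776907223010853054555941610942175966804842888300492364233730641652420734673805530239757154946019987238219725038428304275928470305112122,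
   926540507733368844617128398806709321822813314621353554559036612568380689563013301154058188742127155115535060875179828022185098057137121520925890477406353268963603167955025894046592861400043148478148918731949527080223168351300832866831810000763378241126346937065181847805267690902912973094153278345701969627390260186520012669623646563469517882731048647184349979680206781838285239331954688261022451509886733510186060846644044438568749382990746318612054314245834564098557149886364405435052004032842711976352310179839009387762496607621289656663322879419390004983132390060232563538968944371194270441965511005802465654598032747256796548527868963677633808412171510617294778622939760589867895758909772189471040128122241701361948522518816346543205755827101729328840028966748121835108587480297496923110028530344477646750535560257512888285004518679515665294759269240928192299054,
   926272461119285576057532050350590814291755763019028817918619170413320707281430019755966336711313638800844810652351599150454974541779484036372636220888768921620069889173965904479887454830992733954483196669235545860819138442205417072150603946486642783574722191179994877874370852731627406590790330195469510258539086075452112729621914024580850913946499160794546058664234075051190260504205687608703667449785004644641279859467741476078395892467936182506226190731944245590899305667971267473064735014605548064873459986631666922292737814746291507625382427949922360442395556136342093787981497632764586199013880777252780986357907434603761905080914212567262013057668373811541759468260914704858231637277164234993784946749090217037965782690891392361027455648695482760040516496288962247543410807050438168533218038590206815514320446036144976721444773548571033758304808155030171287878,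
   926173272028718972192116215582519291805293276835816730009119880897116581166457376360533351310698612074412559370941753823782415084092480138584634270892843475828064652256093682646890066436195452953710975231462265844259983527058504323401169030070300502373949879063687756622989662830428373238045408025704331287103177419462070441103751045885723434225074258355572867595030469780873195684843016632636009319310626142264656225576879710950152174626595251204748291645417817512603523706926649148495680273383885557511723322682911497087626919371698131855430324491285472600253025537320140966366533299149518798366241398993927754443054252519226793776071471097451196264371821854128830487343764136860577285050600398238272343125591150427872083942025416415331793862499011284499416004007764572680656701498231217472028685072393426814688731752883004514848875320631218438314809928770043183151,
   926342739174199265042886537179808480040841326849882433226112828323653648508943280137538993977799175929460886766960550316276527592299831998527653088771824324340487626540841365598285672691926843865554311766563858477781892269122120004750939783370537477789844275248799692055366746262801366258033612928664117663571689691114879330643148805030775023168091641800813789107431167116922527262031147728907228170320300884869827843924484258611598972794548077279719173566634141048249410529282594841595905402858823770469586279401086126227458127807569445596233952390543575340505456985357997569234786204066403417516109478207494384571049673715733011109179204906902241444463970151301839964303914987000214481403290798511636079567009862993847905254758551943836046627052646953853944718182821739998575382878694158062553307265112122929866944355691128133685337823538065859552239690132665402444,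
   926088867513894711937436436180482850200734736935789640529308216941086860854270645499935550724123460169347819267015761904864139428126223687715602091211834565774143444374602492476019228316862287642462405392569167219279905297168231432990036814190932075247061253793821781699838822961290308315646459177759893044975119007464206596321644729704605750675410215914805436746576998006030242256318272846997602759964144274050052793727782944718718310392383239841660497415049391568667887103921152608771739526211560024674878653825768592246050516909576358177286988399267940884338024187402662331841554216486617446535489450859914092963328788968254916777843604264569234068781237934423107727359082347763582732101318384856087366027952754147636115700642257513586239066608554327053745587375005557953872547208563095256510991643262302701052565837739570870871895674329876305675909120459841340747,
   929802946919119000471539802413892462364379609991728603806330302279014308845614001583942433482444253559825072078423092725981269004077522526239828549989030235925822710873408331577761183443191795266069426240952656968699308439038702804500941161674681898058695181716287683762236095628435082528797421391653922633908882436897253519310471169201082388150979076697445993917468957689076860802232197374728593828838457937465178588122019891996767186261202971310588969644418698790608358520924071683250445488313517935420449826115190103825090914767908970539806862925419367900521611825674512928373764008375131067506318301443562286431933992291682782777398085229106229356124783556436031238467199680945355406737893889468719237510471714994449970006624952390099927000498659687064546986501670151265620078917234910895615287425419240414478948632077746583532760637714921979968886185692376662086,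
   930129406695256161734504311016334875995929529590228618039647036700516716506995416038103103236614957309076064614355916684649011661121247742670440653415378255241517652427844173306602846908211638756654861059622234064076390277317226374223900950375091969676124876203664689629755212857417344326182097550795495101216688366451143997817241930577728319993615683817185868878128943311080758157078500706155899756346425276076261057205371914554767654315592773891127862744812846985161075666339835656767592232644262309970074234928591471472097432019024642798039495965215011933355094991024404501692166569562358906936916961605792428865965159970035731472290542429969200444237416546713485456792750703098613342659433704195640897889182188982905944051290877130971477985748602676153280563118651429074905444710666332360012115179628389640023943313407272572319233095964391994423891499179283530263,
   926201577541007741533847512554286385879969614402452254028773153321807263437777388808093395234725489058145872630201951891654407218670835293888536521773749135657303496609271345495463330538606274218164459439292586904342999877271975854578365116727220114278040331270053866500002026381019837253967352529748170333540418349993233772474377976467229533291143912190131133341356298078391600971078544407720854234535777551309313789004512347187044510733941931339572928725450032310506674976179914485105198850659658405026201484762985152420940297764295845129678294594588790054834850564324716400602680915505290412330809984346893412483359369297673949183148884926218275634744288504807070793852350743393456192218365712134034629213411981271042354108065568823020247155804370358349746361392646397258597387869019641173772778185283054389346665074030663980669325133205334421526932718436276240424,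
   926173324608329969986366182967005696817487795706752660878723358185682040314010930101956300939343149323308402307641795470684574450756825970358433875954996188150925874199272930391602272617673126972174505796283698060783235821528686641143228026434555097783120107550034479077117068064428833767287753904081332536574205860944507765973512801733927919358135445198979008141406734772729519280179594499935478056403549966726359321462004574555127236455638035026434436182803516280999319052892996454921159987695464918048171892614607063416888096446243509944175140216739952317748753020294799499134718252771757854158960560031542501885598551887993278492209728795065527088161807244225371438705914826486854054699751001844854184747318989782249149558652415698448977022160508200885460595025709992211254832926613035218320897390908302034317312554595785993734707695245033478345149250750042612254,
   1164446233073472671725132433775639177955259686120428398894756488435635467876281366746588941023504841035191876001268719988748329984285822214898837174549991880411377894557225834312039425662516137242253688939804123276544587524429095542708174267475964164363372000465423803063545689805000799061032260835167441452354035459575451456467517447825761526027782783277116093702183346271408355815098570372598545512019601400545237058588263241506409722338871661115301239333209026231276023029071353666365493622230245070310785934128675038363556269577691029598701222520517584369570536570609781507932480996234594681207370210222731008027450394832361014844793004361742188933205639816150391958314159821143075044510158999769743941527201173526220750552359794810013481114657717583671437726163447978364971746377255318752163313161913575513607067604339549783181405370729360784061093782422368428575,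
   926145024703095627971897840256643361523279361124532965800370811623124382066320579748759309870725876394162341443870971253264908590900643622342452474457200694831333707436749046476866976995737601779694473229822953456534152447132402680967219753541707167175738090682847005811811459301607567727451949623720390832601262645145130124951897320992375711811260470897687330155516825107429439772274590569926511490991360764049761895868133159406763004689441825165640189465829039382171197188461482385024355280367775762498238420744712858078436917947093331631993368918736457284307827616843455780134353605654956608186209902935118294409167272691020051873694713696962607394915821886062246359347910181132803026049610221520557751228209216984496450452059426693292377742194712719846228316340034504708041445444733109135967498644539205573473509542855093497389811276070625775766868386294129557550,
   926512262778237382322753219331771911756741839989161594285632933085322203583328658966356270462365941127665251063593456630339986554216409803341428865872932601049533470135283623111635737704948111830186932593751906697081648338458004337232379036689249216988667071854189960762932262250497451818978154293992723872248333415408376243050626476597591731262026667997838332475365109432039079767423227957802282194565066991527363943185166538836630740506617806588622095081210846104758821409198962793112887072134362167362892953673342914547254595880780491042743021675731732204984657053359708888688300819393114530561807173670454819111990302735764484425910768307078230179666832150185470738263667863094378934320070185293128847791481197543690887499202516195937402303816338329867305633975641119633608440660491680430836757859058672817579335947350044253093905902458391562599433273110245934408,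
   926117007576589557740041917641415648372036570318194113949519423057593733685084254805921520525742960168499465809531800719446861948375175600194147378995861397895883318264384742164072074714379071089886232967095414023928039858387429184584549049540172586460423229761803551383836404301663405228396898942564270340696748712821258829226287745112330351575412956111156369122725740354351790545281805055517717297130886685712987539667583291461914074768873766449555677393847798870131466761880433625061478292050084652933130779389298958498666977478178515218291786491255317406374837205926995801436299387967529964876634248593575632735113946117318979848252334952075945206484684622873746026798798589497119153575978554458977426168480282080434541653555010130295093784745719800257424067304167730503294942040110816025781876977034219455799917535400539642377433304866040878521834471200966320645,
   926596944418586576252641239421207097953603366358341948326794296593295072919513048130376412109482329724924981525839687565179425660682897430499847986631778501021956117779933852950753306053097879142830036679772571402516338068659893559949367822588315605313606935823887399868947518457538685382454695326104140946052934433342043401060173304252507793135699652429019217500163697301647453851195275929210651414866762131812990041840967814946460578417785848467941321456983608725954298569910363585521803701072214357824887186746732292998120201293253163253481765799450299046639418524521661984549065989653012889344768561525203261151737771203658989572855378915187332131779741324583274019817790825679244634519742685464080326124150594073281803039507397807508109594104094251631123717577046352416999030527794832565899702233363715960837834044245346978498237982711419065714434226757815894338,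
   926342745424278377267478003902966428299722372584486411533732087642468934450830005911312318988943252064510979686029764264538963048374134358991814392892612720510662325660490465273360786936289852367562176718676893978326071626998988476047345074448515167845306865664386959213731223059176446861463845602235535002259068455778185519473261805902073775734022873109750328585734291219471006469685817380264321189518405372961558363535849524411975371477738223618290871045947502346835023378275344410391629155686684594039403123496195490557707815832305981070324463893426533474955118070533710769775226401496700886521281896636002334981043747658603099693242675027964738713790962963213898620610895510987767396437299628663880087943710964382577522700068143438302680549486716513768137004291854891258093806602603683129796419312222979691678248499766647651268337262069540618799736516631989723681,
   926514080438575019893341805700182239520932219159616523292189350380407167127929045903135103823886510715412444169493147041245162050773318954083047714717612222072796493293602383530240120368409931194344829088384699230543617389027406401971400753100128410507249740182453279130635571671422785427180276856429623164674707275640388885191927375612080020951868004894459427773411409628446734127163962508300728070342238627583864592572468665454525644738245763626536888570424081720356635928498818069692480040604725866174628867756612668158927521618823846107412568218297242426971181525832926442539791046009859059850083491257997611589432930002446485864067929853855294674718491099869750642191017805403334490975240230715756312222757199553936897152711772674549696100003306759597284203412727186109085787787689574213150316911572688475038855411449430891786748828655881786531234078202733666849,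
   926344608767721125601000520172616941674124983168713194491186535717537319056211705787989999406901361688140985389303707948217893464570307464546529534762277151696037867698519430097446328907754630174318740529358958942246504458664721665116858184503993267082117058910036119710638600216847863998141582603293186724849346047387973076641095667237312359203012901293413567410199483377573810062845582223640282225762252511563424248371394011690903706596540824552891836503820710110443466763406286596482933525787759936734525329278258412827623956332275293877720003611409233686172809325648933894993663556638114838428644464570350536146637808822828441760734554120329209584060554934999159356895127204792865753501216704662374218025406075183949810914523322805069946453476641695174062320900690564119136819176361269340072254079903076958706233020052231492348404397466810949822257270711698653230,
   926187392299104459516803456305870560301223589722151995688490787614510829984668945359917682342745777347024903160964108537525544843988125508501134253753602106931650826327373206560652132239678950816388007177500704426797043199317395294989268908574480558206896107051718608688818529886655813336765344742186184773308601228459638947641271305263612064352086236584024081141160040900764826696443733670498631010046600821937741361402604151335517211963460221890932625327032262196745344282575940102397432615306691352768131095633558317355881464585696908368292557484609164844863426598470822178402243896413783710779353795157129391400926263195089710034346840039572466900749036424985579617550189689345415534041272793063941997611688716830485709736549063644835469141915223599548652193093297774034207012118285073131634407575149349371359305523149485821140904780945681111978802326430768448016,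
   926413350808056378386953711645753138595227692392903702669653699713302926336995389412147250177878006744000957171224296738552021375036775493339080119389572629621814655046671948313804434631738981445478049426558252717387105221975124035516005159923855293344206436445151608254618836787279492714313574558947682851495146119215676224781790691716786765265364173231900369522921195421936520736767966848564464804560890350396757008095311386493344195824761165402712187640898530710088030305634960723181972055905247287024062630675368875824387645126866234210707618713882577118068813449354650227723628057794267538987637493792033655791777065275631535926984997423013565998934466876203129795013979107426318557151702016341942913054964141640585185066444333777231430441397247454407552370564530257858128720712344381138212202030330048616550280023847894511838637100544204453281767231268278641175,
   926159148394454735733762443638483927110548331810900038157162380881101707465071543059785983551425510752993800192823145130751304432911344419275867390381050475803806591062592830819098233791483911304166150107292889864434954098663831728288739639569775129138544922602901272163379122205609657623761568162048827615494695528706499313839960864423606392230504764314525055100740179648286437821297745015501106047197469421581810003728772802870415151724111542986002505270544347338540866162507794890120930066636952811635924568964620104019891988914218047457412253476887468432349883644557510987324716773080539295239472523038246645289164862221171864605272846649254952422509677283306930789566861590381496702934637250396478537610550081687526844571716179618566830319991037742190878745271880562739107780130758236473672413011654786152260795618039637545100044675782701829878183764039941226542,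
   1048924908354043260319834348572818579814913363063700226023011059127813166164571945146585825119344052267489151057894535074481286148016470717863759031186441720193946220946291942348335996385325386249576628813752603135777495073234815437516067048742707214925042170448671512646817016903884679479050510464119708022029093154002539617994807078746062466081790748229603773830406319297608648582155900761387977895070403662674484557441680815430459028082657892901947618677938301487020856107965636879643686367498777845363825729330188283352975955745751591995069589850195893976264748021928250581905275342563340351532313043308906787570844733310633577251230071893787726805864058365953174775288318166781157593606147313571029097234403943750811841792793261347583071158770333969714290575764055739903572353794250445010054528421503402153776816362523250770309098665834532605494075028552739791378,
   1164191692582424083591207521434531240766616300346175574099288799360615151681584733180762307614163844915834426840991574538346087417240690425371705163771034090113673373995910611800263338644767510460127562724370456117494008998107420661373733815280899910273148041517226383180916495596706500731398307923464198742527575382352166293787834728291377700617320441876493251311652509136580497164371406998027726345417378914477713624959791738598283186530307008549560407406928804356796961410479914686366083023089197390297849359325177761396260159156910552169202983677389519919678926844765822211558604598011565005865317917546748055881014913019231551924825931067310506871911346230692159671351829462742780858695403762392693030469716061223238269060518751096941227748909459007429926486533737787240634201282839741037314616467413618026871099243485807158864916033842611297061285549162332422197,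
   926514079792045878361178980834213375741777533116043542030675683870910143435300307894413229868646433868212712347648359591445594003058293892671525771937326806538105116832166765202894898968494134829951340852549438503944524632836056786815795244672125454049188626131500790259249835951049066129341454649643693745146702492533060734515723813179419818509088987021311532348902889603717568315819815975035923079908854023677222051081975127884365199477161331516978403324725111261974991464373496323291831603216263601648729283405532983432971422404495568755998600398887248469810688197618771667954633075707349816689304817777702905265410811904824536504093182945190795355250919977001081189595087988996349154975912127565393069738320233882959568281007196984250438220104029264682988438566311072176168657095020352675620213694900359162676812787140865050976623504827429750069632141727921742342,
   926187393105667322051835291976500633797676980428072059464834450574057070191494677485643297213375686954591071160305995305273331169082560978118365156095911925380247636082322357304824678493302924197767941129605961103311614894756881778832119211741018865722446664641658411800169935656884383171674755332046184675132539574798567296108789363841920297275463329461746460702594958185995967815001471185415713765630414769490814886918343155981089270835778014721675828078750241250984693123282342207475760550811492399330291155075402502193820799371260288398048315193495026678966770236934363232169760488895473810150405351707049010704148650929731068481138050889299511887719559528654316350339096461231946747450366958561824242218996409962166432697122070598107855807272888940231357499028536562667964871030556952696522666553552617781941595197919576811997135283549391101258805415890895585802,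
   926116781688105993996318758898752279763030971307885609558600721633838603189544954484186777892918037448188280504156817929065335277538192773399864294091301876256418286530748093937251949960478248593287141481517525860529238105187785847377533850150644097538070964711018916101449621176065514787658746371814669329088844009893251494525529128197989827058972199230418874436907683790786244475166038150962353050613701432440092049853841897993612609621883093281507472759758330654227317179162614013587114833633910482763533697481602266376613498879347788539370184544608536597841779026175662336825247093501676891113741348851498614319122987024322071746914117004943879673705015698726561555878457345756485334740729705001657192467673769691368065447906483743934961365456178143510633524770748831552779545137602613594682793083001587424480561654295168004737057654501314177871373396088178409525,
   944617085355246696374795050240166033531639141734938280978495663246671602574448767761495518507686484282551746701411272948274685732318000875883034183007261543155463495495401448422862205221176966718400777811846841473525029803435045576872152710489883736777072315436449010105284461132679702036763172083400442887476454660397251810255949560937446031314003202716282252286069904685671742921956992807016124522254241857136476162609899872511587629595403145348643523638802190121934968601820756312922662668677064098700741162288682077999684890346178385616930881096638430689513813860662345979899148877617461737175893610642478960217986075855445037362334127451382320740819964576999415142292583407642954979748746945789870168115348777977772418634971709478966042538388424844293260286654233493242035017317013698745365793664793700744046993192156648410407513308025717457693926899129255141910,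
   926060291350143240894737246455954574715023103131185077614546773235830588964605678584059826499589334572471607479775017712264565053304441994536163601779908590358605362526617457122002580898058827749620066259256631533507639218079561947582297121562715493709892282975780489165306711753709875294172640380923136916934528337195091813730967066247070534456907866843969141342482474516772626574444318210246717944100096369059265275110546040432759095020653563210673167892289747940298704009730397375234929285222140612853757539256959541863413390836245702721717744324474650477412199374099777398385794356800188507410865035567910171502946636145495121016103907317526110906283549519941569857499805439694137137499696771324586823602049947668273656616220590730167162387390016713701101784869530406364670620257870041685836104908772782216588149973225590157953923665674530866056545713544870363180,
   926046174578692854034817923531422393866657589715851338271712294899319627271598522787713712291134323470643094621173936029186346088191310071842364150312833221816626376480870265090638153658133937936674548276971300805569366863932411317659153224317386968541306539984433963189899619262537090069606107501602120147375704840184782286186925658438164023923639503503326577926274918789544331858755077385632237782078436378142720404739097297958776617255477365076728831526291238768937475987691880938279477021783139702974336305720449543554901833203882781400753721080212640508343745587610331688234064195348616627919738776799299418596486157359394089389715818503023562673369262822291209718099575223713280457379041099687850021130964935870171272497987926432740500291674805100636152402177493353657834360958083266474307203763984153968939091404157234845037344470419277345634843452377821610028,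
   1233958061743055447590221]

theorem fourFourFiveFive_refuted : refutes fourFourFiveFive fourFourFiveFive_cert = true := by
  decide +kernel

/-- A vertex `x` of degree three with paths `x t p` and `x y v u` to vertices of degree at most
four. The colorings in which `yv` and `xt` have the same color are exempt. -/
def threeFarFourFour : Config :=
  ⟨[65543, 131089, 262146, 524300, 1048584, 2097200, 4194336],
  [(0, 1), (0, 2), (0, 3), (3, 4), (1, 5), (5, 6)], [3, 0, 0, 0, 2, 0, 2], [[(4, 2)]]⟩

def threeFarFourFour_cert : List ℕ :=
  [937301869292720954039735132198814680260396797836427764833081646331786796759374564202992282063294112848627259738941441228834688219991612741316196343028861376317765814804231393179170375501961474995147830900739948983178731970511165358006362768618542812574293082331834797044504270343614482704433616409672242593099541844382332849794444545555286397345567070177609376553605915926332901130482292139109013034949998435224491583790704976907244880242842907731128702632912857957902328881126980159052414068357546756616104720112836609735947708675818272770796819061528020732841376278100908420675178839017513550357124357868467864811296827825572851489348512001387533323237157990179805559155329384477373549900695802801268792933258636217916173935627187230297230051601285884439423599443111031642624298644606854243066499463521708956974641805808282679417769980442005763309175418918578094159,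
   926300376610060292714531159029571409393689542880500456910326886280910061586931735984430308333034056076307016829127637326555505260597441206958423396329372322775230686686198087940519886101761086829908015902688303919685351465556972860046344708792345038622761144870871216937881796408560785125081133334920948282925160802967942600628594781562959350021020606217312287601178987850631457873312535236920137698132666180121055125484027278517828048001960394484761963693144664275269596343887926019051619037147444464506725016235135307623545927193965315686567893850481913639392838975774941105600049402517543187421869877314899963223173848026503489270690359906827934665260401650343937215918335716586690380278140671909570935566679601038595961796126016462391694893388128288360624268949378864697224681894998582426933903288700713634995203395759891600961180023294075484379372818536968099860,
   926215635926042827017916499258418928895057439824913889666054792691930152508085084337734251364276237482700223101298887071170551952021184083273311372430295521931430752159542615921550571451970773251824630850163647123862529392666188620750155274106066871018860023857874749532119909630658910757995071124497555997807763982926824538757049268649012451005618903097257342687170202243416763568107707497379381426397329555132055354022950974829416125074403773408066499780766310628560831009195318764668847097414090652253631740504857510105676743045951750551570614307827616200341427902332224277054164882216718953050889272782503221205011392182675216093455675520615519488709714737892009377471831111629313255465514639265808652889461770036364531567027836285088162200070917059817544938989337519830310381044479226192335717292066994888069437859479448920388760138875982427223782433153740773391,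
   926455719857132060952165057696705711778844311950181051216062651310965631469138875034452437867016388620353931944190164976546301569470594072587806326257268011424319170875105132642766171557955402065137865830353781597113198207754098693165683247461051218446542252784571429579693214057168702832740289382336365906473405918079076811023121738180111032576246896886878551789253029622638825046568449037601537214600043679320049787707141930710170511312842392652658197850842633906522569035466673025390575671935929183507901648712145930260201061706248636588378390249400835146566238800068162448278814152529982016688826267238351784022565778845501037248944194221816947855979137947072645066738400007174749270064663568035358515357236857944268394610961126396046170969562410053872474549638527689988942095688830221450085318417511321476714557959145071927713645165168535393406736686774168000529,
   1012362094268720033006108533142612283309841899831888833313424106436218013490740136538164935419913638779331682335569942472815901327987449269589068366046421015012497854330965610794546885746747317687646866252400596198617785924616415266025234215528611515813681517315282745198108946356661602102592247321238129506218282192350277353048341130683550789687044456088988719459438371058032504193758821733829898894005476913187531639019422247344040629626785396879572578338369862183561375033555323093337869034422211383435942848729045225227163275888030743640804610343075100129333151845456316025168044467142696318280171108228731540893785621980881114583534012575784137005512555116108793482952309597281521538589851030457071065763642130103585556665573560029397432840416427749111270027815333104750097851352369858716545614657150149553460641788571811476039138873655438811998836788808830222403,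
   926301688925611819195020386979929432405477879130526019607589731304506480722096743303728380941563447121617217877303591045167697470214627421006402592504828306687537595712551007504864219830633435446748921762931434916307571963450867785327799241922364955474670224264439132106758856132368795829388705682066824660383588035535210810709187130350799776479253483014258728435893077581445184899213372298077564773665953622059584315606813231394441343549725583432508937744089899256741055181663372408931227151339317379956688049849058617930821177089993919174217670804328028589300320464351614828316119118646267074987247430768174412726407909001469462323172234797287779359144025090535017884438835640193673899737349470995470454347135043253979836727976902470617892951388045337626512071536585535290005412332108820020382964167668743683120592495710863254016770175328633997846588267238194741285,
   937301869292711089377298369071656619220479822179466441250397635618635138822862997518004746812081597447731585194358155085876189217449633072284665871135853517162713350897144977061397312566496188281277675925382404376523503560780241544143686913419299679146001435193669401240208808477923099015039786334116613389418911828846952080659621644933086061217748520180156971492966473263629311525282853868706724750656295537868182035834279730241781645939527146173909826534317438034729118098998674312341849510901585753459497084206635830891998673401934576294709125660177281028058340474800014133738698254096910047683792703355151257815323109337675211693113431901070145763318777815218081460245167543815403566425662025188896562380266786465754257854481123065997293997890328156833819665662828123441621917241909234093943092437507859728281719161441939092257953239944569390900175606830027898934,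
   926258010146917393493523990005994270824382857093452413842470682857590035230505993866612579242724733097616758163851059736214915349313363710134917650469108573248344938386655015426980184418655724677798606499005844575940982149294716891679032339104223133661121531374944496649723335306815699059598362674546920871539817125892525226015365562026209909699235939520337990016689787694393183014367045703939615614418243405242790413271155972583365762882623640877020287636873305455718738011029118906596856000618094181285858330073125817299480814552536734340142641129290370105437003529592682761163262735997494056178717431869485422264586097815125400836376701332460303757165017348747826682167561293215543571352472477881293091789152851022256993615098474576838615700770699491656078771443513936666889885534205983957935763611077851437098279192809763010594294401759653115295738765261449205773,
   926217007286074355566601477314910151841464347095034035276635140945371168257870590874378544799072572884027110307035651320204912027537641829188391221542965586579103797601059027128282008685881104697486631577247549639424844220174085420973391290359193088480204795146712042975801767766329424766241500417289393490513490682807187950393652813992022620880388243528616173745207578009892648156796273044655515131556917256514038415224706575037764325053102800350341952433391184536488881785102399819787402213254753778323073224241123341441002270384181081315257056424110502042965976977428020574463484743607923528910873501784979474595277698344115151530766034552862556061305986051065386794545179129936689176439253144037503012185474362697822383984773390725402368262322666126551205036526950225161308253566234538286370943091048314410455900870664529224530970508029600475800020152966691297288,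
   1012432705040655860821657470563319380541168822860060354647828666935676284598149062169850508831855506923471083015135495330516402043439000319028293419592282950151574524792964149593474280396615757943070352910344518520374927762352400188852355520660551313390137014780133475743210009800099508415020895606072090130770326947615233129639326676083978885431223444283088796445351870037597307375885198226637624201008608900345558212244623020272508238121228029352763340648497190817455623059908525792049781745870819832013648899956958867697233611766230910434049069712696006852218354236597969617687329067013651452271980815189325364667487450488878365195262768165600019909290471009129824896353144744357777864788475627792511397245320287478442773306682511293675234981795709743655835127153035977190797319340896805076838507916281494222054841429931168597939459466648294959005100103688033665072,
   1015920935570278996654535085925599311742631903776609364810417084026621116876359027364528092166424842900492085155155830442887175607874058124416086122762457672733160910131989806057668636462539170545683063008873707482370347908454312170130348306355246474274598869239266991196706205312746858674132541449253614034919281811622218433001651253297302795509538392242460825092714753062572513367838434236959583232661252650604966753404091235662095509052890508214093150539192454278638675304332517561149872504359143586033865481369336493691060260272840814899224258967320064773236223451241817503978830988410983861750712843791373267419094574774326326928651379325210045149160443073244032933705700952036045425751796623886689305198913288692737107755711583861936052514548369187696704896645924132540165532128139531315182816358785469687209282413444720948853038399528875132227174533401620250676,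
   1012432705040655860821657470703500582842791201698477241170123096858538662406201805402643048373498585636006096059604617420381846272881410187949613015821895967461199538027458203768480481310218553102124605460164445372041226792623173953987551407422774587396934068230151800652542398980993425436619960867103573823624714672910521970702020527279078994336723167632003550305758153725859641104055033480263215620968256955658751144168926057530697692740412591096276262869865239561168098576035277473570432637605571940926078516981299898085514804146338380549094045557246045459988388160732167437393504278470345663821737050811317473764690023424544560190410349318117653307714380015323821879341021615420123711407388368820391184839730247576528771027718228934786871753609879171096804468035375640722545171318492251107046661033841325749489424564789587080045050809009212344825653854794551394353,
   941100843461702960401772308303834975328236827191589531333844273012429139927981614827849029861185100685979547857107723219615471931550313391295313839855251404202818404980979791883158455828593237500172669534530793979356596521493977565729166416162175784288235123522977924182012595493326144894134185479352552542917800699126201678099292543714373322373482541177667951707087896645162444965157403934051790227892977720227729779323778409794223084077312969095164947074240564066604134989300110408353900787771025303433529612954351561251366101253250201673141738615889783181409357888310455965281330646540183406789750006991656537945108830333551685786945721588619448576868790106429247270393158902009485402558775483277829442871206693129580372502065251878584555551477056523649187484517967057628598955001612541405692219202327805511042096077147252829600944869555015489163582138516614676532,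
   926221036738441341738110647630501163583533357477185816309862122737489560248073514745974776677494457436949431402919391506636012019547380242795621736687976424157755003194776354776162832627489595768147256991487376797107086142759010048642228880612792419273612710421844947474816070318251650172188258695803084523640978544827353648242540030488540496269303104469432670495549707154556527630032694853012640210860022521339666019234213462310965962649483077507435186683821644360295888317818439362768213804082936511194695999332023080529806223158747383734754468839786084197490976570223068863876424208211603718774824673499116394131303555848806215067410798224922222773885098913282261684780404174599621930172060201790755747721702110533599271208666979961587677996052405953886920431645121670809486958998183473880020298208736203699634245353455260577419914654282497484121743074191773140302,
   926201516768498695691627583689783972674699891358721054701857956670735733521714028770458267972489783498417903000748020918637054662003137764539309400679703652110947627348234903997764510920170360158108921309176956584706000914260568057475634407123162563842783882595787416089192207057298031360111467612715090049602208953334098384960955651648237196286549179454740009634570595824608026570694657714170280562369099815728447855378916740742256641604294142232255017171409504612256451435634192959005136574881872374236877944387192680639503342391771554958106116019963561571932421055337908455766139661109191025402906987266701727479823181369827704175344135853983692980132214343222079846526343586535980880793662238799800436135171813566014271951803752104969070878892406230893710494899850197850132964135374571496251741880517873537758112366737960568041651753637938490372779859692659302924,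
   941100843464340007127588174847164756065954138750650606727756703623654563950438729238646234823234164921345573334352302715664992507074564685371323417714870157989126449231735037527866274007632899153080143295168116744835618736912810121454869521692997231692472476712529558666464323341006785666663991769412739307142892034050973425803670653900893745708083549845851036462338633281016492313396167645520394302477926725498743660881377870710294918446340938548350208792051608552743638600057394343821758244401956625362405194406901110455967760605708983501735680655608252363854557988335010693691526074414009651845994024414519437669438746677627021296831375477732401702547914742684894205835379098850720034448913727168914879126954687923512048002847299969606503242670922920203890903839990776112684745455609909389376464664865834772694203412783746529803836487520701616404869910700345458755,
   926202832339105388468644015204723217858444282937027339256584035913211091255308186962322722257844945977588059270152869163710097424292319879701649385606026566438658230769339822655038769362940563666667721756993094474878730636536138377998611945348713967973410686503404691876051115295839096895219407389797339016502824742633757071131668816854469855125313212205719681493695327593053196766889965459977418467595580599371599444926642960658923198763819812732293246572434731961132940706202863550589644406484588471468038873847409897045765565286658461170995723236347186381081545496520933995140444808861412440324114326636670415666075962614474312020878379024383624334927348705085308175466371700050830789735809823501108774818497181669546247907580794577129744502032696508635155793302839688520243079245197614675472660947478386827411824578323309215471195760625175052809446461246301537072,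
   926174586519342458725532894678759715639725485109515247779916108526339895043114339107840022041007074202578997632878690251071444788406602013140225108388015165938796701392446992483651894940584479745855221468973441358410661434316856174168214510023772514958258926787110548012766058847353301733662075616794285318190696344303681709926203107498743813209662264603803754867292257058141786355900122285798230485569631304590735493163662806505592261515959829836462935442686685263831188489603313375739804139908755017216826069937457011314959983509067606882316398545680448736514147870387525058453404476866669968724228807417953077962807557126832505768674951078492563594031031980838302106555899138351585285049630373777543727305631272862073685317123179590582306466110369652952396178518648199202171474688442094801881076301787758719991239293376899088785824603219684627891212983360222330946,
   933771106156899752933866891736202146215714873015032443368898387785361415769989837620199910824856735321862001789950350213040437816589701391223034497118340036487067593238973492533280987473266848609876206090738328730440992629701475167690595890161223539402933636111935462036293093537009063678612371494056383919716184281062587371052139242330895298365586709845993560772783564527918467321477525899275251025131954149102974073435499517925874943096384471109719344400380776710281722020768223695637152952924432694387570727228491097587129678761949461229657015766130157664270574222160398707759035675241999867271837079896964457804290152858210354362528847469632756518589576984015458822860797820265133066860068761680848407330569103421004350106676300872285021612925392048505737265948942170698696772080481289586376521129699500115707266956106542186439472377009396491307402316565174157382,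
   926201516788543077856442855680674759553791968220938486356798574446409800641031994940389602056121884317791280908008512876684463950753326583564728698770147959694000489247965410529655271796137148619437692988716817757273560957274587849042591028134191882306359431018527938749636476042368648526962035476623269325487361634285198774549260138559859636267312124218319164907204049248632927785503332920912440244541652344058413847403558534990978574566597242839723574860247344263258143351685342196599532423069882138520946635104456415787119501795142696887870774426783260377012038632547578110591938148529751956096801238834976351154914129907620757005367868214389944837694047455610241949803308280789947039698127672538138093410659874419633978774579761604461023899876952948474567673877703238547697367786045750896683869253809182269982202075910179950007551309828685924648943103570409297950,
   926201516142884456082965067669469113885182179155967591403999866963070475619106695521704057783140066711525759970483999986264403603205868397781491629706310688925299637635118843086109790107050008378664264552177202104404919718036480025420407001989257063529304363923475054453811334704935324699546735702122646314281401778434183997204340422285403338317717295069690132265960587472473416666084992153543365453269997152432439393769856957353631311105379630107049209265481858042251000569074108062473199593000001794398952582217705210207490415354395170341667661020073553709377395751478098242736943615061500745353867164841000175565823105961873325610946027711034673703952760084933441362983714982615991802258555230811943517700858209630658915003140225285116800799504665491402341779446013349650179269527084684192924714327138557052348033772806033171339977178050913736513338322135260987458,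
   926201516788543077856442855680674759586430447780998535493530554470849649116856658776910871631067802495428337987135341469995625240179229636923487002321458539039937613075048682745214897369362049122522407317366796038696062119822741284451374584360645599816161692853212012080940911872310853791403219482695632503973245893939032405345616461051097029660283866396050458009212049698004983653251279965622564913585370114886266049823027884990961214075428896262209742667265943322078089426476705524393018765258004562756223538342703940972545507513506423487969074713129602755436062517773928836251619124993740195847228947691215389586463600103447499089987037103900292613929509016252567503425870016586660512755116893118902380801378061530693638889413380519410665844976326476233827572894398647835009357491065346924265692784930233469148267047836472153108512589442953642314218053738633757256,
   926117063982997397270963655838178921509521962478153403518095667054062367133134470945975302085524912813034945417197045119109025779454335058223453807392339889118932848228091593766765941867892413669721619546341204405167998721898793441339291396649880595578561951618554093085022819266599833088217163701878067273250980110626755379283899364347960524220185633226766457719438409973073261691875411678630958882711786448310142530637286161602446067484534663363232911657089984767902132550705136013984534089786450366804459831734866844848751685062077816274640585779534873557577836438414420923710109704488123613275991928399625976654907040262914335640381894891113077280511699046551556751478947289771866020853841648733995138468809228762611329814377978453115117386732302263618922644498251463330644999916221561879356708831619011301185051242379072065575120347155157091828469947236268507202,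
   929737506836109047920322989537166009421961384535677109820228271010861740420658430110051359921455074228695690155938313801222486571299827059070365118278196944684746765190977353948498707759309335585612186054199668456220370300853305641624218030698064282887956281446250762034819244417166613404729140294697902797534104274693070647082716378353321563105811478803002393871741857051124946526422676006973836075111436983307997328318592939979007181652800123574132900513952503943744345423406971412218186077552465795787614100124270747314773620729452867376922655802273305429306121260511478687601943775753372161697670390104668789473149190733934950529341464459815572225555165148952987778609692964431736051710701852090267782184029290315853229110523458287241478838052738379604981564469722141331468827435068957960962205067853617771456842700230273618700227800969184800788854849276065809230,
   926300376589910690694785852656660106400140313534000547105574452557997498016654877479756984088912580103364845423122591973320518135117563083549469460353422385591126956815531376309383951396746346537242109971258140477410907164092776880557782630853608548240255229376445941919748192283048668946624969734217811567268571264770661569566378515031769238072461279389196262433545548957942631004957143698517925455257576329485555447995454920085139524186822158204398662866766128214222048069028168953971192986345494505041378319203295533771784978617898901542986442957900193546656759927202862797630171647858243490357305270602278096830487229659463792988479960133659990199453898071011829611708226463149208154848486720512401072044197712320336962243862080939208117648772846407221207504288375168032821070789896622944352982770871407998521471288548661067375256626466409104493004240357502157903,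
   933827761136367614424334542696040942907945438979810837770004389961376013453761853195977305469205549896264042891738273321784595026489438586688414876644623256577039826861461259737782423366566759309915398894638418538700900485925029436800534494022734362381227051431397907862573227171267889458353340198362211954039676337402995762960723746350281589964062968414229524754952101627312617089284184169518519100028165125969553755581510801624554776218217446677747634549737354487773408901372791018203628091733099870215610105244547034201856246809304006418282818885717378574251247853972298490611828164399602216210092361411935028633389197312639426343737187479627224774144196586657785795941603137214643823166458890511581576263589394420501613749275503691677587209745857902795131653726134341968520344109139228435141877766087678914769942795152391411594430575040528263822697678480786587697,
   926201687868550085498487216754550882708305186265887896029178081535760130307791463817346562668265245623329355170800242966145211444185089952828787752924575406487712206832617873437492764481560887549778407456146767743293227354583692679854713017927596790502406886420309921994511454372319831294615867599161262342432434363809818576998536850555645839287615516820829698482766028473694368031346673606736605623517851212606243024086389811008153280562406858646109291056902794217757608136778682336873007974112315452239222056612080843429944080658036143298087809540071068162540442489227222767964658753677491466308943575747933264942543021808218237868048105401393373574570798792818624329808620400465003472340816981444396737072411789764879201906549803977899357199034487439737627939389798406969358778606352614226108500429749216242365178652084204929179864656936809827744859614289471472432,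
   1279882149817880623751917917538457932988521900435481001680806038758523167970171887599129732517823863084785688912482606875838232710280270083446135111256380046340854457567886685903993073744548162961884645202903770509083540037096499347579135361654512817273056741076653483167732046137209371656130579229772191785239325570818992170913205864503985291682971668688586601782677040367674316646245004199680416576176336305383588496181926803877778021877925811634556594630910743468489620157767457560896909759330273902558764531458190185545554384515066759815240061533727030331196438723193805642735328530524279206372719765001763904065658676764168158991427253712494207142077433383682851685334782870881053985810430176878311354326830090392784467766760410728582121891548292559302457034089634170797338624261173109493971032430833742692192984682311143869003793469460969755952823559293582508073,
   926258006466905591267789944277658373660539854378650429531331585660418245618879209618125038682344465969791545819479230492987548593483054721660151976750218822439291336324733683375845500370235710974563079772656763615454637866532345290346156884394165283452930689201900016502457110864132196853974615226866630754593938022510421839030154280297049732117622783251052894748890878295511004658537103429878505789927528636751106132432396560812590764501460414869978836127363783339755502937773232722992683660791503902168209614797022048167826579795006030326133797695616063680047445253934123047995660534992676596283925035618860677087726202230064522611227266683565385227057207068602196037789871905188740757856249858801243742147027068203431535051139554800017843627477449458640552628805705658666832086763630575853620106166513919423069370003853302254357964258271914149166516689723834302525,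
   123125871650835370031847383534553455104560962744248259056639356209122108110257903105161240155885506859042130957524144459710942475586629636224418502121876117117843366221981291979610538061134522556441637585210330461019178255339571514581120141767352108550175129665]

theorem threeFarFourFour_refuted : refutes threeFarFourFour threeFarFourFour_cert = true := by
  decide +kernel

/-- The complete graph on six vertices without the edge `xu`, where `x` and `u` have degree at most
four. -/
def completeMinusEdge : Config :=
  ⟨[65551, 132881, 268578, 535108, 1062024, 2097392],
  [(0, 1), (0, 2), (0, 3), (0, 4), (5, 1), (5, 2), (5, 3), (5, 4), (1, 2), (1, 3), (1, 4), (2, 3),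
  (2, 4), (3, 4)], [2, 0, 0, 0, 0, 2], []⟩

def completeMinusEdge_cert : List ℕ :=
  [948317429418826970896629290905688766765205355372945097534746173851893927655421779992190750709323931964048190895359565298551935907850857266861930367226957955115204096899666516547539972407277256552601751389922164865030800689985020598234769770278895329933172032632320121633416162393812102677441681456663049870739738018408853326594605289570810378050679549244384061359565716034825078881193063791195362222967236425643625061533009360464010942734032336646665056012109338812222513807159372552496731950416772479749280703740106520197435523549164415614216591787030493124076861593730046309846836849694550077272492991555212704095980860959970371555051363073594676190576600689264234396486511230033475764526400411469643804716915158803486797559829939159812414713547386614869495699531350188397953745174651756727373535682273677963927489832449100277170573344488701644040384866885586321487,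
   966394338687726389587569454904985348528561433410293161632282285874105610613026163804843465357072747170548327333290459294948585661287423465751617829073034099195132925878844814297497770091108937038191209015496438254913799008188794757193986682642590620378083085815585370827450146289315296776887161609427021737463454477905145337291345984929030247988154529392927921477570335308443985032411922513341681821335873013834690729518952174688907310689229278679242814497316019717045331385908743290148686350584823250517783872728291033667927914891814896731772833378260239754748897370993604191460457950172568040054579033128495872781681495901284513539132635862275634909817732476074567731252338150982904252779165907247130791325525193994647377939454284279412709488805709001175019905964967739439324879650866632242497842997715396984685159536561778316316360851292676008684077851415934273358,
   1261003643342711684465238923060386361170230849344179901144376780364288754069153773756587610567621962658726548543878004046901235254541891378704242415791922556378771347226735191160183045037409011517925639611382418987352726962191925302744309004460550648519974704997857504474784514067954623241032688244014357957753982798437774500414780013873835022902975082928905600109195355092788179978754742382738228271025841812901689511280406042501781317522104684806104959957332779551450484555600717046211183882675740638582019991274073470153767663603949837067005856846]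

theorem completeMinusEdge_refuted : refutes completeMinusEdge completeMinusEdge_cert = true := by
  decide +kernel
end Kempe

namespace Kempe

theorem Config.Embeds.of_list {G : SimpleGraph V} {D : Config} (hG : Critical 6 G) (l : List V)
    (d : V) (hl : l.length = D.masks.length) (hnd : l.Nodup)
    (hadj : ∀ e ∈ D.edges, G.Adj (l.getD e.1 d) (l.getD e.2 d))
    (hs : ∀ q ∈ l.zip D.slack, deg G q.1 + q.2 ≤ 6) : D.Embeds G fun w => l.getD w d := by
  refine ⟨fun w hw w' hw' h => ?_, fun e he => ?_, fun w hw => ?_⟩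
  · rw [← hl] at hw hw'
    simp only [List.getD_eq_getElem _ _ hw, List.getD_eq_getElem _ _ hw'] at h
    exact (hnd.getElem_inj_iff).1 h
  · rw [Config.fst, Config.snd, List.getD_eq_getElem _ _ he]
    exact hadj _ (List.getElem_mem he)
  · rw [← hl] at hw
    simp only [List.getD_eq_getElem _ _ hw]
    by_cases h : w < D.slack.length
    · rw [List.getD_eq_getElem _ _ h]
      exact hs (l[w], D.slack[w]) (by
        rw [List.mem_iff_getElem]
        exact ⟨w, by simp [hw, h], by simp⟩)
    · rw [List.getD_eq_default _ _ (not_lt.1 h)]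
      exact hG.deg_le _

theorem Config.not_embeds_list [Fintype V] {G : SimpleGraph V} {D : Config} {st : List ℕ}
    (h : refutes D st = true) (hV : D.Valid) (hD : D.exempt = []) (hG : Critical 6 G) (x : V)
    (l : List V) (hl : (x :: l).length = D.masks.length) (hnd : (x :: l).Nodup)
    (hadj : ∀ e ∈ D.edges, G.Adj ((x :: l).getD e.1 x) ((x :: l).getD e.2 x))
    (hs : ∀ q ∈ (x :: l).zip D.slack, deg G q.1 + q.2 ≤ 6) : False :=
  Config.not_embeds h hV hD hG _ (Config.Embeds.of_list hG _ x hl hnd hadj hs)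

variable [Fintype V] {G : SimpleGraph V}

theorem Critical.no_pathTwoFour (hG : Critical 6 G) {x y w u : V}
    (hnd : [x, y, w, u].Nodup) (hx : deg G x ≤ 2) (hu : deg G u ≤ 4)
    (axy : G.Adj x y) (ayw : G.Adj y w) (awu : G.Adj w u) : False :=
  Config.not_embeds_list pathTwoFour_refuted (by decide +kernel) rfl hG _ _ rfl hnd
    (by simp only [pathTwoFour, List.forall_mem_cons]; exact ⟨axy, ayw, awu, by simp⟩)
    (by simp only [pathTwoFour, List.forall_mem_cons, List.zip_cons_cons]; exact
      ⟨Nat.add_le_add_right hx 4, hG.deg_le _, hG.deg_le _, Nat.add_le_add_right hu 2, by simp⟩)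

theorem Critical.no_triangleTailTwo (hG : Critical 6 G) {x y z w y' x' : V}
    (hnd : [x, y, z, w, y', x'].Nodup) (hx : deg G x ≤ 2) (hX : deg G x' ≤ 2)
    (axy : G.Adj x y) (axz : G.Adj x z) (ayz : G.Adj y z) (ayw : G.Adj y w) (awY : G.Adj w y')
      (aYX : G.Adj y' x') : False :=
  Config.not_embeds_list triangleTailTwo_refuted (by decide +kernel) rfl hG _ _ rfl hnd
    (by simp only [triangleTailTwo, List.forall_mem_cons]; exact
      ⟨axy, axz, ayz, ayw, awY, aYX, by simp⟩)
    (by simp only [triangleTailTwo, List.forall_mem_cons, List.zip_cons_cons]; exact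
      ⟨Nat.add_le_add_right hx 4, hG.deg_le _, hG.deg_le _, hG.deg_le _, hG.deg_le _,
      Nat.add_le_add_right hX 4, by simp⟩)

theorem Critical.no_squaresTwoTwo (hG : Critical 6 G) {x y z w y' u z' : V}
    (hnd : [x, y, z, w, y', u, z'].Nodup) (hx : deg G x ≤ 2) (hu : deg G u ≤ 2)
    (axy : G.Adj x y) (axz : G.Adj x z) (ayw : G.Adj y w) (azw : G.Adj z w) (awY : G.Adj w y')
      (awZ : G.Adj w z') (aYu : G.Adj y' u) (auZ : G.Adj u z') : False :=
  Config.not_embeds_list squaresTwoTwo_refuted (by decide +kernel) rfl hG _ _ rfl hnd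
    (by simp only [squaresTwoTwo, List.forall_mem_cons]; exact
      ⟨axy, axz, ayw, azw, awY, awZ, aYu, auZ, by simp⟩)
    (by simp only [squaresTwoTwo, List.forall_mem_cons, List.zip_cons_cons]; exact
      ⟨Nat.add_le_add_right hx 4, hG.deg_le _, hG.deg_le _, hG.deg_le _, hG.deg_le _,
      Nat.add_le_add_right hu 4, hG.deg_le _, by simp⟩)

theorem Critical.no_pathFourFourFive (hG : Critical 6 G) {x x' z u : V}
    (hnd : [x, x', z, u].Nodup) (hx : deg G x ≤ 4) (hX : deg G x' ≤ 4) (hu : deg G u ≤ 5)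
    (axX : G.Adj x x') (axz : G.Adj x z) (azu : G.Adj z u) : False :=
  Config.not_embeds_list pathFourFourFive_refuted (by decide +kernel) rfl hG _ _ rfl hnd
    (by simp only [pathFourFourFive, List.forall_mem_cons]; exact ⟨axX, axz, azu, by simp⟩)
    (by simp only [pathFourFourFive, List.forall_mem_cons, List.zip_cons_cons]; exact
      ⟨Nat.add_le_add_right hx 2, Nat.add_le_add_right hX 2, hG.deg_le _, Nat.add_le_add_right hu 1,
      by simp⟩)

theorem Critical.no_pathFourFourFour (hG : Critical 6 G) {x x' z w u : V}
    (hnd : [x, x', z, w, u].Nodup) (hx : deg G x ≤ 4) (hX : deg G x' ≤ 4) (hu : deg G u ≤ 4)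
    (axX : G.Adj x x') (axz : G.Adj x z) (azw : G.Adj z w) (awu : G.Adj w u) : False :=
  Config.not_embeds_list pathFourFourFour_refuted (by decide +kernel) rfl hG _ _ rfl hnd
    (by simp only [pathFourFourFour, List.forall_mem_cons]; exact ⟨axX, axz, azw, awu, by simp⟩)
    (by simp only [pathFourFourFour, List.forall_mem_cons, List.zip_cons_cons]; exact
      ⟨Nat.add_le_add_right hx 2, Nat.add_le_add_right hX 2, hG.deg_le _, hG.deg_le _,
      Nat.add_le_add_right hu 2, by simp⟩)

theorem Critical.no_threeFiveFarFour (hG : Critical 6 G) {x y z t w u : V}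
    (hnd : [x, y, z, t, w, u].Nodup) (hx : deg G x ≤ 3) (hy : deg G y ≤ 5) (hu : deg G u ≤ 4)
    (axy : G.Adj x y) (axz : G.Adj x z) (axt : G.Adj x t) (azw : G.Adj z w) (awu : G.Adj w u) :
      False :=
  Config.not_embeds_list threeFiveFarFour_refuted (by decide +kernel) rfl hG _ _ rfl hnd
    (by simp only [threeFiveFarFour, List.forall_mem_cons]; exact
      ⟨axy, axz, axt, azw, awu, by simp⟩)
    (by simp only [threeFiveFarFour, List.forall_mem_cons, List.zip_cons_cons]; exact
      ⟨Nat.add_le_add_right hx 3, Nat.add_le_add_right hy 1, hG.deg_le _, hG.deg_le _, hG.deg_le _,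
      Nat.add_le_add_right hu 2, by simp⟩)

theorem Critical.no_threeFiveFour (hG : Critical 6 G) {x y z u : V}
    (hnd : [x, y, z, u].Nodup) (hx : deg G x ≤ 3) (hy : deg G y ≤ 5) (hu : deg G u ≤ 4)
    (axy : G.Adj x y) (axz : G.Adj x z) (azu : G.Adj z u) : False :=
  Config.not_embeds_list threeFiveFour_refuted (by decide +kernel) rfl hG _ _ rfl hnd
    (by simp only [threeFiveFour, List.forall_mem_cons]; exact ⟨axy, axz, azu, by simp⟩)
    (by simp only [threeFiveFour, List.forall_mem_cons, List.zip_cons_cons]; exact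
      ⟨Nat.add_le_add_right hx 3, Nat.add_le_add_right hy 1, hG.deg_le _, Nat.add_le_add_right hu 2,
      by simp⟩)

theorem Critical.no_threeFourFour (hG : Critical 6 G) {x y z t u w : V}
    (hnd : [x, y, z, t, u, w].Nodup) (hx : deg G x ≤ 3) (hu : deg G u ≤ 4) (hw : deg G w ≤ 4)
    (axy : G.Adj x y) (axz : G.Adj x z) (axt : G.Adj x t) (ayu : G.Adj y u) (azw : G.Adj z w) :
      False :=
  Config.not_embeds_list threeFourFour_refuted (by decide +kernel) rfl hG _ _ rfl hnd
    (by simp only [threeFourFour, List.forall_mem_cons]; exact ⟨axy, axz, axt, ayu, azw, by simp⟩)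
    (by simp only [threeFourFour, List.forall_mem_cons, List.zip_cons_cons]; exact
      ⟨Nat.add_le_add_right hx 3, hG.deg_le _, hG.deg_le _, hG.deg_le _, Nat.add_le_add_right hu 2,
      Nat.add_le_add_right hw 2, by simp⟩)

theorem Critical.no_threeSquareFour (hG : Critical 6 G) {x y z t u : V}
    (hnd : [x, y, z, t, u].Nodup) (hx : deg G x ≤ 3) (hu : deg G u ≤ 4)
    (axy : G.Adj x y) (axz : G.Adj x z) (axt : G.Adj x t) (ayu : G.Adj y u) (azu : G.Adj z u) :
      False :=
  Config.not_embeds_list threeSquareFour_refuted (by decide +kernel) rfl hG _ _ rfl hnd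
    (by simp only [threeSquareFour, List.forall_mem_cons]; exact ⟨axy, axz, axt, ayu, azu, by simp⟩)
    (by simp only [threeSquareFour, List.forall_mem_cons, List.zip_cons_cons]; exact
      ⟨Nat.add_le_add_right hx 3, hG.deg_le _, hG.deg_le _, hG.deg_le _, Nat.add_le_add_right hu 2,
      by simp⟩)

theorem Critical.no_fourFiveFiveFour (hG : Critical 6 G) {x y z t u : V}
    (hnd : [x, y, z, t, u].Nodup) (hx : deg G x ≤ 4) (hy : deg G y ≤ 5) (hz : deg G z ≤ 5)
      (hu : deg G u ≤ 4)
    (axy : G.Adj x y) (axz : G.Adj x z) (axt : G.Adj x t) (atu : G.Adj t u) : False :=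
  Config.not_embeds_list fourFiveFiveFour_refuted (by decide +kernel) rfl hG _ _ rfl hnd
    (by simp only [fourFiveFiveFour, List.forall_mem_cons]; exact ⟨axy, axz, axt, atu, by simp⟩)
    (by simp only [fourFiveFiveFour, List.forall_mem_cons, List.zip_cons_cons]; exact
      ⟨Nat.add_le_add_right hx 2, Nat.add_le_add_right hy 1, Nat.add_le_add_right hz 1, hG.deg_le _,
      Nat.add_le_add_right hu 2, by simp⟩)

theorem Critical.no_fourFiveFourFour (hG : Critical 6 G) {x y z t s u w : V}
    (hnd : [x, y, z, t, s, u, w].Nodup) (hx : deg G x ≤ 4) (hy : deg G y ≤ 5) (hu : deg G u ≤ 4)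
      (hw : deg G w ≤ 4)
    (axy : G.Adj x y) (axz : G.Adj x z) (axt : G.Adj x t) (axs : G.Adj x s) (azu : G.Adj z u)
      (atw : G.Adj t w) : False :=
  Config.not_embeds_list fourFiveFourFour_refuted (by decide +kernel) rfl hG _ _ rfl hnd
    (by simp only [fourFiveFourFour, List.forall_mem_cons]; exact
      ⟨axy, axz, axt, axs, azu, atw, by simp⟩)
    (by simp only [fourFiveFourFour, List.forall_mem_cons, List.zip_cons_cons]; exact
      ⟨Nat.add_le_add_right hx 2, Nat.add_le_add_right hy 1, hG.deg_le _, hG.deg_le _, hG.deg_le _,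
      Nat.add_le_add_right hu 2, Nat.add_le_add_right hw 2, by simp⟩)

theorem Critical.no_fourFiveSquareFour (hG : Critical 6 G) {x y z t s u : V}
    (hnd : [x, y, z, t, s, u].Nodup) (hx : deg G x ≤ 4) (hy : deg G y ≤ 5) (hu : deg G u ≤ 4)
    (axy : G.Adj x y) (axz : G.Adj x z) (axt : G.Adj x t) (axs : G.Adj x s) (azu : G.Adj z u)
      (atu : G.Adj t u) : False :=
  Config.not_embeds_list fourFiveSquareFour_refuted (by decide +kernel) rfl hG _ _ rfl hnd
    (by simp only [fourFiveSquareFour, List.forall_mem_cons]; exact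
      ⟨axy, axz, axt, axs, azu, atu, by simp⟩)
    (by simp only [fourFiveSquareFour, List.forall_mem_cons, List.zip_cons_cons]; exact
      ⟨Nat.add_le_add_right hx 2, Nat.add_le_add_right hy 1, hG.deg_le _, hG.deg_le _, hG.deg_le _,
      Nat.add_le_add_right hu 2, by simp⟩)

theorem Critical.no_squareFourFour (hG : Critical 6 G) {x y z u v : V}
    (hnd : [x, y, z, u, v].Nodup) (hx : deg G x ≤ 4) (hu : deg G u ≤ 4) (hv : deg G v ≤ 4)
    (axy : G.Adj x y) (axz : G.Adj x z) (ayu : G.Adj y u) (ayv : G.Adj y v) (azu : G.Adj z u) :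
      False :=
  Config.not_embeds_list squareFourFour_refuted (by decide +kernel) rfl hG _ _ rfl hnd
    (by simp only [squareFourFour, List.forall_mem_cons]; exact ⟨axy, axz, ayu, ayv, azu, by simp⟩)
    (by simp only [squareFourFour, List.forall_mem_cons, List.zip_cons_cons]; exact
      ⟨Nat.add_le_add_right hx 2, hG.deg_le _, hG.deg_le _, Nat.add_le_add_right hu 2,
      Nat.add_le_add_right hv 2, by simp⟩)

theorem Critical.no_threeSquareThree (hG : Critical 6 G) {x y z t v u v' : V}
    (hnd : [x, y, z, t, v, u, v'].Nodup) (hx : deg G x ≤ 3) (hu : deg G u ≤ 3)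
    (axy : G.Adj x y) (axz : G.Adj x z) (axt : G.Adj x t) (ayv : G.Adj y v) (avu : G.Adj v u)
      (ayV : G.Adj y v') (aVu : G.Adj v' u) : False :=
  Config.not_embeds_list threeSquareThree_refuted (by decide +kernel) rfl hG _ _ rfl hnd
    (by simp only [threeSquareThree, List.forall_mem_cons]; exact
      ⟨axy, axz, axt, ayv, avu, ayV, aVu, by simp⟩)
    (by simp only [threeSquareThree, List.forall_mem_cons, List.zip_cons_cons]; exact
      ⟨Nat.add_le_add_right hx 3, hG.deg_le _, hG.deg_le _, hG.deg_le _, hG.deg_le _,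
      Nat.add_le_add_right hu 3, hG.deg_le _, by simp⟩)

theorem Critical.no_triangleSquareThree (hG : Critical 6 G) {x y z t p a : V}
    (hnd : [x, y, z, t, p, a].Nodup) (hx : deg G x ≤ 3) (hp : deg G p ≤ 3)
    (axy : G.Adj x y) (axz : G.Adj x z) (axt : G.Adj x t) (atp : G.Adj t p) (ayt : G.Adj y t)
      (aya : G.Adj y a) (aap : G.Adj a p) : False :=
  Config.not_embeds_list triangleSquareThree_refuted (by decide +kernel) rfl hG _ _ rfl hnd
    (by simp only [triangleSquareThree, List.forall_mem_cons]; exact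
      ⟨axy, axz, axt, atp, ayt, aya, aap, by simp⟩)
    (by simp only [triangleSquareThree, List.forall_mem_cons, List.zip_cons_cons]; exact
      ⟨Nat.add_le_add_right hx 3, hG.deg_le _, hG.deg_le _, hG.deg_le _, Nat.add_le_add_right hp 3,
      hG.deg_le _, by simp⟩)

theorem Critical.no_triangleSquaresFour (hG : Critical 6 G) {x y z t p a b : V}
    (hnd : [x, y, z, t, p, a, b].Nodup) (hx : deg G x ≤ 3) (hp : deg G p ≤ 4)
    (axy : G.Adj x y) (axz : G.Adj x z) (axt : G.Adj x t) (atp : G.Adj t p) (ayt : G.Adj y t)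
      (aya : G.Adj y a) (aap : G.Adj a p) (ayb : G.Adj y b) (abp : G.Adj b p) : False :=
  Config.not_embeds_list triangleSquaresFour_refuted (by decide +kernel) rfl hG _ _ rfl hnd
    (by simp only [triangleSquaresFour, List.forall_mem_cons]; exact
      ⟨axy, axz, axt, atp, ayt, aya, aap, ayb, abp, by simp⟩)
    (by simp only [triangleSquaresFour, List.forall_mem_cons, List.zip_cons_cons]; exact
      ⟨Nat.add_le_add_right hx 3, hG.deg_le _, hG.deg_le _, hG.deg_le _, Nat.add_le_add_right hp 2,
      hG.deg_le _, hG.deg_le _, by simp⟩)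

theorem Critical.no_fourFiveFiveFarFour (hG : Critical 6 G) {x y z t s w u : V}
    (hnd : [x, y, z, t, s, w, u].Nodup) (hx : deg G x ≤ 4) (hy : deg G y ≤ 5) (hz : deg G z ≤ 5)
      (hu : deg G u ≤ 4)
    (axy : G.Adj x y) (axz : G.Adj x z) (axt : G.Adj x t) (axs : G.Adj x s) (atw : G.Adj t w)
      (awu : G.Adj w u) : False :=
  Config.not_embeds_list fourFiveFiveFarFour_refuted (by decide +kernel) rfl hG _ _ rfl hnd
    (by simp only [fourFiveFiveFarFour, List.forall_mem_cons]; exact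
      ⟨axy, axz, axt, axs, atw, awu, by simp⟩)
    (by simp only [fourFiveFiveFarFour, List.forall_mem_cons, List.zip_cons_cons]; exact
      ⟨Nat.add_le_add_right hx 2, Nat.add_le_add_right hy 1, Nat.add_le_add_right hz 1, hG.deg_le _,
      hG.deg_le _, hG.deg_le _, Nat.add_le_add_right hu 2, by simp⟩)

theorem Critical.no_fourFourFiveFive (hG : Critical 6 G) {x y z t s u v w : V}
    (hnd : [x, y, z, t, s, u, v, w].Nodup) (hx : deg G x ≤ 4) (hu : deg G u ≤ 4) (hv : deg G v ≤ 5)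
      (hw : deg G w ≤ 5)
    (axy : G.Adj x y) (axz : G.Adj x z) (axt : G.Adj x t) (axs : G.Adj x s) (ayu : G.Adj y u)
      (ayv : G.Adj y v) (azw : G.Adj z w) : False :=
  Config.not_embeds_list fourFourFiveFive_refuted (by decide +kernel) rfl hG _ _ rfl hnd
    (by simp only [fourFourFiveFive, List.forall_mem_cons]; exact
      ⟨axy, axz, axt, axs, ayu, ayv, azw, by simp⟩)
    (by simp only [fourFourFiveFive, List.forall_mem_cons, List.zip_cons_cons]; exact
      ⟨Nat.add_le_add_right hx 2, hG.deg_le _, hG.deg_le _, hG.deg_le _, hG.deg_le _,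
      Nat.add_le_add_right hu 2, Nat.add_le_add_right hv 1, Nat.add_le_add_right hw 1, by simp⟩)

theorem Critical.no_completeMinusEdge (hG : Critical 6 G) {x y z s t u : V}
    (hnd : [x, y, z, s, t, u].Nodup) (hx : deg G x ≤ 4) (hu : deg G u ≤ 4)
    (axy : G.Adj x y) (axz : G.Adj x z) (axs : G.Adj x s) (axt : G.Adj x t) (auy : G.Adj u y)
      (auz : G.Adj u z) (aus : G.Adj u s) (aut : G.Adj u t) (ayz : G.Adj y z) (ays : G.Adj y s)
      (ayt : G.Adj y t) (azs : G.Adj z s) (azt : G.Adj z t) (ast : G.Adj s t) : False :=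
  Config.not_embeds_list completeMinusEdge_refuted (by decide +kernel) rfl hG _ _ rfl hnd
    (by simp only [completeMinusEdge, List.forall_mem_cons]; exact
      ⟨axy, axz, axs, axt, auy, auz, aus, aut, ayz, ays, ayt, azs, azt, ast, by simp⟩)
    (by simp only [completeMinusEdge, List.forall_mem_cons, List.zip_cons_cons]; exact
      ⟨Nat.add_le_add_right hx 2, hG.deg_le _, hG.deg_le _, hG.deg_le _, hG.deg_le _,
      Nat.add_le_add_right hu 2, by simp⟩)

/-- For a fixed coloring without `xy`,
  a color of `yv` other than the color of `xt` is impossible. -/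
theorem Critical.color_eq (hG : Critical 6 G) {x y z t p v u : V}
    (hnd : [x, y, z, t, p, v, u].Nodup) (hx : deg G x ≤ 3) (hp : deg G p ≤ 4) (hu : deg G u ≤ 4)
    (axy : G.Adj x y) (axz : G.Adj x z) (axt : G.Adj x t) (atp : G.Adj t p) (ayv : G.Adj y v)
    (avu : G.Adj v u) {c : V → V → Option (Fin 6)}
    (hc : IsColoring (G.deleteEdges {s(x, y)}) c) : ∃ k, c y v = some k ∧ c x t = some k := by
  obtain ⟨l, hl, h⟩ := Config.exempt_of_refutes threeFarFourFour_refuted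
    (by decide +kernel) hG.uncolorable
    (Config.Embeds.of_list hG [x, y, z, t, p, v, u] x rfl hnd
    (by simp only [threeFarFourFour, List.forall_mem_cons]; exact
      ⟨axy, axz, axt, atp, ayv, avu, by simp⟩)
    (by simp only [threeFarFourFour, List.forall_mem_cons, List.zip_cons_cons]; exact
      ⟨Nat.add_le_add_right hx 3, hG.deg_le _,
      hG.deg_le _, hG.deg_le _, Nat.add_le_add_right hp 2, hG.deg_le _, Nat.add_le_add_right hu 2,
        by simp⟩)) hc
  simp only [threeFarFourFour, List.mem_singleton] at hl
  subst hl
  obtain ⟨k, h1, h2⟩ := h _ (List.mem_singleton_self _)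
  rw [Config.holds_edge (by simp)] at h1 h2
  exact ⟨k, h1.2, h2.2⟩

end Kempe

namespace Kempe

section Charge
open Classical

variable [Fintype V] {G : SimpleGraph V}

/-- Neighbors of degree at most four. -/
noncomputable def low (G : SimpleGraph V) (v : V) : Finset V := {w | G.Adj v w ∧ deg G w ≤ 4}

/-- Neighbors of degree six. -/
noncomputable def top (G : SimpleGraph V) (v : V) : Finset V := {w | G.Adj v w ∧ deg G w = 6}

/-- All vertices of degree at most four. -/
noncomputable def lows (G : SimpleGraph V) : Finset V := {w | deg G w ≤ 4}

/-- All vertices of degree six. -/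
noncomputable def tops (G : SimpleGraph V) : Finset V := {w | deg G w = 6}

@[simp] theorem mem_low {v w : V} : w ∈ low G v ↔ G.Adj v w ∧ deg G w ≤ 4 := by simp [low]

@[simp] theorem mem_top {v w : V} : w ∈ top G v ↔ G.Adj v w ∧ deg G w = 6 := by simp [top]

@[simp] theorem mem_lows {w : V} : w ∈ lows G ↔ deg G w ≤ 4 := by simp [lows]

@[simp] theorem mem_tops {w : V} : w ∈ tops G ↔ deg G w = 6 := by simp [tops]

theorem deg_eq_card (v : V) : deg G v = (Finset.univ.filter (G.Adj v)).card := by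
  rw [deg, ← Set.ncard_coe_finset]
  congr 1
  ext w
  simp

/-- The charge of a vertex `x` of small degree when the vertices of degree six distribute their
excess evenly. -/
noncomputable def charge (G : SimpleGraph V) (x : V) : ℚ :=
  ∑ v ∈ top G x, 1 / ((low G v).card : ℚ) - (5 - deg G x)

/-- The amount by which the degree sum exceeds five times the number of vertices. -/
noncomputable def excess (G : SimpleGraph V) : ℚ := ∑ v : V, ((deg G v : ℚ) - 5)

/-- The part of the excess of `v` which is not sent to vertices outside `U`. -/
noncomputable def share (G : SimpleGraph V) (U : Finset V) (v : V) : ℚ :=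
  1 - ((low G v \ U).card : ℚ) / (low G v).card

theorem share_nonneg (U : Finset V) (v : V) : 0 ≤ share G U v := by
  rw [share, sub_nonneg]
  exact div_le_one_of_le₀ (by exact_mod_cast Finset.card_le_card Finset.sdiff_subset) (by simp)

theorem share_eq_one {U : Finset V} {v : V} (h : low G v ⊆ U) : share G U v = 1 := by
  rw [share, Finset.sdiff_eq_empty_iff_subset.2 h]
  simp

theorem excess_eq (hd : ∀ v, deg G v ≤ 6) {U : Finset V} (hU : U ⊆ lows G) :
    excess G = ∑ v ∈ tops G, share G U v - ∑ x ∈ U, (5 - (deg G x : ℚ)) +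
      ∑ x ∈ lows G \ U, charge G x := by
  have h1 : excess G = (tops G).card - ∑ x ∈ lows G, (5 - (deg G x : ℚ)) := by
    rw [excess, Finset.card_eq_sum_ones, Nat.cast_sum, tops, lows, Finset.sum_filter,
      Finset.sum_filter, ← Finset.sum_sub_distrib]
    refine Finset.sum_congr rfl fun v _ => ?_
    have := hd v
    generalize deg G v = d at this
    interval_cases d <;> norm_num
  have h2 : ∑ x ∈ lows G \ U, ∑ v ∈ top G x, 1 / ((low G v).card : ℚ) =
      ∑ v ∈ tops G, ((low G v \ U).card : ℚ) / (low G v).card := by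
    rw [Finset.sum_comm' (t' := tops G) (s' := fun v => low G v \ U)]
    · refine Finset.sum_congr rfl fun v _ => ?_
      rw [Finset.sum_const, nsmul_eq_mul, mul_one_div]
    · intro x v
      simp only [Finset.mem_sdiff, mem_lows, mem_top, mem_low, mem_tops, G.adj_comm x v]
      tauto
  have h3 := Finset.sum_sdiff (f := fun x => 5 - (deg G x : ℚ)) hU
  simp only [share, charge, Finset.sum_sub_distrib, Finset.sum_const, nsmul_eq_mul, mul_one] at *
  rw [h2, h1]
  linarith

theorem le_excess (hd : ∀ v, deg G v ≤ 6) {U S : Finset V} (hU : U ⊆ lows G) (hS : S ⊆ tops G)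
    (h : ∀ v ∈ S, low G v ⊆ U) :
    (S.card : ℚ) - ∑ x ∈ U, (5 - (deg G x : ℚ)) + ∑ x ∈ lows G \ U, charge G x ≤ excess G := by
  rw [excess_eq hd hU]
  have : (S.card : ℚ) ≤ ∑ v ∈ tops G, share G U v := by
    rw [Finset.card_eq_sum_ones, Nat.cast_sum]
    calc _ = ∑ v ∈ S, share G U v :=
          Finset.sum_congr rfl fun v hv => by rw [share_eq_one (h v hv), Nat.cast_one]
      _ ≤ _ := Finset.sum_le_sum_of_subset_of_nonneg hS fun v _ _ => share_nonneg U v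
  linarith

theorem five_mul_card_add_three_le (h : 2 < excess G) :
    5 * Fintype.card V + 3 ≤ 2 * G.edgeSet.ncard := by
  have h1 : ∑ v, deg G v = 2 * G.edgeSet.ncard := by
    rw [← coe_edgeFinset, Set.ncard_coe_finset, ← G.sum_degrees_eq_twice_card_edges]
    refine Finset.sum_congr rfl fun v _ => ?_
    rw [deg_eq_card, ← card_neighborFinset_eq_degree]
    congr 1
    ext w
    simp
  have h2 : excess G = 2 * G.edgeSet.ncard - 5 * Fintype.card V := by
    rw [excess, Finset.sum_sub_distrib, ← Nat.cast_sum, h1]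
    simp [mul_comm]
  rw [h2] at h
  have : (5 * Fintype.card V + 2 : ℚ) < 2 * G.edgeSet.ncard := by linarith
  have : 5 * Fintype.card V + 2 < 2 * G.edgeSet.ncard := by exact_mod_cast this
  omega

namespace Critical

variable (hG : Critical 6 G)
include hG

theorem card_top_sdiff {x y : V} (h : G.Adj x y) : 7 ≤ deg G x + (top G y \ {x}).card := by
  have := hG.adjacency h
  convert this
  rw [← Set.ncard_coe_finset]
  congr 1
  ext w
  simp
  tauto

theorem card_top {x y : V} (h : G.Adj x y) : 7 ≤ deg G x + (top G y).card :=
  (hG.card_top_sdiff h).trans (by gcongr; exact Finset.sdiff_subset)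

theorem eight_le {x y : V} (h : G.Adj x y) : 8 ≤ deg G x + deg G y := by
  have h1 := hG.card_top_sdiff h
  have h2 : (insert x (top G y \ {x})).card ≤ deg G y := by
    rw [deg_eq_card]
    refine Finset.card_le_card fun w hw => ?_
    simp only [Finset.mem_insert, Finset.mem_sdiff, mem_top] at hw
    simp only [Finset.mem_filter, Finset.mem_univ, true_and]
    rcases hw with rfl | hw
    · exact h.symm
    · exact hw.1.1
  rw [Finset.card_insert_of_notMem (by simp)] at h2
  omega

theorem two_le_deg (v : V) : 2 ≤ deg G v := by
  obtain ⟨w, h⟩ := hG.exists_adj v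
  have := hG.eight_le h
  have := hG.deg_le w
  omega

theorem card_low_lt {x y : V} (h : G.Adj x y) : (low G y).card < deg G x := by
  have h1 := hG.card_top h
  have h2 : (low G y ∪ top G y).card ≤ deg G y := by
    rw [deg_eq_card]
    refine Finset.card_le_card fun w hw => ?_
    simp only [Finset.mem_union, mem_low, mem_top] at hw
    simp only [Finset.mem_filter, Finset.mem_univ, true_and]
    tauto
  rw [Finset.card_union_of_disjoint (Finset.disjoint_left.2 fun w => by
    simp only [mem_low, mem_top]
    omega)] at h2
  have := hG.deg_le y
  omega

end Critical

end Charge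

end Kempe

namespace Kempe

section Discharging
open Classical

variable [Fintype V] {G : SimpleGraph V}

theorem exists_adj_notMem {x : V} {S : Finset V} (h : S.card < deg G x) :
    ∃ t, G.Adj x t ∧ t ∉ S := by
  rw [deg_eq_card] at h
  obtain ⟨t, ht, h'⟩ := Finset.exists_mem_notMem_of_card_lt_card h
  exact ⟨t, by simpa using ht, h'⟩

theorem deg_le_card_top_add {x : V} {S : Finset V} (h : ∀ w, G.Adj x w → w ∉ S → deg G w = 6) :
    deg G x ≤ (top G x).card + S.card := by
  rw [deg_eq_card]
  refine (Finset.card_le_card fun w hw => ?_).trans (Finset.card_union_le _ _)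
  have hw : G.Adj x w := by simpa using hw
  by_cases hS : w ∈ S
  · exact Finset.mem_union_right _ hS
  · exact Finset.mem_union_left _ (mem_top.2 ⟨hw, h w hw hS⟩)

/-- Neighbors of `x` of degree six all of whose other neighbors have degree at least five. -/
noncomputable def clean (G : SimpleGraph V) (x : V) : Finset V := {v ∈ top G x | low G v ⊆ {x}}

@[simp] theorem mem_clean {x v : V} :
    v ∈ clean G x ↔ (G.Adj x v ∧ deg G v = 6) ∧ ∀ u, G.Adj v u → deg G u ≤ 4 → u = x := by
  simp [clean, Finset.subset_iff]

theorem clean_subset (x : V) : clean G x ⊆ top G x := Finset.filter_subset _ _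

theorem mem_clean_of_forall {x v : V} (hv : v ∈ top G x)
    (h : ∀ u, u ≠ x → G.Adj v u → deg G u ≤ 4 → False) : v ∈ clean G x :=
  mem_clean.2 ⟨mem_top.1 hv, fun u h1 h2 => by_contra fun h3 => h u h3 h1 h2⟩

theorem exists_of_notMem_clean {x v : V} (hv : v ∈ top G x) (h : v ∉ clean G x) :
    ∃ u, u ≠ x ∧ G.Adj v u ∧ deg G u ≤ 4 := by
  by_contra! h'
  exact h (mem_clean_of_forall hv fun u h1 h2 h3 => by have := h' u h1 h2; omega)

theorem le_card_clean {x : V} {n m : ℕ} (hn : n + m ≤ (top G x).card)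
    (h : (top G x \ clean G x).card ≤ m) : n ≤ (clean G x).card := by
  have := Finset.card_sdiff_add_card_eq_card (clean_subset (G := G) x)
  omega

theorem le_charge {x : V} (hx : deg G x ≤ 4) {b c n : ℕ}
    (hb : ∀ v ∈ top G x, (low G v).card ≤ b) (hb0 : 0 < b)
    (hc : c ≤ (clean G x).card) (hn : n ≤ (top G x).card) :
    (c : ℚ) + (n - c) / b - (5 - deg G x) ≤ charge G x := by
  have hb1 : (1 : ℚ) ≤ b := by exact_mod_cast hb0
  have hc' : (c : ℚ) ≤ (clean G x).card := by exact_mod_cast hc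
  have hn' : (n : ℚ) ≤ (top G x).card := by exact_mod_cast hn
  have hpos : ∀ v ∈ top G x, 0 < (low G v).card := fun v hv =>
    Finset.card_pos.2 ⟨x, mem_low.2 ⟨(mem_top.1 hv).1.symm, hx⟩⟩
  have h1 : ((clean G x).card : ℚ) ≤ ∑ v ∈ clean G x, 1 / ((low G v).card : ℚ) := by
    rw [Finset.card_eq_sum_ones, Nat.cast_sum]
    refine Finset.sum_le_sum fun v hv => ?_
    have h2 := Finset.card_le_card (Finset.mem_filter.1 hv).2
    have h3 := hpos v (clean_subset x hv)
    rw [Finset.card_singleton] at h2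
    rw [show (low G v).card = 1 by omega]
    simp
  have h2 : ((top G x \ clean G x).card : ℚ) * (1 / b) ≤
      ∑ v ∈ top G x \ clean G x, 1 / ((low G v).card : ℚ) := by
    rw [← nsmul_eq_mul]
    refine Finset.card_nsmul_le_sum _ _ _ fun v hv => ?_
    have hv := (Finset.mem_sdiff.1 hv).1
    exact one_div_le_one_div_of_le (by exact_mod_cast hpos v hv) (by exact_mod_cast hb v hv)
  have h3 : ((top G x \ clean G x).card : ℚ) + (clean G x).card = (top G x).card := by
    exact_mod_cast Finset.card_sdiff_add_card_eq_card (clean_subset x)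
  have h4 := Finset.sum_sdiff (f := fun v => 1 / ((low G v).card : ℚ)) (clean_subset (G := G) x)
  rw [charge, ← h4]
  have h5 : (n - c : ℚ) / b + c ≤ (top G x \ clean G x).card * (1 / b) + (clean G x).card := by
    rw [eq_sub_of_add_eq h3]
    have : (0 : ℚ) ≤ 1 - 1 / b := by
      rw [sub_nonneg]
      exact div_le_one_of_le₀ hb1 (by positivity)
    have e1 : (n - c : ℚ) / b + c = n * (1 / b) + c * (1 - 1 / b) := by ring
    have e2 : ((top G x).card - (clean G x).card : ℚ) * (1 / b) + (clean G x).card =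
      (top G x).card * (1 / b) + (clean G x).card * (1 - 1 / b) := by ring
    rw [e1, e2]
    gcongr
  linarith

namespace Critical

variable (hG : Critical 6 G)
include hG

theorem card_low_le {x v : V} (hv : v ∈ top G x) : (low G v).card ≤ deg G x - 1 := by
  have := hG.card_low_lt (mem_top.1 hv).1
  omega

theorem mem_clean_of_le_five {x y z : V} (hx : deg G x ≤ 3) (hxy : G.Adj x y) (hy : deg G y ≤ 5)
    (hz : z ∈ top G x) : z ∈ clean G x := by
  refine mem_clean_of_forall hz fun u h1 h2 h3 => ?_
  have := hG.eight_le hxy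
  obtain ⟨h4, h5⟩ := mem_top.1 hz
  refine hG.no_threeFiveFour (x := x) (y := y) (z := z) (u := u) ?_ hx hy h3 hxy h4 h2
  simp
  grind (splits := 40) [SimpleGraph.irrefl]

theorem card_not_clean_le_one {x : V} (hx : deg G x = 3) :
    (top G x \ clean G x).card ≤ 1 := by
  refine Finset.card_le_one.2 fun y hy z hz => by_contra fun hyz => ?_
  rw [Finset.mem_sdiff] at hy hz
  obtain ⟨u, h1, h2, h3⟩ := exists_of_notMem_clean hy.1 hy.2
  obtain ⟨w, h4, h5, h6⟩ := exists_of_notMem_clean hz.1 hz.2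
  obtain ⟨⟨h7, h8⟩, -⟩ := And.imp_left mem_top.1 hy
  obtain ⟨⟨h9, h10⟩, -⟩ := And.imp_left mem_top.1 hz
  obtain ⟨t, ht, ht'⟩ := exists_adj_notMem (G := G) (x := x) (S := {y, z})
    (by have := Finset.card_le_two (a := y) (b := z); omega)
  simp only [Finset.mem_insert, Finset.mem_singleton, not_or] at ht'
  have := hG.eight_le ht
  by_cases huw : u = w
  · subst huw
    refine hG.no_threeSquareFour (x := x) (y := y) (z := z) (t := t) (u := u)
      ?_ hx.le h3 h7 h9 ht h2 h5
    simp
    grind (splits := 40) [SimpleGraph.irrefl]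
  · refine hG.no_threeFourFour (x := x) (y := y) (z := z) (t := t) (u := u) (w := w)
      ?_ hx.le h3 h6 h7 h9 ht
      h2 h5
    simp
    grind (splits := 40) [SimpleGraph.irrefl]

theorem half_le_charge {x : V} (hx : deg G x = 3) (h : ∀ w, G.Adj x w → deg G w = 6) :
    1 / 2 ≤ charge G x := by
  have h1 := deg_le_card_top_add (x := x) (S := ∅) fun w hw _ => h w hw
  have h2 := le_charge (G := G) (x := x) (by omega) (b := 2) (c := 2) (n := 3)
    (fun v hv => (hG.card_low_le hv).trans (by omega)) (by simp)
    (le_card_clean (m := 1) (by simpa [hx] using h1) (hG.card_not_clean_le_one hx))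
    (by simpa [hx] using h1)
  rw [hx] at h2
  norm_num at h2
  linarith

theorem charge_nonneg_of_deg_eq_three {x : V} (hx : deg G x = 3) : 0 ≤ charge G x := by
  by_cases h : ∀ w, G.Adj x w → deg G w = 6
  · have := hG.half_le_charge hx h
    linarith
  push Not at h
  obtain ⟨y, hy, h6⟩ := h
  have hy5 : deg G y ≤ 5 := by have := hG.deg_le y; omega
  have h1 := hG.card_top hy.symm
  have h2 : top G x \ clean G x = ∅ :=
    Finset.sdiff_eq_empty_iff_subset.2 fun z hz => hG.mem_clean_of_le_five hx.le hy hy5 hz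
  have h3 := le_charge (G := G) (x := x) (by omega) (b := 2) (c := 2) (n := 2)
    (fun v hv => (hG.card_low_le hv).trans (by omega)) (by simp)
    (le_card_clean (m := 0) (by omega) (by simp [h2])) (by omega)
  rw [hx] at h3
  norm_num at h3
  linarith

theorem charge_of_adj {x x' : V} (hx : deg G x = 4) (hx' : deg G x' = 4) (h : G.Adj x x') :
    0 ≤ charge G x := by
  have h1 := hG.card_top h.symm
  have h2 := le_charge (G := G) (x := x) (by omega) (b := 2) (c := 0) (n := 3)
    (fun z hz => ?_) (by simp) (by simp) (by omega)
  · rw [hx] at h2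
    norm_num at h2
    linarith
  · refine (Finset.card_le_card (t := {x, x'}) fun u hu => ?_).trans Finset.card_le_two
    simp only [Finset.mem_insert, Finset.mem_singleton]
    by_contra! hne
    rw [mem_top] at hz
    rw [mem_low] at hu
    refine hG.no_pathFourFourFive (x := x) (x' := x') (z := z) (u := u) ?_ hx.le hx'.le
      (by omega) h hz.1 hu.1
    simp
    grind (splits := 40) [SimpleGraph.irrefl]

theorem mem_clean_of_two {x y z t : V} (hx : deg G x = 4) (hy : G.Adj x y) (hz : G.Adj x z)
    (hyz : y ≠ z) (hy5 : deg G y = 5) (hz5 : deg G z = 5) (ht : t ∈ top G x) : t ∈ clean G x := by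
  refine mem_clean_of_forall ht fun u h1 h2 h3 => ?_
  rw [mem_top] at ht
  refine hG.no_fourFiveFiveFour (x := x) (y := y) (z := z) (t := t) (u := u)
    ?_ hx.le hy5.le hz5.le h3 hy hz
    ht.1 h2
  simp
  grind (splits := 40) [SimpleGraph.irrefl]

theorem one_le_charge_of_two {x y z : V} (hx : deg G x = 4) (hy : G.Adj x y) (hz : G.Adj x z)
    (hyz : y ≠ z) (hy5 : deg G y = 5) (hz5 : deg G z = 5) : 1 ≤ charge G x := by
  have h1 := hG.card_top hy.symm
  have h2 : top G x \ clean G x = ∅ :=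
    Finset.sdiff_eq_empty_iff_subset.2 fun t ht => hG.mem_clean_of_two hx hy hz hyz hy5 hz5 ht
  have h3 := le_charge (G := G) (x := x) (by omega) (b := 3) (c := 2) (n := 2)
    (fun v hv => (hG.card_low_le hv).trans (by omega)) (by simp)
    (le_card_clean (m := 0) (by omega) (by simp [h2])) (by omega)
  rw [hx] at h3
  norm_num at h3
  linarith

theorem card_not_clean_le_one_of_adj {x y : V} (hx : deg G x = 4) (hy : G.Adj x y)
    (hy5 : deg G y = 5) (h : ∀ w, G.Adj x w → w ≠ y → deg G w = 6) :
    (top G x \ clean G x).card ≤ 1 := by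
  refine Finset.card_le_one.2 fun z hz t ht => by_contra fun hzt => ?_
  rw [Finset.mem_sdiff] at hz ht
  obtain ⟨u, h1, h2, h3⟩ := exists_of_notMem_clean hz.1 hz.2
  obtain ⟨w, h4, h5, h6⟩ := exists_of_notMem_clean ht.1 ht.2
  obtain ⟨⟨h7, h8⟩, -⟩ := And.imp_left mem_top.1 hz
  obtain ⟨⟨h9, h10⟩, -⟩ := And.imp_left mem_top.1 ht
  obtain ⟨s, hs, hs'⟩ := exists_adj_notMem (G := G) (x := x) (S := {y, z, t})
    (by have := Finset.card_le_three (a := y) (b := z) (c := t); omega)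
  simp only [Finset.mem_insert, Finset.mem_singleton, not_or] at hs'
  have := h s hs hs'.1
  by_cases huw : u = w
  · subst huw
    refine hG.no_fourFiveSquareFour (x := x) (y := y) (z := z) (t := t) (s := s) (u := u)
      ?_ hx.le hy5.le h3 hy h7
      h9 hs h2 h5
    simp
    grind (splits := 40) [SimpleGraph.irrefl]
  · refine hG.no_fourFiveFourFour (x := x) (y := y) (z := z) (t := t) (s := s) (u := u) (w := w)
      ?_ hx.le hy5.le
      h3 h6 hy h7 h9 hs h2 h5
    simp
    grind (splits := 40) [SimpleGraph.irrefl]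

theorem four_div_three_le_charge {x y : V} (hx : deg G x = 4) (hy : G.Adj x y)
    (hy5 : deg G y = 5) (h : ∀ w, G.Adj x w → w ≠ y → deg G w = 6) : 4 / 3 ≤ charge G x := by
  have h1 := deg_le_card_top_add (x := x) (S := {y}) fun w hw h' => h w hw (by simpa using h')
  rw [Finset.card_singleton] at h1
  have h2 := le_charge (G := G) (x := x) (by omega) (b := 3) (c := 2) (n := 3)
    (fun v hv => (hG.card_low_le hv).trans (by omega)) (by simp)
    (le_card_clean (m := 1) (by omega) (hG.card_not_clean_le_one_of_adj hx hy hy5 h))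
    (by omega)
  rw [hx] at h2
  norm_num at h2
  linarith

/-- If some neighbor `y` of a vertex `x` of degree four has two further neighbors of small degree,
then all neighbors of `x` other than `y` are clean. -/
theorem mem_clean_of_card_low {x y z : V} (hx : deg G x = 4) (h : ∀ w, G.Adj x w → deg G w = 6)
    (hy : G.Adj x y) (hlow : 3 ≤ (low G y).card) (hz : G.Adj x z) (hzy : z ≠ y) :
    z ∈ clean G x := by
  refine mem_clean_of_forall (mem_top.2 ⟨hz, h z hz⟩) fun w h1 h2 h3 => ?_
  have hy6 := h y hy
  have hz6 := h z hz
  have key : ∃ u v, u ≠ x ∧ v ≠ x ∧ u ≠ v ∧ u ∈ low G y ∧ v ∈ low G y := by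
    have : 1 < (low G y \ {x}).card := by
      have := Finset.le_card_sdiff {x} (low G y)
      rw [Finset.card_singleton] at this
      omega
    obtain ⟨u, hu, v, hv, huv⟩ := Finset.one_lt_card.1 this
    simp only [Finset.mem_sdiff, Finset.mem_singleton] at hu hv
    exact ⟨u, v, hu.2, hv.2, huv, hu.1, hv.1⟩
  obtain ⟨u, v, hu, hv, huv, hu', hv'⟩ := key
  rw [mem_low] at hu' hv'
  obtain ⟨t, ht, ht'⟩ := exists_adj_notMem (G := G) (x := x) (S := {y, z})
    (by have := Finset.card_le_two (a := y) (b := z); omega)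
  obtain ⟨s, hs, hs'⟩ := exists_adj_notMem (G := G) (x := x) (S := {y, z, t})
    (by have := Finset.card_le_three (a := y) (b := z) (c := t); omega)
  simp only [Finset.mem_insert, Finset.mem_singleton, not_or] at hs' ht'
  have ht6 := h t ht
  have hs6 := h s hs
  by_cases huw : w = u
  · subst huw
    refine hG.no_squareFourFour (x := x) (y := y) (z := z) (u := w) (v := v)
      ?_ hx.le h3 hv'.2 hy hz hu'.1
      hv'.1 h2
    simp
    grind (splits := 40) [SimpleGraph.irrefl]
  by_cases hvw : w = v
  · subst hvw
    refine hG.no_squareFourFour (x := x) (y := y) (z := z) (u := w) (v := u)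
      ?_ hx.le h3 hu'.2 hy hz hv'.1
      hu'.1 h2
    simp
    grind (splits := 40) [SimpleGraph.irrefl]
  · refine hG.no_fourFourFiveFive (x := x) (y := y) (z := z) (t := t) (s := s) (u := u) (v := v)
      (w := w)
      ?_ hx.le hu'.2 (by omega) (by omega) hy hz ht hs hu'.1 hv'.1 h2
    simp
    grind (splits := 40) [SimpleGraph.irrefl]

theorem one_le_charge {x : V} (hx : deg G x = 4) (h : ∀ w, G.Adj x w → deg G w = 6) :
    1 ≤ charge G x := by
  have h1 := deg_le_card_top_add (x := x) (S := ∅) fun w hw _ => h w hw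
  rw [Finset.card_empty] at h1
  by_cases h2 : ∀ y ∈ top G x, (low G y).card ≤ 2
  · have h3 := le_charge (G := G) (x := x) (by omega) (b := 2) (c := 0) (n := 4)
      h2 (by simp) (by simp) (by omega)
    rw [hx] at h3
    norm_num at h3
    linarith
  · push Not at h2
    obtain ⟨y, hy, hlow⟩ := h2
    have h3 : (top G x \ clean G x).card ≤ 1 := by
      rw [← Finset.card_singleton y]
      refine Finset.card_le_card fun z hz => ?_
      simp only [Finset.mem_sdiff, Finset.mem_singleton] at hz ⊢
      by_contra hzy
      exact hz.2 (hG.mem_clean_of_card_low hx h (mem_top.1 hy).1 hlow (mem_top.1 hz.1).1 hzy)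
    have h4 := le_charge (G := G) (x := x) (by omega) (b := 3) (c := 3) (n := 4)
      (fun v hv => (hG.card_low_le hv).trans (by omega)) (by simp)
      (le_card_clean (m := 1) (by omega) h3) (by omega)
    rw [hx] at h4
    norm_num at h4
    linarith

theorem charge_nonneg {x : V} (h3 : 3 ≤ deg G x) (h4 : deg G x ≤ 4) : 0 ≤ charge G x := by
  rcases (show deg G x = 3 ∨ deg G x = 4 by omega) with hx | hx
  · exact hG.charge_nonneg_of_deg_eq_three hx
  by_cases h5 : ∃ x', G.Adj x x' ∧ deg G x' ≤ 4
  · obtain ⟨x', h, h'⟩ := h5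
    have := hG.eight_le h
    exact hG.charge_of_adj hx (by omega) h
  push Not at h5
  by_cases h6 : ∀ w, G.Adj x w → deg G w = 6
  · exact zero_le_one.trans (hG.one_le_charge hx h6)
  push Not at h6
  obtain ⟨y, hy, hy6⟩ := h6
  have hy5 : deg G y = 5 := by have := hG.deg_le y; have := h5 y hy; omega
  by_cases h7 : ∀ w, G.Adj x w → w ≠ y → deg G w = 6
  · exact le_trans (by norm_num) (hG.four_div_three_le_charge hx hy hy5 h7)
  push Not at h7
  obtain ⟨z, hz, hzy, hz6⟩ := h7
  exact zero_le_one.trans (hG.one_le_charge_of_two hx hy hz (Ne.symm hzy) hy5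
    (by have := hG.deg_le z; have := h5 z hz; omega))

end Critical
end Discharging
end Kempe

namespace Kempe
section Discharging2
open Classical
variable [Fintype V] {G : SimpleGraph V}
namespace Critical
variable (hG : Critical 6 G)
include hG

theorem two_lt_excess_of_neighborhood (h3 : ∀ v, 3 ≤ deg G v) {U : Finset V} {z : V} {d : ℕ}
    (hU : U ⊆ lows G) (hd : ∑ x ∈ U, (5 - (deg G x : ℚ)) ≤ d) (hz : deg G z = 6)
    (hc : d + 2 ≤ (top G z).card) (hlow : ∀ w, w = z ∨ w ∈ top G z → ∀ u, u ∉ U → G.Adj w u →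
      deg G u ≤ 4 → False) : 2 < excess G := by
  have h := le_excess hG.deg_le hU (S := insert z (top G z)) (fun w hw => by
    rw [Finset.mem_insert, mem_top] at hw
    rw [mem_tops]
    rcases hw with rfl | hw
    · exact hz
    · exact hw.2) fun w hw u hu => by_contra fun hn => by
    rw [mem_low] at hu
    exact hlow w (Finset.mem_insert.1 hw) u hn hu.1 hu.2
  have h' := Finset.sum_nonneg fun x (hx : x ∈ lows G \ U) =>
    hG.charge_nonneg (h3 x) (mem_lows.1 (Finset.mem_sdiff.1 hx).1)
  rw [Finset.card_insert_of_notMem (by simp)] at h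
  have hc' : ((d + 2 : ℕ) : ℚ) ≤ (top G z).card := by exact_mod_cast hc
  push_cast at h hc'
  linarith

theorem two_lt_excess_of_adj (h3 : ∀ v, 3 ≤ deg G v) {x x' : V} (hx : deg G x ≤ 4)
    (hx' : deg G x' ≤ 4) (h : G.Adj x x') : 2 < excess G := by
  have h8 := hG.eight_le h
  have h1 := hG.card_top h.symm
  obtain ⟨z, hz⟩ := Finset.card_pos.1 (show 0 < (top G x).card by omega)
  rw [mem_top] at hz
  have hzlow : ∀ u, u ∉ ({x, x'} : Finset V) → G.Adj z u → deg G u ≤ 5 → False := by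
    intro u hu h4 h5
    simp only [Finset.mem_insert, Finset.mem_singleton, not_or] at hu
    refine hG.no_pathFourFourFive (x := x) (x' := x') (z := z) (u := u) ?_ hx hx' h5 h hz.1 h4
    simp
    grind (splits := 40) [SimpleGraph.irrefl]
  have h2 := deg_le_card_top_add (x := z) (S := {x, x'}) fun w hw hw' => by
    have := hG.deg_le w
    by_contra hw6
    exact hzlow w hw' hw (by omega)
  have := Finset.card_le_two (a := x) (b := x')
  refine hG.two_lt_excess_of_neighborhood h3 (U := {x, x'}) (d := 2) ?_ ?_ hz.2 (by omega) ?_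
  · simp [Finset.insert_subset_iff, hx, hx']
  · rw [Finset.sum_pair h.ne, show deg G x = 4 by omega, show deg G x' = 4 by omega]
    norm_num
  · rintro w (rfl | hw) u hu h4 h5
    · exact hzlow u hu h4 (by omega)
    · rw [mem_top] at hw
      simp only [Finset.mem_insert, Finset.mem_singleton, not_or] at hu
      refine hG.no_pathFourFourFour (x := x) (x' := x') (z := z) (w := w) (u := u)
        ?_ hx hx' h5 h hz.1 hw.1 h4
      simp
      grind (splits := 40) [SimpleGraph.irrefl]

theorem two_lt_excess_of_adj_five (h3 : ∀ v, 3 ≤ deg G v) {x y : V} (hx : deg G x = 3)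
    (hy : G.Adj x y) (hy5 : deg G y ≤ 5) : 2 < excess G := by
  have h1 := hG.card_top hy.symm
  obtain ⟨z, hz⟩ := Finset.card_pos.1 (show 0 < (top G x).card by omega)
  have hz' := mem_top.1 hz
  have h2 := hG.card_top hz'.1
  have hcl : ∀ w ∈ top G x, ∀ u, u ∉ ({x} : Finset V) → G.Adj w u → deg G u ≤ 4 → False :=
    fun w hw u hu h4 h5 => hu (Finset.mem_singleton.2
      ((mem_clean.1 (hG.mem_clean_of_le_five hx.le hy hy5 hw)).2 u h4 h5))
  refine hG.two_lt_excess_of_neighborhood h3 (U := {x}) (d := 2) ?_ ?_ hz'.2 (by omega) ?_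
  · simp [hx]
  · rw [Finset.sum_singleton, hx]
    norm_num
  · rintro w (rfl | hw) u hu h4 h5
    · exact hcl w hz u hu h4 h5
    · by_cases hwx : w ∈ top G x
      · exact hcl w hwx u hu h4 h5
      rw [mem_top] at hw hwx
      obtain ⟨t, ht, ht'⟩ := exists_adj_notMem (G := G) (x := x) (S := {y, z})
        (by have := Finset.card_le_two (a := y) (b := z); omega)
      simp only [Finset.mem_insert, Finset.mem_singleton, not_or] at ht' hu
      have := hG.eight_le ht
      have := hG.eight_le hy
      refine hG.no_threeFiveFarFour (x := x) (y := y) (z := z) (t := t) (w := w) (u := u)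
        ?_ hx.le hy5 h5 hy
        hz'.1 ht hw.1 h4
      simp
      grind (splits := 40) [SimpleGraph.irrefl]

theorem two_lt_excess_of_two_five (h3 : ∀ v, 3 ≤ deg G v)
    (hB : ∀ x x', G.Adj x x' → deg G x ≤ 4 → 5 ≤ deg G x') {x y z : V} (hx : deg G x = 4)
    (hy : G.Adj x y) (hz : G.Adj x z) (hyz : y ≠ z) (hy5 : deg G y = 5) (hz5 : deg G z = 5) :
    2 < excess G := by
  have h1 := hG.card_top hy.symm
  obtain ⟨t, ht⟩ := Finset.card_pos.1 (show 0 < (top G x).card by omega)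
  have ht' := mem_top.1 ht
  have h2 := hG.card_top ht'.1
  have hcl : ∀ w ∈ top G x, ∀ u, u ∉ ({x} : Finset V) → G.Adj w u → deg G u ≤ 4 → False :=
    fun w hw u hu h4 h5 => hu (Finset.mem_singleton.2
      ((mem_clean.1 (hG.mem_clean_of_two hx hy hz hyz hy5 hz5 hw)).2 u h4 h5))
  refine hG.two_lt_excess_of_neighborhood h3 (U := {x}) (d := 1) ?_ ?_ ht'.2 (by omega) ?_
  · simp [hx]
  · rw [Finset.sum_singleton, hx]
    norm_num
  · rintro w (rfl | hw) u hu h4 h5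
    · exact hcl w ht u hu h4 h5
    · by_cases hwx : w ∈ top G x
      · exact hcl w hwx u hu h4 h5
      rw [mem_top] at hw hwx
      obtain ⟨s, hs, hs'⟩ := exists_adj_notMem (G := G) (x := x) (S := {y, z, t})
        (by have := Finset.card_le_three (a := y) (b := z) (c := t); omega)
      simp only [Finset.mem_insert, Finset.mem_singleton, not_or] at hs' hu
      have := hB x s hs hx.le
      refine hG.no_fourFiveFiveFarFour (x := x) (y := y) (z := z) (t := t) (s := s) (w := w)
        (u := u) ?_ hx.le
        hy5.le hz5.le h5 hy hz ht'.1 hs hw.1 h4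
      simp
      grind (splits := 40) [SimpleGraph.irrefl]

end Critical
end Discharging2
end Kempe

namespace Kempe
section Discharging3
open Classical
variable [Fintype V] {G : SimpleGraph V}

/-- All vertices of degree two. -/
noncomputable def twos (G : SimpleGraph V) : Finset V := {x | deg G x = 2}

/-- All vertices of degree six without neighbors of small degree. -/
noncomputable def free (G : SimpleGraph V) : Finset V := {v ∈ tops G | low G v = ∅}

@[simp] theorem mem_twos {x : V} : x ∈ twos G ↔ deg G x = 2 := by simp [twos]

@[simp] theorem mem_free {v : V} : v ∈ free G ↔ deg G v = 6 ∧ low G v = ∅ := by simp [free]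

namespace Critical
variable (hG : Critical 6 G)
include hG

theorem mem_top_of_two {x y : V} (hx : deg G x = 2) (h : G.Adj x y) : y ∈ top G x := by
  have := hG.eight_le h
  have := hG.deg_le y
  exact mem_top.2 ⟨h, by omega⟩

theorem card_top_of_two {x : V} (hx : deg G x = 2) : (top G x).card = 2 := by
  rw [← hx, deg_eq_card]
  congr 1
  ext y
  simp only [mem_top, Finset.mem_filter, Finset.mem_univ, true_and]
  exact ⟨And.left, fun h => mem_top.1 (hG.mem_top_of_two hx h)⟩

theorem low_of_two {x y : V} (hx : deg G x = 2) (h : y ∈ top G x) : low G y = {x} := by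
  have h' := mem_top.1 h
  have h1 := hG.card_low_lt h'.1
  refine (Finset.eq_of_subset_of_card_le (s := {x}) ?_ (by rw [Finset.card_singleton]; omega)).symm
  simp [h'.1.symm, hx]

theorem neg_one_le_charge {x : V} (hx : deg G x = 2) : -1 ≤ charge G x := by
  have h1 := hG.card_top_of_two hx
  have h2 := le_charge (G := G) (x := x) (by omega) (b := 1) (c := 2) (n := 2)
    (fun v hv => (hG.card_low_le hv).trans (by omega)) (by simp)
    (le_card_clean (m := 0) (by omega) (le_of_eq (Finset.card_eq_zero.2
      (Finset.sdiff_eq_empty_iff_subset.2 fun v hv => mem_clean_of_forall hv fun u h1 h2 h3 =>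
        h1 (Finset.mem_singleton.1 (hG.low_of_two hx hv ▸ mem_low.2 ⟨h2, h3⟩))))))
    (by omega)
  rw [hx] at h2
  norm_num at h2
  linarith

theorem mem_free_of_two {x y w : V} (hx : deg G x = 2) (hy : y ∈ top G x) (hw : w ∈ top G y)
    (hwx : w ∉ top G x) : w ∈ free G := by
  have hy' := mem_top.1 hy
  have hw' := mem_top.1 hw
  refine mem_free.2 ⟨hw'.2, Finset.eq_empty_of_forall_notMem fun u hu => ?_⟩
  rw [mem_low] at hu
  have hux : ¬u = x := fun h => hwx (mem_top.2 ⟨h ▸ hu.1.symm, hw'.2⟩)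
  refine hG.no_pathTwoFour (x := x) (y := y) (w := w) (u := u) ?_ hx.le hu.2 hy'.1 hw'.1 hu.1
  simp
  grind (splits := 40) [SimpleGraph.irrefl]

theorem card_free_sub_card_twos_le : ((free G).card : ℚ) - (twos G).card ≤ excess G := by
  have h := le_excess hG.deg_le (U := ∅) (S := free G) (by simp) (Finset.filter_subset _ _)
    fun v hv => by simp [(mem_free.1 hv).2]
  have h1 : ∑ x ∈ lows G, (if deg G x = 2 then (-1 : ℚ) else 0) ≤ ∑ x ∈ lows G, charge G x := by
    refine Finset.sum_le_sum fun x hx => ?_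
    have := hG.two_le_deg x
    split_ifs with h2
    · exact hG.neg_one_le_charge h2
    · exact hG.charge_nonneg (by omega) (mem_lows.1 hx)
  rw [← Finset.sum_filter, Finset.sum_const, nsmul_eq_mul] at h1
  have h2 : (lows G).filter (deg G · = 2) = twos G := by
    ext x
    simp only [Finset.mem_filter, mem_lows, mem_twos]
    omega
  rw [h2] at h1
  simp only [Finset.sdiff_empty, Finset.sum_empty, sub_zero] at h
  linarith

theorem five_le_card {x y : V} (hx : deg G x = 2) (hy : y ∈ top G x) :
    5 ≤ (top G y ∩ free G).card + (top G y ∩ top G x).card := by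
  have h1 := hG.card_top (mem_top.1 hy).1
  have h2 : top G y ⊆ (top G y ∩ free G) ∪ (top G y ∩ top G x) := fun w hw => by
    by_cases hwx : w ∈ top G x
    · simp [-mem_top, hw, hwx]
    · simp [-mem_top, -mem_free, hw, hG.mem_free_of_two hx hy hw hwx]
  have h3 := (Finset.card_le_card h2).trans (Finset.card_union_le _ _)
  omega

theorem four_le_card {x y : V} (hx : deg G x = 2) (hy : y ∈ top G x) :
    4 ≤ (top G y ∩ free G).card := by
  have h1 := hG.five_le_card hx hy
  have h2 : top G y ∩ top G x ⊆ (top G x).erase y := fun w hw => by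
    rw [Finset.mem_inter] at hw
    exact Finset.mem_erase.2 ⟨(mem_top.1 hw.1).1.ne', hw.2⟩
  have h3 := Finset.card_le_card h2
  rw [Finset.card_erase_of_mem hy, hG.card_top_of_two hx] at h3
  omega

omit hG in
theorem sum_card_inter (x : V) : ∑ w ∈ free G, (top G w ∩ top G x).card =
    ∑ y ∈ top G x, (top G y ∩ free G).card := by
  simp only [Finset.card_eq_sum_ones]
  refine Finset.sum_comm' fun w y => ?_
  simp only [Finset.mem_inter, mem_free, mem_top, G.adj_comm w y]
  tauto

theorem eight_le_sum {x : V} (hx : deg G x = 2) :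
    8 ≤ ∑ w ∈ free G, (top G w ∩ top G x).card := by
  rw [sum_card_inter]
  have h := Finset.card_nsmul_le_sum _ _ _ fun y hy => hG.four_le_card hx hy
  rwa [hG.card_top_of_two hx] at h

theorem ten_le_sum {x : V} (hx : deg G x = 2)
    (h : ∀ y z, G.Adj x y → G.Adj x z → G.Adj y z → False) :
    10 ≤ ∑ w ∈ free G, (top G w ∩ top G x).card := by
  rw [sum_card_inter]
  have h := Finset.card_nsmul_le_sum (top G x) (fun y => (top G y ∩ free G).card) 5 fun y hy => by
    have h1 := hG.five_le_card hx hy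
    rwa [show top G y ∩ top G x = ∅ from Finset.eq_empty_of_forall_notMem fun z hz => by
      simp only [Finset.mem_inter, mem_top] at hz hy
      exact h y z hy.1 hz.2.1 hz.1.1, Finset.card_empty] at h1
  rwa [hG.card_top_of_two hx] at h

theorem sum_twos_le_six (w : V) : ∑ x ∈ twos G, (top G w ∩ top G x).card ≤ 6 := by
  rw [← Finset.card_biUnion fun x hx x' hx' hne => Finset.disjoint_left.2 fun y hy hy' => hne ?_]
  · refine (Finset.card_le_card (t := top G w) fun y hy => ?_).trans ?_
    · simp only [Finset.mem_biUnion, Finset.mem_inter] at hy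
      exact hy.choose_spec.2.1
    · refine le_trans ?_ (hG.deg_le w)
      rw [deg_eq_card]
      exact Finset.card_le_card fun y hy => by simpa using (mem_top.1 hy).1
  · rw [← Finset.singleton_inj, ← hG.low_of_two (mem_twos.1 hx) (Finset.mem_inter.1 hy).2,
      ← hG.low_of_two (mem_twos.1 hx') (Finset.mem_inter.1 hy').2]

theorem sum_twos_le_card_add_one {w : V} (hw : deg G w = 6) :
    ∑ x ∈ twos G, (top G w ∩ top G x).card ≤ (twos G).card + 1 := by
  have h2 : ∀ x ∈ twos G, (top G w ∩ top G x).card ≤ 2 := fun x hx =>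
    (Finset.card_le_card Finset.inter_subset_right).trans (hG.card_top_of_two (mem_twos.1 hx)).le
  have h1 : ((twos G).filter fun x => (top G w ∩ top G x).card = 2).card ≤ 1 := by
    refine Finset.card_le_one.2 fun x hx u hu => by_contra fun hxu => ?_
    rw [Finset.mem_filter] at hx hu
    obtain ⟨y, z, hyz, h⟩ := Finset.card_eq_two.1 hx.2
    obtain ⟨y', z', hyz', h'⟩ := Finset.card_eq_two.1 hu.2
    have hy : y ∈ top G w ∩ top G x := by simp [h]
    have hz : z ∈ top G w ∩ top G x := by simp [h]
    have hy' : y' ∈ top G w ∩ top G u := by simp [h']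
    have hz' : z' ∈ top G w ∩ top G u := by simp [h']
    rw [Finset.mem_inter] at hy hz hy' hz'
    have e1 := hG.low_of_two (mem_twos.1 hx.1) hy.2
    have e2 := hG.low_of_two (mem_twos.1 hx.1) hz.2
    have e3 := hG.low_of_two (mem_twos.1 hu.1) hy'.2
    have e4 := hG.low_of_two (mem_twos.1 hu.1) hz'.2
    have f (a b : V) (ha : low G a = {x}) (hb : low G b = {u}) : a ≠ b := by
      rintro rfl
      exact hxu (Finset.singleton_inj.1 (ha.symm.trans hb))
    have f1 := f _ _ e1 e3
    have f2 := f _ _ e1 e4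
    have f3 := f _ _ e2 e3
    have f4 := f _ _ e2 e4
    simp only [mem_top, mem_twos] at hx hu hy hz hy' hz'
    refine hG.no_squaresTwoTwo (x := x) (y := y) (z := z) (w := w) (y' := y') (u := u) (z' := z')
      ?_ hx.1.le
      hu.1.le hy.2.1 hz.2.1 hy.1.1.symm hz.1.1.symm hy'.1.1 hz'.1.1 hy'.2.1.symm hz'.2.1
    clear e1 e2 e3 e4 f h h' h2
    simp
    grind (splits := 40) [SimpleGraph.irrefl]
  rw [Finset.card_filter] at h1
  have h3 : ∑ x ∈ twos G, (top G w ∩ top G x).card ≤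
      ∑ x ∈ twos G, (1 + if (top G w ∩ top G x).card = 2 then 1 else 0) :=
    Finset.sum_le_sum fun x hx => by
      have := h2 x hx
      split_ifs <;> omega
  rw [Finset.sum_add_distrib, ← Finset.card_eq_sum_ones] at h3
  omega

theorem two_lt_excess_of_twos {x₀ : V} (hx₀ : deg G x₀ = 2) : 2 < excess G := by
  refine lt_of_lt_of_le ?_ hG.card_free_sub_card_twos_le
  have hm : 1 ≤ (twos G).card := Finset.card_pos.2 ⟨x₀, mem_twos.2 hx₀⟩
  suffices (twos G).card + 3 ≤ (free G).card by
    have : ((twos G).card + 3 : ℚ) ≤ (free G).card := by exact_mod_cast this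
    linarith
  by_cases h : ∃ x y z, deg G x = 2 ∧ G.Adj x y ∧ G.Adj x z ∧ G.Adj y z
  · obtain ⟨x, y, z, hx, hy, hz, hyz⟩ := h
    have hy' := hG.mem_top_of_two hx hy
    have h1 := hG.four_le_card hx hy'
    have h2 : ∀ x' ∈ twos G \ {x}, 8 ≤ ∑ w ∈ free G \ (top G y ∩ free G),
        (top G w ∩ top G x').card := by
      intro x' hx'
      simp only [Finset.mem_sdiff, mem_twos, Finset.mem_singleton] at hx'
      refine (hG.eight_le_sum hx'.1).trans (le_of_eq ?_)
      refine (Finset.sum_subset Finset.sdiff_subset fun w hw hw' => ?_).symm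
      have hw1 : w ∈ top G y := by
        by_contra h3
        exact hw' (Finset.mem_sdiff.2 ⟨hw, fun h4 => h3 (Finset.mem_inter.1 h4).1⟩)
      rw [Finset.card_eq_zero]
      refine Finset.eq_empty_of_forall_notMem fun y' hy' => ?_
      rw [Finset.mem_inter] at hy'
      have e1 := hG.low_of_two hx (hG.mem_top_of_two hx hy)
      have e2 := hG.low_of_two hx (hG.mem_top_of_two hx hz)
      have e3 := hG.low_of_two hx'.1 hy'.2
      have hy6 := (mem_top.1 (hG.mem_top_of_two hx hy)).2
      have hz6 := (mem_top.1 (hG.mem_top_of_two hx hz)).2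
      have f (a b : V) (ha : low G a = {x}) (hb : low G b = {x'}) : a ≠ b := by
        rintro rfl
        exact hx'.2 (Finset.singleton_inj.1 (ha.symm.trans hb)).symm
      have f1 := f _ _ e1 e3
      have f2 := f _ _ e2 e3
      rw [mem_free] at hw
      simp only [mem_top] at hy' hw1
      have f3 : w ≠ z := by
        rintro rfl
        simp [hw.2] at e2
      refine hG.no_triangleTailTwo (x := x) (y := y) (z := z) (w := w) (y' := y') (x' := x')
        ?_ hx.le hx'.1.le
        hy hz hyz hw1.1 hy'.1.1 hy'.2.1.symm
      simp
      grind (splits := 40) [SimpleGraph.irrefl]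
    have h3 := Finset.card_nsmul_le_sum _ _ _ h2
    rw [Finset.sum_comm] at h3
    have h4 := Finset.sum_le_card_nsmul (free G \ (top G y ∩ free G))
      (fun w => ∑ x' ∈ twos G \ {x}, (top G w ∩ top G x').card) 6 fun w _ =>
        (Finset.sum_le_sum_of_subset Finset.sdiff_subset).trans (hG.sum_twos_le_six w)
    have h5 := h3.trans h4
    have h6 := Finset.card_sdiff_add_card_eq_card (Finset.inter_subset_right :
      top G y ∩ free G ⊆ free G)
    have h7 := Finset.card_sdiff_add_card_eq_card (s := {x}) (t := twos G) (by simp [hx])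
    rw [Finset.card_singleton] at h7
    simp only [smul_eq_mul] at h5
    omega
  · push Not at h
    have h1 := Finset.card_nsmul_le_sum (twos G)
      (fun x => ∑ w ∈ free G, (top G w ∩ top G x).card) 10 fun x hx =>
        hG.ten_le_sum (mem_twos.1 hx) fun y z h1 h2 h3 => h x y z (mem_twos.1 hx) h1 h2 h3
    rw [Finset.sum_comm] at h1
    have h2 := h1.trans (Finset.sum_le_card_nsmul _ _ _ fun w _ => hG.sum_twos_le_six w)
    have h3 := h1.trans (Finset.sum_le_card_nsmul _ _ _ fun w hw =>
      hG.sum_twos_le_card_add_one (mem_free.1 hw).1)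
    simp only [smul_eq_mul] at h2 h3
    by_cases h4 : (twos G).card ≤ 4
    · generalize (twos G).card = m at *
      interval_cases m <;> omega
    · omega
end Critical
end Discharging3
end Kempe

namespace Kempe
section Discharging4
open Classical
variable [Fintype V] {G : SimpleGraph V}

/-- Vertices of degree six all of whose neighbors of small degree lie in `U`. -/
noncomputable def good (G : SimpleGraph V) (U : Finset V) : Finset V :=
  {v ∈ tops G | low G v ⊆ U}

@[simp] theorem mem_good {U : Finset V} {v : V} : v ∈ good G U ↔ deg G v = 6 ∧ low G v ⊆ U := by
  simp [good]

theorem card_good_add_le_excess (hd : ∀ v, deg G v ≤ 6) {U B : Finset V} (hU : U ⊆ lows G)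
    (hB : B ⊆ tops G \ good G U) (h : ∀ v ∈ B, 1 / 2 ≤ share G U v) :
    ((good G U).card : ℚ) + B.card / 2 - ∑ x ∈ U, (5 - (deg G x : ℚ)) +
      ∑ x ∈ lows G \ U, charge G x ≤ excess G := by
  have h0 : good G U ⊆ tops G := Finset.filter_subset _ _
  rw [excess_eq hd hU, ← Finset.sum_sdiff h0]
  have h1 : ((good G U).card : ℚ) = ∑ v ∈ good G U, share G U v := by
    rw [Finset.card_eq_sum_ones, Nat.cast_sum]
    exact Finset.sum_congr rfl fun v hv => by rw [share_eq_one (mem_good.1 hv).2, Nat.cast_one]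
  have h2 : (B.card : ℚ) / 2 ≤ ∑ v ∈ tops G \ good G U, share G U v := by
    refine le_trans ?_ (Finset.sum_le_sum_of_subset_of_nonneg hB fun v _ _ => share_nonneg U v)
    have := Finset.card_nsmul_le_sum _ _ _ h
    rw [nsmul_eq_mul] at this
    linarith
  linarith

theorem mem_good_of_clean {x p v : V} (hv : v ∈ clean G x) : v ∈ good G {x, p} := by
  rw [mem_clean] at hv
  refine mem_good.2 ⟨hv.1.2, fun u hu => ?_⟩
  rw [mem_low] at hu
  simp [hv.2 u hu.1 hu.2]

/-- `x` is a vertex of degree three with neighbors `y`, `z`, `t`, and `p` is the only other vertex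
of small degree adjacent to one of these neighbors, namely to `t`. -/
structure Linked (G : SimpleGraph V) (x y z t p : V) : Prop where
  deg_x : deg G x = 3
  deg_p : deg G p ≤ 4
  ne : x ≠ p
  mem_y : y ∈ clean G x
  mem_z : z ∈ clean G x
  mem_t : t ∈ top G x
  yz : y ≠ z
  yt : y ≠ t
  zt : z ≠ t
  low_t : low G t = {x, p}

namespace Linked

variable {x y z t p : V} (h : Linked G x y z t p)
include h

theorem adj_tp : G.Adj t p := by
  have : p ∈ low G t := by simp [h.low_t]
  exact (mem_low.1 this).1

theorem y_good : y ∈ good G {x, p} := mem_good_of_clean h.mem_y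
theorem z_good : z ∈ good G {x, p} := mem_good_of_clean h.mem_z
theorem t_good : t ∈ good G {x, p} := mem_good.2 ⟨(mem_top.1 h.mem_t).2, h.low_t.le⟩

theorem not_adj_of_clean {v : V} (hv : v ∈ clean G x) : ¬G.Adj v p := fun h' =>
  h.ne ((mem_clean.1 hv).2 p h' h.deg_p).symm

theorem pair_subset : {x, p} ⊆ lows G := by
  have := h.deg_x
  have := h.deg_p
  simp only [Finset.insert_subset_iff, Finset.singleton_subset_iff, mem_lows]
  omega

theorem of_mem_erase {a : V} (ha : a ∈ (top G p).erase t) :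
    a ≠ x ∧ a ≠ y ∧ a ≠ z ∧ a ≠ t ∧ a ≠ p ∧ G.Adj a p ∧ deg G a = 6 := by
  rw [Finset.mem_erase, mem_top] at ha
  have hx := h.deg_x
  refine ⟨?_, ?_, ?_, ha.1, ha.2.1.ne', ha.2.1.symm, ha.2.2⟩ <;> rintro rfl
  · omega
  · exact h.not_adj_of_clean h.mem_y ha.2.1.symm
  · exact h.not_adj_of_clean h.mem_z ha.2.1.symm

theorem card_add_le {A : Finset V} (hA : A ⊆ good G {x, p}) (hA' : ∀ a ∈ A, G.Adj a p ∧ a ≠ t) :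
    3 + A.card + ((top G y ∩ good G {x, p}) \ ({z, t} ∪ A)).card ≤ (good G {x, p}).card := by
  have h1 : ({y, z, t} : Finset V).card = 3 := Finset.card_eq_three.2
    ⟨y, z, t, h.yz, h.yt, h.zt, rfl⟩
  have h2 : Disjoint {y, z, t} A := by
    refine Finset.disjoint_left.2 fun v hv hvA => ?_
    have hv' := hA' v hvA
    simp only [Finset.mem_insert, Finset.mem_singleton] at hv
    rcases hv with rfl | rfl | rfl
    · exact h.not_adj_of_clean h.mem_y hv'.1
    · exact h.not_adj_of_clean h.mem_z hv'.1
    · exact hv'.2 rfl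
  rw [← h1, ← Finset.card_union_of_disjoint h2, ← Finset.card_union_of_disjoint]
  · refine Finset.card_le_card fun v hv => ?_
    simp only [Finset.mem_union, Finset.mem_insert, Finset.mem_singleton, Finset.mem_sdiff,
      Finset.mem_inter] at hv
    rcases hv with ((rfl | rfl | rfl) | hv) | hv
    exacts [h.y_good, h.z_good, h.t_good, hA hv, hv.1.2]
  · refine Finset.disjoint_left.2 fun v hv hv' => ?_
    simp only [Finset.mem_union, Finset.mem_insert, Finset.mem_singleton, Finset.mem_sdiff,
      Finset.mem_inter, mem_top] at hv hv'
    rcases hv with (rfl | hv) | hv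
    · exact G.irrefl hv'.1.1.1
    · exact hv'.2 (Or.inl hv)
    · exact hv'.2 (Or.inr hv)

variable (hG : Critical 6 G)
include hG

theorem four_le_card_or (hc : ∀ u, deg G u ≤ 4 → 1 / 2 ≤ charge G u) :
    4 ≤ (top G y ∩ good G {x, p}).card ∨ 3 ≤ (top G y ∩ good G {x, p}).card ∧
      1 / 2 ≤ ∑ u ∈ lows G \ {x, p}, charge G u := by
  have hy := mem_clean.1 h.mem_y
  have hz := mem_clean.1 h.mem_z
  have ht := mem_top.1 h.mem_t
  have h4 := hG.card_top hy.1.1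
  rw [h.deg_x] at h4
  have hex : ∀ v ∈ top G y \ good G {x, p}, ∃ u, u ≠ x ∧ u ≠ p ∧ G.Adj v u ∧ deg G u ≤ 4 := by
    intro v hv
    by_contra! hn
    rw [Finset.mem_sdiff] at hv
    refine hv.2 (mem_good.2 ⟨(mem_top.1 hv.1).2, fun u hu => ?_⟩)
    rw [mem_low] at hu
    by_contra hu'
    simp only [Finset.mem_insert, Finset.mem_singleton, not_or] at hu'
    have := hn u hu'.1 hu'.2 hu.1
    omega
  obtain ⟨c, hcol⟩ := hG.colorable hy.1.1
  have hkey : ∀ v ∈ top G y \ good G {x, p}, ∃ k, c y v = some k ∧ c x t = some k := by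
    intro v hv
    obtain ⟨u, h1, h2, h3, h5⟩ := hex v hv
    rw [Finset.mem_sdiff, mem_top] at hv
    have hzv : ¬z = v := fun e => hv.2 (e ▸ h.z_good)
    have htv : ¬t = v := fun e => hv.2 (e ▸ h.t_good)
    refine hG.color_eq (x := x) (y := y) (z := z) (t := t) (p := p) (v := v) (u := u) ?_ h.deg_x.le
      h.deg_p h5 hy.1.1 hz.1.1 ht.1 h.adj_tp hv.1.1 h3 hcol
    have := h.deg_p
    have := h.deg_x
    have := h.yz
    have := h.yt
    have := h.zt
    have := h.ne
    simp
    grind (splits := 40) [SimpleGraph.irrefl]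
  have hle : (top G y \ good G {x, p}).card ≤ 1 := by
    refine Finset.card_le_one.2 fun v hv v' hv' => ?_
    obtain ⟨k, h1, h2⟩ := hkey v hv
    obtain ⟨k', h3, h5⟩ := hkey v' hv'
    rw [h2, Option.some_inj] at h5
    exact hcol.inj h1 (h5 ▸ h3)
  have hcard := Finset.card_sdiff_add_card_inter (top G y) (good G {x, p})
  rcases Finset.eq_empty_or_nonempty (top G y \ good G {x, p}) with h0 | ⟨v, hv⟩
  · rw [h0, Finset.card_empty] at hcard
    left
    omega
  · refine Or.inr ⟨by omega, ?_⟩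
    obtain ⟨u, h1, h2, h3, h5⟩ := hex v hv
    exact (hc u h5).trans (Finset.single_le_sum (f := charge G) (fun w hw =>
      le_trans (by norm_num) (hc w (mem_lows.1 (Finset.mem_sdiff.1 hw).1))) (by simp [h1, h2, h5]))

theorem two_lt_excess_of_three (hc : ∀ u, deg G u ≤ 4 → 1 / 2 ≤ charge G u)
    (hp : deg G p = 3) (hp6 : ∀ w, G.Adj p w → deg G w = 6) : 2 < excess G := by
  have hyc := mem_clean.1 h.mem_y
  have hzc := mem_clean.1 h.mem_z
  have htc := mem_top.1 h.mem_t
  have htp := h.adj_tp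
  have ht : t ∈ top G p := mem_top.2 ⟨htp.symm, htc.2⟩
  have ht' : t ∈ top G p \ clean G p := by
    refine Finset.mem_sdiff.2 ⟨ht, fun h' => h.ne ?_⟩
    exact (mem_clean.1 h').2 x htc.1.symm (by have := h.deg_x; omega)
  have hA : (top G p).erase t ⊆ clean G p := fun a ha => by
    rw [Finset.mem_erase] at ha
    by_contra hac
    exact ha.1
      (Finset.card_le_one.1 (hG.card_not_clean_le_one hp) _ (Finset.mem_sdiff.2 ⟨ha.2, hac⟩)
      _ ht')
  have hA2 : 2 ≤ ((top G p).erase t).card := by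
    have := deg_le_card_top_add (x := p) (S := ∅) fun w hw _ => hp6 w hw
    rw [Finset.card_erase_of_mem ht]
    rw [Finset.card_empty] at this
    omega
  have hAg : (top G p).erase t ⊆ good G {x, p} := fun a ha => by
    have ha := mem_clean.1 (hA ha)
    refine mem_good.2 ⟨ha.1.2, fun u hu => ?_⟩
    rw [mem_low] at hu
    simp [ha.2 u hu.1 hu.2]
  have h1 := h.card_add_le hAg fun a ha => by
    rw [Finset.mem_erase, mem_top] at ha
    exact ⟨ha.2.1.symm, ha.1⟩
  have h2 := h.four_le_card_or hG hc
  have hnd := fun a => h.of_mem_erase (a := a)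
  have hx := h.deg_x
  have hyz := h.yz
  have hyt := h.yt
  have hzt := h.zt
  have hxp := h.ne
  have h3 : ((top G y ∩ good G {x, p}) ∩ ({z, t} ∪ (top G p).erase t)).card ≤ 2 := by
    refine (Finset.card_le_card (t := insert z
      ((top G y ∩ good G {x, p}) ∩ (top G p))) fun v hv => ?_).trans
      ((Finset.card_insert_le _ _).trans (Nat.succ_le_succ (Finset.card_le_one.2
        fun a ha b hb => by_contra fun hab => ?_)))
    · simp only [Finset.mem_inter, Finset.mem_union, Finset.mem_insert, Finset.mem_singleton,
        Finset.mem_erase] at hv ⊢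
      rcases hv with ⟨hv, (rfl | rfl) | hv'⟩
      · exact Or.inl rfl
      · exact Or.inr ⟨hv, ht⟩
      · exact Or.inr ⟨hv, hv'.2⟩
    · have s1 : ∀ a ∈ top G p, G.Adj y a → a ≠ t → G.Adj y t → False := fun a ha hya hat hyt' => by
        have := hnd a (Finset.mem_erase.2 ⟨hat, ha⟩)
        refine hG.no_triangleSquareThree (x := x) (y := y) (z := z) (t := t) (p := p) (a := a)
          ?_ hx.le hp.le
          hyc.1.1 hzc.1.1 htc.1 htp hyt' hya this.2.2.2.2.2.1
        simp
        grind (splits := 40) [SimpleGraph.irrefl]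
      rw [Finset.mem_inter, Finset.mem_inter, mem_top (v := y)] at ha hb
      by_cases hat : a = t
      · exact s1 b hb.2 hb.1.1.1 (fun e => hab (hat.trans e.symm)) (hat ▸ ha.1.1.1)
      by_cases hbt : b = t
      · exact s1 a ha.2 ha.1.1.1 hat (hbt ▸ hb.1.1.1)
      have h4 := hnd a (Finset.mem_erase.2 ⟨hat, ha.2⟩)
      have h5 := hnd b (Finset.mem_erase.2 ⟨hbt, hb.2⟩)
      refine hG.no_threeSquareThree (x := x) (y := y) (z := z) (t := t) (v := a) (u := p)
        (v' := b) ?_ hx.le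
        hp.le hyc.1.1 hzc.1.1 htc.1 ha.1.1.1 h4.2.2.2.2.2.1 hb.1.1.1 h5.2.2.2.2.2.1
      simp
      grind (splits := 40) [SimpleGraph.irrefl]
  have h4 := card_good_add_le_excess hG.deg_le h.pair_subset (B := ∅) (by simp) (by simp)
  rw [Finset.sum_pair h.ne, hx, hp] at h4
  have h5 := Finset.card_sdiff_add_card_inter (top G y ∩ good G {x, p})
    ({z, t} ∪ (top G p).erase t)
  rcases h2 with h2 | ⟨h2, h6⟩
  · have h7 : 7 ≤ (good G {x, p}).card := by omega
    have h8 : (0 : ℚ) ≤ ∑ u ∈ lows G \ {x, p}, charge G u := Finset.sum_nonneg fun u hu =>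
      le_trans (by norm_num) (hc u (mem_lows.1 (Finset.mem_sdiff.1 hu).1))
    have h9 : (7 : ℚ) ≤ (good G {x, p}).card := by exact_mod_cast h7
    norm_num at h4
    linarith
  · have h7 : 6 ≤ (good G {x, p}).card := by omega
    have h9 : (6 : ℚ) ≤ (good G {x, p}).card := by exact_mod_cast h7
    norm_num at h4
    linarith

theorem two_lt_excess_of_five (hc : ∀ u, deg G u ≤ 4 → 1 / 2 ≤ charge G u) {q : V}
    (hp : deg G p = 4) (hq : G.Adj p q) (hq5 : deg G q = 5)
    (hp6 : ∀ w, G.Adj p w → w ≠ q → deg G w = 6) : 2 < excess G := by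
  have hyc := mem_clean.1 h.mem_y
  have hzc := mem_clean.1 h.mem_z
  have htc := mem_top.1 h.mem_t
  have htp := h.adj_tp
  have ht : t ∈ top G p := mem_top.2 ⟨htp.symm, htc.2⟩
  have ht' : t ∈ top G p \ clean G p := by
    refine Finset.mem_sdiff.2 ⟨ht, fun h' => h.ne ?_⟩
    exact (mem_clean.1 h').2 x htc.1.symm (by have := h.deg_x; omega)
  have hAg : (top G p).erase t ⊆ good G {x, p} := fun a ha => by
    rw [Finset.mem_erase] at ha
    have hac : a ∈ clean G p := by_contra fun hac => ha.1 (Finset.card_le_one.1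
      (hG.card_not_clean_le_one_of_adj hp hq hq5 hp6) _ (Finset.mem_sdiff.2 ⟨ha.2, hac⟩) _ ht')
    rw [Finset.pair_comm]
    exact mem_good_of_clean hac
  have hA2 : 2 ≤ ((top G p).erase t).card := by
    have := deg_le_card_top_add (x := p) (S := {q}) fun w hw hw' => hp6 w hw (by simpa using hw')
    rw [Finset.card_erase_of_mem ht]
    rw [Finset.card_singleton] at this
    omega
  have h1 := h.card_add_le hAg fun a ha => by
    rw [Finset.mem_erase, mem_top] at ha
    exact ⟨ha.2.1.symm, ha.1⟩
  have h2 := h.four_le_card_or hG hc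
  have hx := h.deg_x
  have hyz := h.yz
  have hyt := h.yt
  have hzt := h.zt
  have hxp := h.ne
  have h4 := card_good_add_le_excess hG.deg_le h.pair_subset (B := ∅) (by simp) (by simp)
  rw [Finset.sum_pair h.ne, hx, hp] at h4
  rcases h2 with h2 | ⟨h2, h6⟩
  · have h7 : 6 ≤ (good G {x, p}).card := by
      by_contra h7
      obtain ⟨a, b, hab, hA⟩ := Finset.card_eq_two.1
        (show ((top G p).erase t).card = 2 by omega)
      have ha := h.of_mem_erase (a := a) (by simp [hA])
      have hb := h.of_mem_erase (a := b) (by simp [hA])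
      rw [hA] at h1
      rw [Finset.card_pair hab] at h1
      have h8 : top G y ∩ good G {x, p} ⊆ {z, t} ∪ {a, b} := by
        rw [← Finset.sdiff_eq_empty_iff_subset, ← Finset.card_eq_zero]
        omega
      have h9 := Finset.eq_of_subset_of_card_le h8 ((Finset.card_union_le _ _).trans
        ((add_le_add Finset.card_le_two Finset.card_le_two).trans h2))
      have h10 : ∀ v ∈ ({z, t} ∪ {a, b} : Finset V), G.Adj y v := fun v hv => by
        rw [← h9, Finset.mem_inter, mem_top] at hv
        exact hv.1.1
      refine hG.no_triangleSquaresFour (x := x) (y := y) (z := z) (t := t) (p := p) (a := a)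
        (b := b) ?_ hx.le hp.le
        hyc.1.1 hzc.1.1 htc.1 htp (h10 t (by simp)) (h10 a (by simp)) ha.2.2.2.2.2.1
        (h10 b (by simp)) hb.2.2.2.2.2.1
      clear h8 h9 h10 hA h4 h1
      simp
      grind (splits := 40) [SimpleGraph.irrefl]
    have h8 : (0 : ℚ) ≤ ∑ u ∈ lows G \ {x, p}, charge G u := Finset.sum_nonneg fun u hu =>
      le_trans (by norm_num) (hc u (mem_lows.1 (Finset.mem_sdiff.1 hu).1))
    have h9 : (6 : ℚ) ≤ (good G {x, p}).card := by exact_mod_cast h7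
    norm_num at h4
    linarith
  · have h7 : 5 ≤ (good G {x, p}).card := by omega
    have h9 : (5 : ℚ) ≤ (good G {x, p}).card := by exact_mod_cast h7
    norm_num at h4
    linarith

theorem two_lt_excess_of_four (hc : ∀ u, deg G u ≤ 4 → 1 / 2 ≤ charge G u)
    (hp : deg G p = 4) (hp6 : ∀ w, G.Adj p w → deg G w = 6) : 2 < excess G := by
  have htc := mem_top.1 h.mem_t
  have htp := h.adj_tp
  have hx := h.deg_x
  have ht : t ∈ top G p := mem_top.2 ⟨htp.symm, htc.2⟩
  have htn : t ∉ clean G p := fun h' => h.ne ((mem_clean.1 h').2 x htc.1.symm (by omega))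
  have hA3 : 3 ≤ ((top G p).erase t).card := by
    have := deg_le_card_top_add (x := p) (S := ∅) fun w hw _ => hp6 w hw
    rw [Finset.card_erase_of_mem ht]
    rw [Finset.card_empty] at this
    omega
  have hAl : ∀ a ∈ (top G p).erase t, (low G a).card ≤ 2 := fun a ha => by
    by_contra hcard
    have ha' := h.of_mem_erase ha
    exact htn (hG.mem_clean_of_card_low hp hp6 ha'.2.2.2.2.2.1.symm (by omega) htp.symm
      ha'.2.2.2.1.symm)
  have h1 := h.card_add_le (A := (top G p).erase t ∩ good G {x, p}) Finset.inter_subset_right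
    fun a ha => by
      have ha' := h.of_mem_erase (Finset.mem_inter.1 ha).1
      exact ⟨ha'.2.2.2.2.2.1, ha'.2.2.2.1⟩
  have h2 := h.four_le_card_or hG hc
  have h4 := card_good_add_le_excess hG.deg_le h.pair_subset
    (B := (top G p).erase t \ good G {x, p})
    (Finset.sdiff_subset_sdiff (fun a ha => mem_tops.2 (h.of_mem_erase ha).2.2.2.2.2.2) le_rfl)
    fun a ha => by
      have ha := (Finset.mem_sdiff.1 ha).1
      have ha' := h.of_mem_erase ha
      have h5 := hAl a ha
      have h6 : p ∈ low G a := mem_low.2 ⟨ha'.2.2.2.2.2.1, h.deg_p⟩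
      have h7 : (low G a \ {x, p}).card < (low G a).card := Finset.card_lt_card
        (Finset.ssubset_iff_subset_ne.2 ⟨Finset.sdiff_subset, fun e => by
          rw [← e] at h6
          simp at h6⟩)
      rw [share]
      generalize (low G a).card = m at *
      generalize (low G a \ {x, p}).card = n at *
      interval_cases m <;> interval_cases n <;> norm_num
  rw [Finset.sum_pair h.ne, hx, hp] at h4
  have h5 := Finset.card_sdiff_add_card_inter ((top G p).erase t) (good G {x, p})
  have h6 := Finset.le_card_sdiff ({z, t} ∪ ((top G p).erase t ∩ good G {x, p}))
    (top G y ∩ good G {x, p})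
  have h7 := Finset.card_union_le {z, t} ((top G p).erase t ∩ good G {x, p})
  have h8 := Finset.card_le_two (a := z) (b := t)
  norm_num at h4
  have h9 : (0 : ℚ) ≤ ∑ u ∈ lows G \ {x, p}, charge G u := Finset.sum_nonneg fun u hu =>
    le_trans (by norm_num) (hc u (mem_lows.1 (Finset.mem_sdiff.1 hu).1))
  rcases h2 with h2 | ⟨h2, h10⟩
  · have h11 : 11 ≤ 2 * (good G {x, p}).card + ((top G p).erase t \ good G {x, p}).card := by omega
    have h12 : (11 : ℚ) ≤ 2 * (good G {x, p}).card + ((top G p).erase t \ good G {x, p}).card := by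
      exact_mod_cast h11
    linarith
  · have h11 : 10 ≤ 2 * (good G {x, p}).card + ((top G p).erase t \ good G {x, p}).card := by omega
    have h12 : (10 : ℚ) ≤ 2 * (good G {x, p}).card + ((top G p).erase t \ good G {x, p}).card := by
      exact_mod_cast h11
    linarith
end Linked
end Discharging4
end Kempe

namespace Kempe
section Discharging5
open Classical
variable [Fintype V] {G : SimpleGraph V}

/-- Every vertex of degree at most four has degree three or four, has no neighbors of small degree
and, apart from one possible neighbor of degree five in case its degree is four, all its neighbors
have degree six. -/
def Tame (G : SimpleGraph V) : Prop :=
  ∀ x, deg G x ≤ 4 → (deg G x = 3 ∧ ∀ w, G.Adj x w → deg G w = 6) ∨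
    (deg G x = 4 ∧ ∃ q, G.Adj x q ∧ deg G q = 5 ∧ ∀ w, G.Adj x w → w ≠ q → deg G w = 6) ∨
    (deg G x = 4 ∧ ∀ w, G.Adj x w → deg G w = 6)

omit [Fintype V] in
theorem Tame.three_le_deg (h : Tame G) (v : V) : 3 ≤ deg G v := by
  by_contra hv
  rcases h v (by omega) with h | h | h <;> omega

namespace Critical
variable (hG : Critical 6 G)
include hG

theorem half_le_charge_of_tame (h : Tame G) {u : V} (hu : deg G u ≤ 4) : 1 / 2 ≤ charge G u := by
  rcases h u hu with ⟨h1, h2⟩ | ⟨h1, q, h2, h3, h4⟩ | ⟨h1, h2⟩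
  · exact hG.half_le_charge h1 h2
  · exact le_trans (by norm_num) (hG.four_div_three_le_charge h1 h2 h3 h4)
  · exact le_trans (by norm_num) (hG.one_le_charge h1 h2)

theorem two_lt_excess_of_notMem_clean (h : Tame G) {x t : V} (hx : deg G x = 3)
    (ht : t ∈ top G x) (htc : t ∉ clean G x) : 2 < excess G := by
  have hx6 : ∀ w, G.Adj x w → deg G w = 6 := by
    rcases h x (by omega) with h1 | h1 | h1
    · exact h1.2
    · omega
    · omega
  obtain ⟨p, h1, h2, h3⟩ := exists_of_notMem_clean ht htc
  obtain ⟨y, hy, hyt⟩ := exists_adj_notMem (G := G) (x := x) (S := {t}) (by simp; omega)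
  obtain ⟨z, hz, hzt⟩ := exists_adj_notMem (G := G) (x := x) (S := {y, t})
    (by have := Finset.card_le_two (a := y) (b := t); omega)
  simp only [Finset.mem_insert, Finset.mem_singleton, not_or] at hyt hzt
  have hcl : ∀ v, G.Adj x v → v ≠ t → v ∈ clean G x := fun v hv hvt => by_contra fun hc => hvt <|
    Finset.card_le_one.1 (hG.card_not_clean_le_one hx) _
      (Finset.mem_sdiff.2 ⟨mem_top.2 ⟨hv, hx6 v hv⟩, hc⟩) _ (Finset.mem_sdiff.2 ⟨ht, htc⟩)
  have hl : Linked G x y z t p :=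
    { deg_x := hx, deg_p := h3, ne := h1.symm, mem_y := hcl y hy hyt, mem_z := hcl z hz hzt.2
      mem_t := ht, yz := Ne.symm hzt.1, yt := hyt, zt := hzt.2
      low_t := by
        refine (Finset.eq_of_subset_of_card_le ?_ ?_).symm
        · simp [Finset.insert_subset_iff, (mem_top.1 ht).1.symm, hx, h2, h3]
        · rw [Finset.card_pair h1.symm]
          exact (hG.card_low_le ht).trans (by omega) }
  have hc := fun u => hG.half_le_charge_of_tame h (u := u)
  rcases h p h3 with ⟨h4, h5⟩ | ⟨h4, q, h5, h6, h7⟩ | ⟨h4, h5⟩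
  · exact hl.two_lt_excess_of_three hG hc h4 h5
  · exact hl.two_lt_excess_of_five hG hc h4 h5 h6 h7
  · exact hl.two_lt_excess_of_four hG hc h4 h5

theorem one_le_charge_of_tame (h : Tame G)
    (hcl : ∀ x, deg G x = 3 → ∀ t ∈ top G x, t ∈ clean G x) {u : V} (hu : deg G u ≤ 4) :
    1 ≤ charge G u := by
  rcases h u hu with ⟨h1, h2⟩ | ⟨h1, q, h2, h3, h4⟩ | ⟨h1, h2⟩
  · have h5 := deg_le_card_top_add (x := u) (S := ∅) fun w hw _ => h2 w hw
    rw [Finset.card_empty] at h5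
    have h6 := le_charge hu (b := 2) (c := 3) (n := 3)
      (fun v hv => (hG.card_low_le hv).trans (by omega)) (by simp)
      (le_card_clean (m := 0) (by omega) (le_of_eq (Finset.card_eq_zero.2
        (Finset.sdiff_eq_empty_iff_subset.2 (hcl u h1))))) (by omega)
    rw [h1] at h6
    norm_num at h6
    linarith
  · exact le_trans (by norm_num) (hG.four_div_three_le_charge h1 h2 h3 h4)
  · exact hG.one_le_charge h1 h2

theorem two_lt_excess_of_lows_eq_empty (h : lows G = ∅) : 2 < excess G := by
  obtain ⟨v, hv⟩ := hG.exists_deg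
  have h5 : ∀ w, 5 ≤ deg G w := fun w => by
    by_contra hw
    have : w ∈ lows G := mem_lows.2 (by omega)
    simp [h] at this
  have h2 : 2 ≤ (top G v).card := by
    by_cases h6 : ∀ w, G.Adj v w → deg G w = 6
    · have := deg_le_card_top_add (x := v) (S := ∅) fun w hw _ => h6 w hw
      rw [Finset.card_empty] at this
      omega
    · push Not at h6
      obtain ⟨w, hw, hw6⟩ := h6
      have := hG.card_top hw.symm
      have := hG.deg_le w
      omega
  refine hG.two_lt_excess_of_neighborhood (U := ∅) (d := 0) (z := v)
    (fun w => le_trans (by norm_num) (h5 w)) (by simp) (by simp) hv (by simpa using h2) ?_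
  intro w _ u _ _ hu
  have := h5 u
  omega

theorem two_lt_excess_of_lows_eq_singleton (h : Tame G) {x : V} (hl : lows G = {x}) :
    2 < excess G := by
  have hx : deg G x ≤ 4 := mem_lows.1 (by simp [hl])
  have hx3 := h.three_le_deg x
  have h1 : 1 ≤ (top G x).card := by
    rcases h x hx with ⟨h1, h2⟩ | ⟨h1, q, h2, h3, h4⟩ | ⟨h1, h2⟩
    · have := deg_le_card_top_add (x := x) (S := ∅) fun w hw _ => h2 w hw
      rw [Finset.card_empty] at this
      omega
    · have := hG.card_top h2.symm
      omega
    · have := deg_le_card_top_add (x := x) (S := ∅) fun w hw _ => h2 w hw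
      rw [Finset.card_empty] at this
      omega
  obtain ⟨z, hz⟩ := Finset.card_pos.1 h1
  rw [mem_top] at hz
  have h2 := hG.card_top hz.1
  refine hG.two_lt_excess_of_neighborhood h.three_le_deg (U := {x}) (d := 5 - deg G x) (z := z)
    hl.ge ?_ hz.2 (by omega) ?_
  · rw [Finset.sum_singleton, Nat.cast_sub (by omega)]
    simp
  · intro w _ u hu _ hu4
    rw [← hl] at hu
    exact hu (mem_lows.2 hu4)

theorem two_lt_excess_of_lows_eq_pair (h : Tame G)
    (hcl : ∀ x, deg G x = 3 → ∀ t ∈ top G x, t ∈ clean G x) {x u : V} (hxu : x ≠ u)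
    (hl : lows G = {x, u}) : 2 < excess G := by
  by_contra hle
  have hx : deg G x ≤ 4 := mem_lows.1 (by simp [hl])
  have hu : deg G u ≤ 4 := mem_lows.1 (by simp [hl])
  have hmem : ∀ w, deg G w ≤ 4 → w = x ∨ w = u := fun w hw => by
    have : w ∈ lows G := mem_lows.2 hw
    simpa [hl] using this
  have h1 := le_excess hG.deg_le (U := ∅) (S := free G) (by simp) (Finset.filter_subset _ _)
    fun v hv => by simp [(mem_free.1 hv).2]
  rw [Finset.sdiff_empty, Finset.sum_empty, hl, Finset.sum_pair hxu] at h1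
  have hcx := hG.one_le_charge_of_tame h hcl hx
  have hcu := hG.one_le_charge_of_tame h hcl hu
  have hx1 : charge G x ≤ 1 := by linarith [Nat.cast_nonneg (α := ℚ) (free G).card]
  have hu1 : charge G u ≤ 1 := by linarith [Nat.cast_nonneg (α := ℚ) (free G).card]
  have hfree : ∀ v, deg G v = 6 → v ∈ top G x ∨ v ∈ top G u := by
    intro v hv
    have h2 : v ∉ free G := fun hvf => by
      have : (1 : ℚ) ≤ (free G).card := by exact_mod_cast Finset.card_pos.2 ⟨v, hvf⟩
      linarith
    have h3 : (low G v).Nonempty := by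
      rw [Finset.nonempty_iff_ne_empty]
      exact fun h4 => h2 (mem_free.2 ⟨hv, h4⟩)
    obtain ⟨w, hw⟩ := h3
    rw [mem_low] at hw
    rcases hmem w hw.2 with rfl | rfl
    · exact Or.inl (mem_top.2 ⟨hw.1.symm, hv⟩)
    · exact Or.inr (mem_top.2 ⟨hw.1.symm, hv⟩)
  have hlow2 : ∀ v, (low G v).card ≤ 2 := fun v =>
    (Finset.card_le_card (t := {x, u}) fun w hw => by
      simpa using hmem w (mem_low.1 hw).2).trans Finset.card_le_two
  have hnot : ∀ w, deg G w ≤ 4 → charge G w ≤ 1 → ¬(deg G w = 4 ∧ ∃ q, G.Adj w q ∧ deg G q = 5 ∧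
      ∀ w', G.Adj w w' → w' ≠ q → deg G w' = 6) := by
    rintro w hw hw1 ⟨h2, q, h3, h4, h5⟩
    linarith [hG.four_div_three_le_charge h2 h3 h4 h5]
  have h6 : ∀ w, deg G w ≤ 4 → charge G w ≤ 1 → ∀ w', G.Adj w w' → deg G w' = 6 := by
    intro w hw hw1
    rcases h w hw with h2 | h2 | h2
    · exact h2.2
    · exact absurd h2 (hnot w hw hw1)
    · exact h2.2
  have hx6 := h6 x hx hx1
  have hu6 := h6 u hu hu1
  have hxc := deg_le_card_top_add (x := x) (S := ∅) fun w hw _ => hx6 w hw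
  have huc := deg_le_card_top_add (x := u) (S := ∅) fun w hw _ => hu6 w hw
  rw [Finset.card_empty, add_zero] at hxc huc
  have hx3 := h.three_le_deg x
  have hu3 := h.three_le_deg u
  have hclean : ∀ w, deg G w = 4 → charge G w ≤ 1 → 4 ≤ (top G w).card → ∀ v ∈ top G w,
      v ∉ clean G w := by
    intro w hw hw1 hw4 v hv hvc
    have h2 := le_charge (x := w) hw.le (b := 2) (c := 1) (n := 4) (fun v _ => hlow2 v) (by simp)
      (Finset.card_pos.2 ⟨v, hvc⟩) hw4
    rw [hw] at h2
    norm_num at h2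
    linarith
  have hmixed : ∀ a b, a ≠ b → deg G a = 3 → deg G b = 4 → charge G b ≤ 1 →
      4 ≤ (top G b).card → (∀ w, deg G w ≤ 4 → w = a ∨ w = b) → False := by
    intro a b hab ha hb hb1 hb4 hw
    obtain ⟨v, hv⟩ := Finset.card_pos.1 (show 0 < (top G b).card by omega)
    refine hclean b hb hb1 hb4 v hv (mem_clean_of_forall hv fun w h2 h3 h4 => ?_)
    rw [mem_top] at hv
    obtain rfl : w = a := (hw w h4).resolve_right h2
    exact hab ((mem_clean.1 (hcl w ha v (mem_top.2 ⟨h3.symm, hv.2⟩))).2 b hv.1.symm (by omega)).symm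
  rcases (show deg G x = 3 ∨ deg G x = 4 by omega) with hxd | hxd <;>
    rcases (show deg G u = 3 ∨ deg G u = 4 by omega) with hud | hud
  · obtain ⟨y, hy⟩ := Finset.card_pos.1 (show 0 < (top G x).card by omega)
    have hy' := mem_top.1 hy
    have h2 := hG.card_top hy'.1
    have hx3' : (top G x).card ≤ 3 := by
      rw [← hxd, deg_eq_card]
      exact Finset.card_le_card fun w hw => by simpa using (mem_top.1 hw).1
    have h3 : top G y ⊆ (top G x).erase y ∪ (top G y ∩ top G u) := fun w hw => by
      rw [Finset.mem_union, Finset.mem_erase, Finset.mem_inter]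
      rcases hfree w (mem_top.1 hw).2 with h4 | h4
      · exact Or.inl ⟨(mem_top.1 hw).1.ne', h4⟩
      · exact Or.inr ⟨hw, h4⟩
    have h4 := (Finset.card_le_card h3).trans (Finset.card_union_le _ _)
    rw [Finset.card_erase_of_mem hy] at h4
    obtain ⟨v, hv, v', hv', hvv⟩ := Finset.one_lt_card.1
      (show 1 < (top G y ∩ top G u).card by omega)
    rw [Finset.mem_inter, mem_top, mem_top] at hv hv'
    obtain ⟨z, hz, hzy⟩ := exists_adj_notMem (G := G) (x := x) (S := {y}) (by simp; omega)
    obtain ⟨t, ht, hty⟩ := exists_adj_notMem (G := G) (x := x) (S := {y, z})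
      (by have := Finset.card_le_two (a := y) (b := z); omega)
    simp only [Finset.mem_insert, Finset.mem_singleton, not_or] at hzy hty
    have hn : ∀ a, G.Adj x a → ¬G.Adj a u := fun a ha hau => hxu
      ((mem_clean.1 (hcl x hxd a (mem_top.2 ⟨ha, hx6 a ha⟩))).2 u hau hu).symm
    have hnv : ∀ a b, G.Adj x a → G.Adj u b → a ≠ b := fun a b ha hb hab =>
      hn a ha (hab ▸ hb.symm)
    have f1 := hnv z v hz hv.2.1
    have f2 := hnv z v' hz hv'.2.1
    have f3 := hnv t v ht hv.2.1
    have f4 := hnv t v' ht hv'.2.1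
    have hz6 := hx6 z hz
    have ht6 := hx6 t ht
    refine hG.no_threeSquareThree (x := x) (y := y) (z := z) (t := t) (v := v) (u := u) (v' := v')
      ?_ hxd.le
      hud.le hy'.1 hz ht hv.1.1 hv.2.1.symm hv'.1.1 hv'.2.1.symm
    clear hn hnv hfree hmem hnot h6 hclean hmixed hx6 hu6 hl hlow2 hcl h1 hle h3 h4
    simp
    grind (splits := 40) [SimpleGraph.irrefl]
  · exact hmixed x u hxu hxd hud hu1 (by omega) hmem
  · exact hmixed u x hxu.symm hud hxd hx1 (by omega) fun w hw => (hmem w hw).symm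
  · have hsub : ∀ a b, deg G a = 4 → charge G a ≤ 1 → 4 ≤ (top G a).card →
        (∀ w, deg G w ≤ 4 → w = a ∨ w = b) → top G a ⊆ top G b := by
      intro a b ha ha1 ha4 hw v hv
      obtain ⟨w, h2, h3, h4⟩ := exists_of_notMem_clean hv (hclean a ha ha1 ha4 v hv)
      obtain rfl := (hw w h4).resolve_left h2
      exact mem_top.2 ⟨h3.symm, (mem_top.1 hv).2⟩
    have h2 := hsub x u hxd hx1 (by omega) hmem
    have h3 := hsub u x hud hu1 (by omega) fun w hw => (hmem w hw).symm
    have hx4 : (top G x).card = 4 := by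
      refine le_antisymm ?_ (by omega)
      rw [← hxd, deg_eq_card]
      exact Finset.card_le_card fun w hw => by simpa using (mem_top.1 hw).1
    have hcliq : ∀ a ∈ top G x, ∀ b ∈ top G x, a ≠ b → G.Adj a b := by
      intro a ha b hb hab
      have h4 : top G a ⊆ (top G x).erase a := fun w hw => by
        rw [Finset.mem_erase]
        refine ⟨(mem_top.1 hw).1.ne', ?_⟩
        rcases hfree w (mem_top.1 hw).2 with h5 | h5
        · exact h5
        · exact h3 h5
      have h5 := hG.card_top (mem_top.1 ha).1
      have h6 := Finset.eq_of_subset_of_card_le h4 (by rw [Finset.card_erase_of_mem ha]; omega)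
      exact (mem_top.1 (h6 ▸ Finset.mem_erase.2 ⟨hab.symm, hb⟩ : b ∈ top G a)).1
    have hN : ∀ a ∈ top G x, G.Adj x a ∧ G.Adj u a ∧ deg G a = 6 := fun a ha =>
      ⟨(mem_top.1 ha).1, (mem_top.1 (h2 ha)).1, (mem_top.1 ha).2⟩
    obtain ⟨y, z, s, t, h4, h5, h6, h7, h8, h9, h10⟩ := Finset.card_eq_four.1 hx4
    have hy : y ∈ top G x := by simp [h10]
    have hz : z ∈ top G x := by simp [h10]
    have hs : s ∈ top G x := by simp [h10]
    have ht : t ∈ top G x := by simp [h10]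
    have hy' := hN y hy
    have hz' := hN z hz
    have hs' := hN s hs
    have ht' := hN t ht
    refine hG.no_completeMinusEdge (x := x) (y := y) (z := z) (s := s) (t := t) (u := u)
      ?_ hx hu hy'.1 hz'.1
      hs'.1 ht'.1 hy'.2.1 hz'.2.1 hs'.2.1 ht'.2.1 (hcliq y hy z hz h4) (hcliq y hy s hs h5)
      (hcliq y hy t ht h6) (hcliq z hz s hs h7) (hcliq z hz t ht h8) (hcliq s hs t ht h9)
    clear hfree hmem hnot hclean hmixed hx6 hu6 hl hlow2 hcl h1 hle h2 h3 hN hcliq h10 hsub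
    simp
    grind (splits := 40) [SimpleGraph.irrefl]

theorem two_lt_excess_of_tame (h : Tame G) : 2 < excess G := by
  by_cases hcl : ∀ x, deg G x = 3 → ∀ t ∈ top G x, t ∈ clean G x
  · rcases Nat.lt_or_ge (lows G).card 3 with h1 | h1
    · generalize hk : (lows G).card = k at h1
      interval_cases k
      · exact hG.two_lt_excess_of_lows_eq_empty (Finset.card_eq_zero.1 hk)
      · obtain ⟨x, hx⟩ := Finset.card_eq_one.1 hk
        exact hG.two_lt_excess_of_lows_eq_singleton h hx
      · obtain ⟨x, u, hxu, hl⟩ := Finset.card_eq_two.1 hk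
        exact hG.two_lt_excess_of_lows_eq_pair h hcl hxu hl
    · have h2 := le_excess hG.deg_le (U := ∅) (S := ∅) (by simp) (by simp) (by simp)
      have h3 := Finset.card_nsmul_le_sum (lows G) (charge G) 1 fun u hu =>
        hG.one_le_charge_of_tame h hcl (mem_lows.1 hu)
      have h4 : (3 : ℚ) ≤ (lows G).card := by exact_mod_cast h1
      simp at h2 h3
      linarith
  · push Not at hcl
    obtain ⟨x, hx, t, ht, htc⟩ := hcl
    exact hG.two_lt_excess_of_notMem_clean h hx ht htc

theorem two_lt_excess : 2 < excess G := by
  by_cases h2 : ∃ x, deg G x = 2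
  · obtain ⟨x, hx⟩ := h2
    exact hG.two_lt_excess_of_twos hx
  have h3 : ∀ v, 3 ≤ deg G v := fun v => by
    have := hG.two_le_deg v
    have : deg G v ≠ 2 := fun h => h2 ⟨v, h⟩
    omega
  by_cases hB : ∀ x x', G.Adj x x' → deg G x ≤ 4 → 5 ≤ deg G x'
  · by_cases hC : ∃ x y, deg G x = 3 ∧ G.Adj x y ∧ deg G y ≤ 5
    · obtain ⟨x, y, h4, h5, h6⟩ := hC
      exact hG.two_lt_excess_of_adj_five h3 h4 h5 h6
    by_cases hD : ∃ x y z, deg G x = 4 ∧ G.Adj x y ∧ G.Adj x z ∧ y ≠ z ∧ deg G y = 5 ∧ deg G z = 5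
    · obtain ⟨x, y, z, h4, h5, h6, h7, h8, h9⟩ := hD
      exact hG.two_lt_excess_of_two_five h3 hB h4 h5 h6 h7 h8 h9
    push Not at hC hD
    refine hG.two_lt_excess_of_tame fun x hx => ?_
    have h56 : ∀ w, G.Adj x w → deg G w ≠ 5 → deg G w = 6 := fun w hw hw5 => by
      have := hG.deg_le w
      have := hB x w hw hx
      omega
    have hx3 := h3 x
    rcases (show deg G x = 3 ∨ deg G x = 4 by omega) with hxd | hxd
    · exact Or.inl ⟨hxd, fun w hw => h56 w hw (hC x w hxd hw).ne'⟩
    by_cases hq : ∃ q, G.Adj x q ∧ deg G q = 5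
    · obtain ⟨q, hq, hq5⟩ := hq
      exact Or.inr (Or.inl ⟨hxd, q, hq, hq5, fun w hw hwq => h56 w hw
        (hD x q w hxd hq hw hwq.symm hq5)⟩)
    · exact Or.inr (Or.inr ⟨hxd, fun w hw => h56 w hw fun h => hq ⟨w, hw, h⟩⟩)
  · push Not at hB
    obtain ⟨x, x', h, h4, h5⟩ := hB
    exact hG.two_lt_excess_of_adj h3 h4 (by omega) h

end Critical
end Discharging5
end Kempe

/-- If `G` is 6-critical, then `2·|E(G)| ≥ 5·|V(G)| + 3`. -/
theorem edge_bound_6critical [Fintype V] (G : SimpleGraph V)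
    (hG : IsKCritical G 6) :
    5 * Fintype.card V + 3 ≤ 2 * G.edgeSet.ncard := by
  exact Kempe.five_mul_card_add_three_le
    (Kempe.Critical.of_isKCritical (by norm_num) hG).two_lt_excess
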